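/- arXiv:0711.4739 — 2 statements merged into one kernel-verified Lean document; each statement's English description precedes it below -/
import Mathlib

section
/- Let {a_n, b_n}_{n=1}^∞ be Jacobi parameters with ∑_{n=1}^∞ (|a_n − 1| + |b_n|) < ∞, and let μ be the associated measure. Then the Szegő condition holds: ∫_{−2}^{2} (4 − x²)^{−1/2} log w(x) dx > −∞. -/
open MeasureTheory Filter Set Metric

noncomputable section

/-- The (topological) support of a measure: points all of whose neighborhoods
have positive measure. -/
def msupport {X : Type*} [TopologicalSpace X] [MeasurableSpace X] (μ : Measure X) : Set X :=
  {x | ∀ U ∈ nhds x, 0 < μ U}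

/-- The essential spectrum of a measure: the accumulation points of its support. -/
def essSpec (μ : Measure ℝ) : Set ℝ := {x | AccPt x (Filter.principal (msupport μ))}

/-- `a b : ℕ → ℝ` (indexed from 1; index 0 unused) are the Jacobi parameters of the
measure `μ`: there is a family of orthonormal polynomials `p n` of degree `n` with
positive leading coefficients satisfying the three-term recursion
`x pₙ = a_{n+1} p_{n+1} + b_{n+1} pₙ + aₙ p_{n-1}` (with `p_{-1} = 0`). -/
def IsJacobiParams (μ : Measure ℝ) (a b : ℕ → ℝ) : Prop :=
  ∃ p : ℕ → Polynomial ℝ,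
    (∀ n, (p n).natDegree = n) ∧
    (∀ n, 0 < (p n).leadingCoeff) ∧
    (∀ m n, ∫ x, (p m).eval x * (p n).eval x ∂μ = if m = n then 1 else 0) ∧
    (∀ n : ℕ, ∀ x : ℝ,
      x * (p n).eval x =
        a (n + 1) * (p (n + 1)).eval x + b (n + 1) * (p n).eval x +
          (if n = 0 then 0 else a n * (p (n - 1)).eval x))

/-- The a.c. density `w` of a measure on `ℝ` (w.r.t. Lebesgue measure). -/
def densityOf (μ : Measure ℝ) : ℝ → ℝ := fun x => (μ.rnDeriv volume x).toReal

lemma exists_norm_eval_le_of_degree_le {N D : Polynomial ℂ} {Z : Set ℂ} (hZ : IsClosed Z)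
    (hD : ∀ z ∈ Z, D.eval z ≠ 0) (hdeg : N.degree ≤ D.degree) :
    ∃ C : ℝ, ∀ z ∈ Z, ‖N.eval z‖ ≤ C * ‖D.eval z‖ := by
  obtain ⟨C, hC⟩ := (Polynomial.isBigO_cobounded_of_degree_le hdeg).bound
  rw [Metric.cobounded_eq_cocompact, Filter.Eventually, mem_cocompact] at hC
  obtain ⟨K, hK, hKC⟩ := hC
  have hc : ContinuousOn (fun z => ‖N.eval z‖ / ‖D.eval z‖) (K ∩ Z) := by
    refine ContinuousOn.div (by fun_prop) (by fun_prop) fun z hz => ?_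
    simpa using hD z hz.2
  obtain ⟨C', hC'⟩ := (hK.inter_right hZ).bddAbove_image hc
  refine ⟨max C C', fun z hz => ?_⟩
  have hpos : 0 < ‖D.eval z‖ := norm_pos_iff.2 (hD z hz)
  by_cases hzK : z ∈ K
  · have := hC' (mem_image_of_mem _ ⟨hzK, hz⟩)
    rw [div_le_iff₀ hpos] at this
    exact this.trans (mul_le_mul_of_nonneg_right (le_max_right _ _) hpos.le)
  · exact (hKC hzK).trans (mul_le_mul_of_nonneg_right (le_max_left _ _) hpos.le)

lemma tendsto_const_div_one_add_sq_mul (C : ℝ) :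
    Tendsto (fun T : ℝ => C / (1 + T ^ 2) * (4 * T)) atTop (nhds 0) := by
  have h : Tendsto (fun T : ℝ => 4 * |C| * T⁻¹) atTop (nhds 0) := by
    simpa using tendsto_inv_atTop_zero.const_mul (4 * |C|)
  refine squeeze_zero_norm' ?_ h
  filter_upwards [eventually_gt_atTop 0] with T hT
  have h1 : (0 : ℝ) < 1 + T ^ 2 := by positivity
  rw [norm_mul, norm_div, Real.norm_eq_abs, Real.norm_eq_abs, Real.norm_eq_abs,
    abs_of_pos h1, abs_of_pos (by positivity : 0 < 4 * T)]
  rw [← div_eq_mul_inv, div_mul_eq_mul_div, div_le_div_iff₀ h1 hT]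
  nlinarith [abs_nonneg C]

lemma integral_real_eq_zero_of_upper_halfPlane {f : ℂ → ℂ} {C : ℝ}
    (hd : ∀ z : ℂ, 0 ≤ z.im → DifferentiableAt ℂ f z)
    (hb : ∀ z : ℂ, 0 ≤ z.im → ‖f z‖ ≤ C / (1 + ‖z‖ ^ 2)) :
    Integrable (fun x : ℝ => f x) ∧ ∫ x : ℝ, f x = 0 := by
  have hint : Integrable (fun x : ℝ => f x) := by
    refine (integrable_inv_one_add_sq.const_mul C).mono' ?_ ?_
    · refine Continuous.aestronglyMeasurable ?_
      refine continuous_iff_continuousAt.2 fun x => ?_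
      exact ContinuousAt.comp (f := fun x : ℝ => (x : ℂ)) (hd x (by simp)).continuousAt
        Complex.continuous_ofReal.continuousAt
    · refine ae_of_all _ fun x => ?_
      simpa [div_eq_mul_inv] using hb x (by simp)
  refine ⟨hint, ?_⟩
  have hC : 0 ≤ C := by
    have := (norm_nonneg _).trans (hb 0 (by simp))
    simpa using this
  have h1 : Tendsto (fun T : ℝ => ∫ x in (-T)..T, f x) atTop (nhds (∫ x : ℝ, f x)) :=
    intervalIntegral_tendsto_integral hint tendsto_neg_atTop_atBot tendsto_id
  refine tendsto_nhds_unique h1 ?_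
  refine squeeze_zero_norm' ?_ (tendsto_const_div_one_add_sq_mul C)
  filter_upwards [eventually_gt_atTop 0] with T hT
  have key := Complex.integral_boundary_rect_eq_zero_of_differentiableOn f (-(T : ℂ))
    (T + T * Complex.I) (by
      intro z hz
      refine (hd z ?_).differentiableWithinAt
      have := hz.2
      simp only [mem_preimage, Complex.neg_im, Complex.ofReal_im, neg_zero, Complex.add_im,
        Complex.mul_im, Complex.ofReal_re, Complex.I_im, mul_one, Complex.I_re, mul_zero,
        add_zero, zero_add] at this
      rw [uIcc_of_le hT.le] at this
      exact this.1)
  simp only [Complex.neg_im, Complex.ofReal_im, neg_zero, Complex.add_im, Complex.neg_re,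
    Complex.mul_im, Complex.ofReal_re, Complex.I_im, mul_one, Complex.I_re, mul_zero,
    add_zero, zero_add, Complex.add_re, Complex.mul_re, sub_self, Complex.ofReal_zero,
    zero_mul] at key
  have hT2 : ∀ z : ℂ, 0 ≤ z.im → T ≤ ‖z‖ → ‖f z‖ ≤ C / (1 + T ^ 2) := fun z hz hzT =>
    (hb z hz).trans (div_le_div_of_nonneg_left hC (by positivity) (by gcongr))
  have e1 : ‖∫ x : ℝ in (-T)..T, f (x + T * Complex.I)‖ ≤ C / (1 + T ^ 2) * |T - (-T)| := by
    refine intervalIntegral.norm_integral_le_of_norm_le_const fun x _ => hT2 _ (by simp [hT.le]) ?_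
    have := Complex.abs_im_le_norm (x + T * Complex.I)
    simpa [abs_of_pos hT] using this
  have e2 : ‖∫ y : ℝ in (0 : ℝ)..T, f (T + y * Complex.I)‖ ≤ C / (1 + T ^ 2) * |T - 0| := by
    refine intervalIntegral.norm_integral_le_of_norm_le_const fun y hy => hT2 _ ?_ ?_
    · rw [uIoc_of_le hT.le] at hy
      simpa using hy.1.le
    · have := Complex.abs_re_le_norm (T + y * Complex.I)
      simpa [abs_of_pos hT] using this
  have e3 : ‖∫ y : ℝ in (0 : ℝ)..T, f (((-T : ℝ) : ℂ) + y * Complex.I)‖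
      ≤ C / (1 + T ^ 2) * |T - 0| := by
    refine intervalIntegral.norm_integral_le_of_norm_le_const fun y hy => hT2 _ ?_ ?_
    · rw [uIoc_of_le hT.le] at hy
      simpa using hy.1.le
    · have := Complex.abs_re_le_norm (((-T : ℝ) : ℂ) + y * Complex.I)
      simpa [abs_of_pos hT] using this
  set J1 := ∫ x : ℝ in (-T)..T, f x
  set J2 := ∫ x : ℝ in (-T)..T, f (x + T * Complex.I)
  set J3 := ∫ y : ℝ in (0 : ℝ)..T, f (T + y * Complex.I)
  set J4 := ∫ y : ℝ in (0 : ℝ)..T, f (((-T : ℝ) : ℂ) + y * Complex.I)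
  have hJ : J1 = J2 - Complex.I • J3 + Complex.I • J4 := by
    linear_combination key
  rw [hJ]
  have n1 := norm_add_le (J2 - Complex.I • J3) (Complex.I • J4)
  have n2 := norm_sub_le J2 (Complex.I • J3)
  rw [norm_smul, Complex.norm_I, one_mul] at n1 n2
  rw [abs_of_pos (by linarith)] at e1 e2 e3
  linarith

/-- A rational function with no poles in the closed upper half-plane that decays
quadratically has vanishing integral over the real line. -/
lemma integral_eval_div_eval_eq_zero {N D : Polynomial ℂ}
    (hD : ∀ z : ℂ, 0 ≤ z.im → D.eval z ≠ 0) (hdeg : N.natDegree + 2 ≤ D.natDegree) :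
    Integrable (fun x : ℝ => N.eval (x : ℂ) / D.eval (x : ℂ)) ∧
      ∫ x : ℝ, N.eval (x : ℂ) / D.eval (x : ℂ) = 0 := by
  have hclosed : IsClosed {z : ℂ | 0 ≤ z.im} := isClosed_le continuous_const Complex.continuous_im
  obtain ⟨C, hC⟩ := exists_norm_eval_le_of_degree_le
    (N := N * (Polynomial.X + Polynomial.C Complex.I) ^ 2) hclosed hD (by
      refine Polynomial.degree_le_of_natDegree_le ?_ |>.trans
        (Polynomial.degree_eq_natDegree ?_).ge
      · refine (Polynomial.natDegree_mul_le.trans ?_).trans hdeg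
        gcongr
        exact (Polynomial.natDegree_pow_le).trans (by simp)
      · rintro rfl
        exact hD 0 (by simp) (by simp))
  refine integral_real_eq_zero_of_upper_halfPlane (f := fun z => N.eval z / D.eval z) (C := C)
    (fun z hz => N.differentiableAt.div D.differentiableAt (hD z hz)) fun z hz => ?_
  have h1 := hC z hz
  have hpos : 0 < ‖D.eval z‖ := norm_pos_iff.2 (hD z hz)
  have h2 : 1 + ‖z‖ ^ 2 ≤ ‖z + Complex.I‖ ^ 2 := by
    rw [Complex.sq_norm, Complex.sq_norm, Complex.normSq_apply, Complex.normSq_apply]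
    simp only [Complex.add_re, Complex.I_re, Complex.add_im, Complex.I_im]
    nlinarith
  rw [norm_div, div_le_div_iff₀ hpos (by positivity)]
  simp only [Polynomial.eval_mul, Polynomial.eval_pow, Polynomial.eval_add, Polynomial.eval_X,
    Polynomial.eval_C, norm_mul, norm_pow] at h1
  exact (mul_le_mul_of_nonneg_left h2 (norm_nonneg _)).trans h1

/-- Algebraic data of the orthonormal polynomials attached to Jacobi parameters. -/
structure IsJacobiSystem (a b : ℕ → ℝ) (p : ℕ → Polynomial ℝ) : Prop where
  pos : ∀ n, 0 < a (n + 1)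
  zero : p 0 = 1
  natDegree : ∀ n, (p n).natDegree = n
  rec_zero : Polynomial.X * p 0 = Polynomial.C (a 1) * p 1 + Polynomial.C (b 1) * p 0
  rec_succ : ∀ n, Polynomial.X * p (n + 1) = Polynomial.C (a (n + 2)) * p (n + 2) +
    Polynomial.C (b (n + 2)) * p (n + 1) + Polynomial.C (a (n + 1)) * p n

/-- The squared modulus of `a (n+1) p (n+1) + i p n`. -/
def carmona (a : ℕ → ℝ) (p : ℕ → Polynomial ℝ) (n : ℕ) (x : ℝ) : ℝ :=
  (a (n + 1) * (p (n + 1)).eval x) ^ 2 + (p n).eval x ^ 2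

namespace IsJacobiSystem

variable {a b : ℕ → ℝ} {p : ℕ → Polynomial ℝ}

lemma ne_zero (h : IsJacobiSystem a b p) (n : ℕ) : p n ≠ 0 := by
  rcases n with _ | n
  · rw [h.zero]; exact one_ne_zero
  · intro h0
    have := h.natDegree (n + 1)
    rw [h0] at this
    simp at this

lemma aeval_rec_zero (h : IsJacobiSystem a b p) {K : Type*} [Field K] [Algebra ℝ K] (z : K) :
    algebraMap ℝ K (a 1) * Polynomial.aeval z (p 1) = z - algebraMap ℝ K (b 1) := by
  have := congrArg (Polynomial.aeval z) h.rec_zero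
  simp only [h.zero, map_mul, map_add, Polynomial.aeval_X, Polynomial.aeval_C, map_one] at this
  linear_combination -this

lemma aeval_rec_succ (h : IsJacobiSystem a b p) {K : Type*} [Field K] [Algebra ℝ K] (n : ℕ)
    (z : K) : algebraMap ℝ K (a (n + 2)) * Polynomial.aeval z (p (n + 2)) =
      (z - algebraMap ℝ K (b (n + 2))) * Polynomial.aeval z (p (n + 1))
        - algebraMap ℝ K (a (n + 1)) * Polynomial.aeval z (p n) := by
  have := congrArg (Polynomial.aeval z) (h.rec_succ n)
  simp only [map_mul, map_add, Polynomial.aeval_X, Polynomial.aeval_C] at this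
  linear_combination -this

lemma not_common_zero (h : IsJacobiSystem a b p) {K : Type*} [Field K] [Algebra ℝ K] (z : K)
    (n : ℕ) : Polynomial.aeval z (p n) = 0 → Polynomial.aeval z (p (n + 1)) ≠ 0 := by
  induction n with
  | zero => intro h0; simp [h.zero] at h0
  | succ n ih =>
    intro h1 h2
    refine ih ?_ h1
    have := h.aeval_rec_succ n z
    rw [h1, h2, mul_zero, mul_zero, zero_sub, zero_eq_neg] at this
    exact (mul_eq_zero.1 this).resolve_left (by simpa using (h.pos n).ne')

lemma im_le_im_mul_conj (h : IsJacobiSystem a b p) {z : ℂ} (hz : 0 ≤ z.im) (n : ℕ) :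
    z.im ≤ ((a (n + 1) : ℂ) * Polynomial.aeval z (p (n + 1)) *
      (starRingEnd ℂ) (Polynomial.aeval z (p n))).im := by
  induction n with
  | zero =>
    have := h.aeval_rec_zero z
    simp only [Complex.coe_algebraMap] at this
    simp [h.zero, this]
  | succ n ih =>
    have := h.aeval_rec_succ n z
    simp only [Complex.coe_algebraMap] at this
    rw [this]
    refine ih.trans ?_
    set u := Polynomial.aeval z (p (n + 1))
    set v := Polynomial.aeval z (p n)
    simp only [Complex.mul_im, Complex.mul_re, Complex.sub_im, Complex.sub_re, Complex.ofReal_im,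
      Complex.ofReal_re, Complex.conj_im, Complex.conj_re]
    nlinarith [mul_nonneg hz (add_nonneg (sq_nonneg u.re) (sq_nonneg u.im))]

lemma add_I_mul_ne_zero (h : IsJacobiSystem a b p) {z : ℂ} (hz : 0 ≤ z.im) (n : ℕ) :
    (a (n + 1) : ℂ) * Polynomial.aeval z (p (n + 1)) +
      Complex.I * Polynomial.aeval z (p n) ≠ 0 := by
  intro h0
  have h1 : (a (n + 1) : ℂ) * Polynomial.aeval z (p (n + 1)) =
      -Complex.I * Polynomial.aeval z (p n) := by linear_combination h0
  have h2 := h.im_le_im_mul_conj hz n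
  rw [h1] at h2
  set v := Polynomial.aeval z (p n) with hv
  simp only [Complex.mul_im, Complex.mul_re, Complex.neg_re, Complex.neg_im, Complex.I_re,
    Complex.I_im, Complex.conj_im, Complex.conj_re] at h2
  have h3 : v = 0 := by
    apply Complex.ext <;> simp only [Complex.zero_re, Complex.zero_im] <;>
      nlinarith [sq_nonneg v.re, sq_nonneg v.im]
  refine h.not_common_zero z n h3 ?_
  rw [h3, mul_zero] at h1
  exact (mul_eq_zero.1 h1).resolve_left (by simpa using (h.pos n).ne')

lemma leadingCoeff_succ (h : IsJacobiSystem a b p) (n : ℕ) :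
    a (n + 1) * (p (n + 1)).leadingCoeff = (p n).leadingCoeff := by
  have key : ∀ n, (Polynomial.X * p n).coeff (n + 1) = a (n + 1) * (p (n + 1)).coeff (n + 1) := by
    intro n
    rcases n with _ | n
    · rw [h.rec_zero, Polynomial.coeff_add, Polynomial.coeff_C_mul, Polynomial.coeff_C_mul,
        Polynomial.coeff_eq_zero_of_natDegree_lt (n := 0 + 1) (p := p 0) (by rw [h.natDegree]; omega)]
      simp
    · rw [h.rec_succ, Polynomial.coeff_add, Polynomial.coeff_add, Polynomial.coeff_C_mul,
        Polynomial.coeff_C_mul, Polynomial.coeff_C_mul,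
        Polynomial.coeff_eq_zero_of_natDegree_lt (n := n + 1 + 1) (p := p n)
          (by rw [h.natDegree]; omega),
        Polynomial.coeff_eq_zero_of_natDegree_lt (n := n + 1 + 1) (p := p (n + 1))
          (by rw [h.natDegree]; omega)]
      simp
  have := key n
  rw [Polynomial.coeff_X_mul] at this
  rw [Polynomial.leadingCoeff, Polynomial.leadingCoeff, h.natDegree, h.natDegree, this]

/-- The polynomial `a (n+1) p (n+1) + i p n`. -/
def qpoly (a : ℕ → ℝ) (p : ℕ → Polynomial ℝ) (n : ℕ) : Polynomial ℂ :=
  ((Polynomial.C (a (n + 1)) * p (n + 1)).map (algebraMap ℝ ℂ)) +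
    Polynomial.C Complex.I * (p n).map (algebraMap ℝ ℂ)

lemma eval_qpoly (z : ℂ) (n : ℕ) : (qpoly a p n).eval z =
    (a (n + 1) : ℂ) * Polynomial.aeval z (p (n + 1)) + Complex.I * Polynomial.aeval z (p n) := by
  simp [qpoly, Polynomial.eval_map, Polynomial.aeval_def]

lemma natDegree_qpoly (h : IsJacobiSystem a b p) (n : ℕ) : (qpoly a p n).natDegree = n + 1 := by
  have h1 : ((Polynomial.C (a (n + 1)) * p (n + 1)).map (algebraMap ℝ ℂ)).natDegree = n + 1 := by
    rw [Polynomial.natDegree_map, Polynomial.natDegree_C_mul (h.pos n).ne', h.natDegree]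
  rw [qpoly, Polynomial.natDegree_add_eq_left_of_natDegree_lt, h1]
  rw [h1, Polynomial.natDegree_C_mul Complex.I_ne_zero, Polynomial.natDegree_map, h.natDegree]
  omega

lemma eval_ofReal_eq (f : Polynomial ℝ) (x : ℝ) :
    (f.map (algebraMap ℝ ℂ)).eval (x : ℂ) = ((f.eval x : ℝ) : ℂ) := by
  rw [Polynomial.eval_map]
  exact (Polynomial.hom_eval₂ f (RingHom.id ℝ) (algebraMap ℝ ℂ) x).symm

lemma eval_qpoly_ofReal (x : ℝ) (n : ℕ) : (qpoly a p n).eval (x : ℂ) =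
    ((a (n + 1) * (p (n + 1)).eval x : ℝ) : ℂ) + Complex.I * ((p n).eval x : ℝ) := by
  rw [qpoly, Polynomial.eval_add, Polynomial.eval_mul, eval_ofReal_eq, eval_ofReal_eq]
  simp

lemma carmona_pos (h : IsJacobiSystem a b p) (n : ℕ) (x : ℝ) : 0 < carmona a p n x := by
  refine lt_of_le_of_ne (by unfold carmona; positivity) fun h0 => ?_
  unfold carmona at h0
  have s1 := sq_nonneg ((p n).eval x)
  have s2 := sq_nonneg (a (n + 1) * (p (n + 1)).eval x)
  have h1 : (p n).eval x = 0 := pow_eq_zero_iff two_ne_zero |>.1 (by linarith)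
  have h2 : a (n + 1) * (p (n + 1)).eval x = 0 := pow_eq_zero_iff two_ne_zero |>.1 (by linarith)
  exact h.not_common_zero x n (by simpa using h1)
    (by simpa using (mul_eq_zero.1 h2).resolve_left (h.pos n).ne')

lemma continuous_carmona (n : ℕ) : Continuous (carmona a p n) := by
  unfold carmona; fun_prop

lemma integrable_div_carmona (h : IsJacobiSystem a b p) {n : ℕ} {f : Polynomial ℝ}
    (hf : f.natDegree ≤ 2 * n) : Integrable (fun x => f.eval x / carmona a p n x) := by
  set D : Polynomial ℝ := (Polynomial.C (a (n + 1)) * p (n + 1)) ^ 2 + p n ^ 2 with hDdef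
  have hDe : ∀ x, D.eval x = carmona a p n x := fun x => by simp [D, carmona]
  have hDdeg : D.natDegree = 2 * n + 2 := by
    have h1 : ((Polynomial.C (a (n + 1)) * p (n + 1)) ^ 2).natDegree = 2 * n + 2 := by
      rw [Polynomial.natDegree_pow, Polynomial.natDegree_C_mul (h.pos n).ne', h.natDegree]; ring
    rw [hDdef, Polynomial.natDegree_add_eq_left_of_natDegree_lt, h1]
    rw [h1, Polynomial.natDegree_pow, h.natDegree]
    omega
  obtain ⟨C, hC⟩ := exists_norm_eval_le_of_degree_le
    (N := (f * (1 + Polynomial.X ^ 2)).map (algebraMap ℝ ℂ))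
    (D := D.map (algebraMap ℝ ℂ)) (Z := range ((↑) : ℝ → ℂ))
    Complex.isometry_ofReal.isClosedEmbedding.isClosed_range (by
      rintro _ ⟨x, rfl⟩
      rw [eval_ofReal_eq, hDe]
      exact_mod_cast (h.carmona_pos n x).ne') (by
      rw [Polynomial.degree_map, Polynomial.degree_map]
      refine Polynomial.degree_le_of_natDegree_le ?_ |>.trans
        (Polynomial.degree_eq_natDegree ?_).ge
      · refine Polynomial.natDegree_mul_le.trans ?_
        have : (1 + Polynomial.X ^ 2 : Polynomial ℝ).natDegree ≤ 2 := by compute_degree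
        omega
      · intro h0; rw [h0] at hDdeg; simp at hDdeg)
  refine (integrable_inv_one_add_sq.const_mul C).mono' ?_ ?_
  · exact (Continuous.div (by fun_prop) (continuous_carmona n)
      fun x => (h.carmona_pos n x).ne').aestronglyMeasurable
  · refine ae_of_all _ fun x => ?_
    have h1 := hC x ⟨x, rfl⟩
    have hp := h.carmona_pos n x
    have h2 : (0 : ℝ) < 1 + x ^ 2 := by positivity
    rw [eval_ofReal_eq, eval_ofReal_eq, hDe, Complex.norm_real, Complex.norm_real,
      Polynomial.eval_mul, norm_mul, Real.norm_of_nonneg hp.le] at h1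
    simp only [Polynomial.eval_add, Polynomial.eval_one, Polynomial.eval_pow,
      Polynomial.eval_X] at h1
    rw [Real.norm_of_nonneg h2.le] at h1
    rw [norm_div, Real.norm_of_nonneg hp.le, ← div_eq_mul_inv, div_le_div_iff₀ hp h2]
    exact h1

/-- The weighted integral `∫ f / (A² + B²)`. -/
def carmonaInt (a : ℕ → ℝ) (p : ℕ → Polynomial ℝ) (n : ℕ) (f : Polynomial ℝ) : ℝ :=
  ∫ x, f.eval x / carmona a p n x

lemma carmonaInt_add (h : IsJacobiSystem a b p) {n : ℕ} {f g : Polynomial ℝ}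
    (hf : f.natDegree ≤ 2 * n) (hg : g.natDegree ≤ 2 * n) :
    carmonaInt a p n (f + g) = carmonaInt a p n f + carmonaInt a p n g := by
  unfold carmonaInt
  rw [← integral_add (h.integrable_div_carmona hf) (h.integrable_div_carmona hg)]
  simp [add_div]

lemma carmonaInt_C_mul (n : ℕ) (c : ℝ) (f : Polynomial ℝ) :
    carmonaInt a p n (Polynomial.C c * f) = c * carmonaInt a p n f := by
  unfold carmonaInt
  rw [← integral_const_mul]
  simp [mul_div_assoc]

lemma carmonaInt_top (h : IsJacobiSystem a b p) {n : ℕ} {f : Polynomial ℝ}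
    (hf : f.natDegree < n) : carmonaInt a p n (p n * f) = 0 ∧
      carmonaInt a p n (p (n + 1) * f) = 0 := by
  obtain ⟨h1, h2⟩ := integral_eval_div_eval_eq_zero (N := f.map (algebraMap ℝ ℂ))
    (D := qpoly a p n) (fun z hz => by rw [eval_qpoly]; exact h.add_I_mul_ne_zero hz n)
    (by rw [Polynomial.natDegree_map, h.natDegree_qpoly]; omega)
  have hfrac : ∀ x : ℝ, (f.map (algebraMap ℝ ℂ)).eval (x : ℂ) / (qpoly a p n).eval (x : ℂ) =
      ((a (n + 1) * ((p (n + 1) * f).eval x / carmona a p n x) : ℝ) : ℂ) -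
        (((p n * f).eval x / carmona a p n x : ℝ) : ℂ) * Complex.I := by
    intro x
    have h3 := h.carmona_pos n x
    have h4 : (qpoly a p n).eval (x : ℂ) ≠ 0 := by
      rw [eval_qpoly]; exact h.add_I_mul_ne_zero (by simp) n
    rw [eval_ofReal_eq, div_eq_iff h4, eval_qpoly_ofReal]
    have h5 : (carmona a p n x : ℂ) ≠ 0 := by exact_mod_cast h3.ne'
    push_cast [Polynomial.eval_mul]
    field_simp
    have : (carmona a p n x : ℂ) = (a (n + 1) * ((p (n + 1)).eval x : ℝ)) ^ 2 +
      ((p n).eval x : ℝ) ^ 2 := by unfold carmona; push_cast; rfl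
    rw [this]
    ring_nf
    rw [Complex.I_sq]
    ring
  have hre := integral_re h1
  have him := integral_im h1
  rw [h2] at hre him
  simp only [RCLike.im_to_complex, RCLike.re_to_complex, hfrac, Complex.sub_re, Complex.sub_im,
    Complex.ofReal_re, Complex.ofReal_im, Complex.mul_re, Complex.mul_im, Complex.I_re,
    Complex.I_im, mul_zero, sub_zero, mul_one, zero_sub, add_zero, Complex.zero_re,
    Complex.zero_im] at hre him
  rw [integral_const_mul] at hre
  rw [integral_neg, neg_eq_zero] at him
  exact ⟨him, (mul_eq_zero.1 hre).resolve_left (h.pos n).ne'⟩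

lemma carmonaInt_top_sq (h : IsJacobiSystem a b p) (n : ℕ) :
    carmonaInt a p n (p n * p n) = Real.pi := by
  set N : Polynomial ℝ := Polynomial.X * p n - Polynomial.C (a (n + 1)) * p (n + 1) with hN
  have hNdeg : N.natDegree ≤ n := by
    rcases n with _ | n
    · rw [hN, h.rec_zero, h.zero]
      simp
    · have : N = Polynomial.C (b (n + 2)) * p (n + 1) + Polynomial.C (a (n + 1)) * p n := by
        rw [hN, h.rec_succ]; ring
      rw [this]
      refine Polynomial.natDegree_add_le_of_degree_le ?_ ?_
      · exact (Polynomial.natDegree_C_mul_le _ _).trans (h.natDegree _).le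
      · exact (Polynomial.natDegree_C_mul_le _ _).trans ((h.natDegree _).le.trans (by omega))
  have hI : ∀ z : ℂ, 0 ≤ z.im → z + Complex.I ≠ 0 := by
    intro z hz h0
    have := congrArg Complex.im h0
    simp at this
    linarith
  have hq0 : ∀ z : ℂ, 0 ≤ z.im → (qpoly a p n).eval z ≠ 0 := fun z hz => by
    rw [eval_qpoly]; exact h.add_I_mul_ne_zero hz n
  obtain ⟨h1, h2⟩ := integral_eval_div_eval_eq_zero (N := N.map (algebraMap ℝ ℂ))
    (D := qpoly a p n * (Polynomial.X + Polynomial.C Complex.I))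
    (fun z hz => by
      simpa using ⟨hq0 z hz, hI z hz⟩)
    (by
      rw [Polynomial.natDegree_map, Polynomial.natDegree_mul
        (fun h0 => hq0 0 (by simp) (by rw [h0]; simp)) (Polynomial.X_add_C_ne_zero _),
        h.natDegree_qpoly, Polynomial.natDegree_X_add_C]
      omega)
  have him := integral_im h1
  rw [h2] at him
  simp only [RCLike.im_to_complex] at him
  have hfrac : ∀ x : ℝ, ((N.map (algebraMap ℝ ℂ)).eval (x : ℂ) /
      (qpoly a p n * (Polynomial.X + Polynomial.C Complex.I)).eval (x : ℂ)).im =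
      (1 + x ^ 2)⁻¹ - (p n * p n).eval x / carmona a p n x := by
    intro x
    have h3 := h.carmona_pos n x
    have h4 := hq0 x (by simp)
    have h5 := hI x (by simp)
    have h6 : (N.map (algebraMap ℝ ℂ)).eval (x : ℂ) /
      (qpoly a p n * (Polynomial.X + Polynomial.C Complex.I)).eval (x : ℂ) =
      ((p n).eval x : ℝ) / (qpoly a p n).eval (x : ℂ) - 1 / (x + Complex.I) := by
      rw [Polynomial.eval_mul, Polynomial.eval_add, Polynomial.eval_X, Polynomial.eval_C,
        div_sub_div _ _ h4 h5, eval_ofReal_eq, eval_qpoly_ofReal]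
      congr 1
      rw [hN]
      push_cast [Polynomial.eval_sub, Polynomial.eval_mul, Polynomial.eval_X, Polynomial.eval_C]
      ring
    rw [h6, Complex.sub_im, eval_qpoly_ofReal]
    have n1 : Complex.normSq (((a (n + 1) * (p (n + 1)).eval x : ℝ) : ℂ) +
        Complex.I * ((p n).eval x : ℝ)) = carmona a p n x := by
      simp [Complex.normSq_apply, carmona]; ring
    have n2 : Complex.normSq ((x : ℂ) + Complex.I) = 1 + x ^ 2 := by
      simp [Complex.normSq_apply]; ring
    rw [Complex.div_im, Complex.div_im, n1, n2]
    simp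
    ring
  simp only [hfrac, Complex.zero_im] at him
  rw [integral_sub integrable_inv_one_add_sq (h.integrable_div_carmona (by
    rw [Polynomial.natDegree_mul (h.ne_zero n) (h.ne_zero n), h.natDegree]; omega)),
    integral_univ_inv_one_add_sq] at him
  unfold carmonaInt
  linarith

lemma carmonaInt_orth_aux (h : IsJacobiSystem a b p) (n j : ℕ) : ∀ k, k + j = n →
    ∀ f : Polynomial ℝ, f.natDegree < k → carmonaInt a p n (p k * f) = 0 ∧
      carmonaInt a p n (p (k + 1) * f) = 0 := by
  induction j with
  | zero =>
    rintro k rfl f hf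
    exact h.carmonaInt_top hf
  | succ j ih =>
    intro k hk f hf
    have ih' := ih (k + 1) (by omega)
    refine ⟨?_, (ih' f (by omega)).1⟩
    have e1 : Polynomial.C (a (k + 1)) * (p k * f) =
        p (k + 1) * ((Polynomial.X - Polynomial.C (b (k + 2))) * f) +
          Polynomial.C (-a (k + 2)) * (p (k + 2) * f) := by
      have := h.rec_succ k
      rw [Polynomial.C_neg]
      linear_combination (-f) * this
    have hd : ((Polynomial.X - Polynomial.C (b (k + 2))) * f).natDegree < k + 1 := by
      refine Polynomial.natDegree_mul_le.trans_lt ?_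
      rw [Polynomial.natDegree_X_sub_C]; omega
    have e2 : carmonaInt a p n (Polynomial.C (a (k + 1)) * (p k * f)) = 0 := by
      rw [e1, h.carmonaInt_add, (ih' _ hd).1, carmonaInt_C_mul, (ih' f (by omega)).2]
      · simp
      · refine Polynomial.natDegree_mul_le.trans ?_
        rw [h.natDegree]; omega
      · refine (Polynomial.natDegree_C_mul_le _ _).trans (Polynomial.natDegree_mul_le.trans ?_)
        rw [h.natDegree]; omega
    rw [carmonaInt_C_mul] at e2
    exact (mul_eq_zero.1 e2).resolve_left (h.pos k).ne'

lemma carmonaInt_orth (h : IsJacobiSystem a b p) {n k : ℕ} (hk : k ≤ n) {f : Polynomial ℝ}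
    (hf : f.natDegree < k) : carmonaInt a p n (p k * f) = 0 ∧
      carmonaInt a p n (p (k + 1) * f) = 0 :=
  h.carmonaInt_orth_aux n (n - k) k (by omega) f hf

lemma carmonaInt_sq_succ (h : IsJacobiSystem a b p) {n k : ℕ} (hk : k + 1 ≤ n) :
    carmonaInt a p n (p k * p k) = carmonaInt a p n (p (k + 1) * p (k + 1)) := by
  have d : ∀ i j, (p i * p j).natDegree ≤ i + j := fun i j =>
    Polynomial.natDegree_mul_le.trans (by rw [h.natDegree, h.natDegree])
  have dC : ∀ c i j, (Polynomial.C c * (p i * p j)).natDegree ≤ i + j := fun c i j =>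
    (Polynomial.natDegree_C_mul_le _ _).trans (d i j)
  have e1 : carmonaInt a p n (Polynomial.X * (p (k + 1) * p k)) =
      a (k + 1) * carmonaInt a p n (p k * p k) := by
    have : Polynomial.X * (p (k + 1) * p k) = Polynomial.C (a (k + 2)) * (p (k + 2) * p k) +
        (Polynomial.C (b (k + 2)) * (p (k + 1) * p k) + Polynomial.C (a (k + 1)) * (p k * p k)) := by
      linear_combination (p k) * h.rec_succ k
    rw [this, h.carmonaInt_add ((dC _ _ _).trans (by omega))
      (Polynomial.natDegree_add_le_of_degree_le ((dC _ _ _).trans (by omega))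
        ((dC _ _ _).trans (by omega))),
      h.carmonaInt_add ((dC _ _ _).trans (by omega)) ((dC _ _ _).trans (by omega)),
      carmonaInt_C_mul, carmonaInt_C_mul, carmonaInt_C_mul]
    have o := h.carmonaInt_orth hk (f := p k) (by rw [h.natDegree]; omega)
    rw [o.1, o.2]
    ring
  have e2 : carmonaInt a p n (Polynomial.X * (p (k + 1) * p k)) =
      a (k + 1) * carmonaInt a p n (p (k + 1) * p (k + 1)) := by
    have o := h.carmonaInt_orth hk (f := p k) (by rw [h.natDegree]; omega)
    rcases k with _ | k
    · have : Polynomial.X * (p 1 * p 0) = Polynomial.C (a 1) * (p 1 * p 1) +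
        Polynomial.C (b 1) * (p 1 * p 0) := by
        linear_combination (p 1) * h.rec_zero
      simp only [zero_add] at o ⊢
      rw [this, h.carmonaInt_add ((dC _ _ _).trans (by omega)) ((dC _ _ _).trans (by omega)),
        carmonaInt_C_mul, carmonaInt_C_mul, o.1]
      ring
    · have : Polynomial.X * (p (k + 2) * p (k + 1)) =
          Polynomial.C (a (k + 2)) * (p (k + 2) * p (k + 2)) +
          (Polynomial.C (b (k + 2)) * (p (k + 2) * p (k + 1)) +
            Polynomial.C (a (k + 1)) * (p (k + 2) * p k)) := by
        linear_combination (p (k + 2)) * h.rec_succ k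
      rw [this, h.carmonaInt_add ((dC _ _ _).trans (by omega))
        (Polynomial.natDegree_add_le_of_degree_le ((dC _ _ _).trans (by omega))
          ((dC _ _ _).trans (by omega))),
        h.carmonaInt_add ((dC _ _ _).trans (by omega)) ((dC _ _ _).trans (by omega)),
        carmonaInt_C_mul, carmonaInt_C_mul, carmonaInt_C_mul, o.1,
        (h.carmonaInt_orth hk (f := p k) (by rw [h.natDegree]; omega)).1]
      ring
  exact mul_left_cancel₀ (h.pos k).ne' (e1.symm.trans e2)

lemma carmonaInt_sq (h : IsJacobiSystem a b p) {n k : ℕ} (hk : k ≤ n) :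
    carmonaInt a p n (p k * p k) = Real.pi := by
  induction hk using Nat.decreasingInduction with
  | self => exact h.carmonaInt_top_sq n
  | of_succ k hk ih => rw [h.carmonaInt_sq_succ hk, ih]

lemma carmonaInt_mul (h : IsJacobiSystem a b p) {n j k : ℕ} (hj : j ≤ n) (hk : k ≤ n) :
    carmonaInt a p n (p j * p k) = if j = k then Real.pi else 0 := by
  rcases lt_trichotomy j k with hjk | rfl | hjk
  · rw [if_neg hjk.ne, mul_comm, (h.carmonaInt_orth hk (by rwa [h.natDegree])).1]
  · rw [if_pos rfl, h.carmonaInt_sq hk]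
  · rw [if_neg hjk.ne', (h.carmonaInt_orth hj (by rwa [h.natDegree])).1]

lemma exists_eq_sum (h : IsJacobiSystem a b p) (m : ℕ) : ∀ R : Polynomial ℝ, R.natDegree < m →
    ∃ c : ℕ → ℝ, R = ∑ k ∈ Finset.range m, Polynomial.C (c k) * p k := by
  induction m with
  | zero => intro R hR; omega
  | succ m ih =>
    intro R hR
    have hlc : (p m).coeff m ≠ 0 := by
      have := h.ne_zero m
      rwa [← Polynomial.leadingCoeff_ne_zero, Polynomial.leadingCoeff, h.natDegree] at this
    set c := R.coeff m / (p m).coeff m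
    have hd : (R - Polynomial.C c * p m).natDegree ≤ m := by
      refine (Polynomial.natDegree_sub_le _ _).trans (max_le (Nat.lt_succ_iff.1 hR) ?_)
      exact (Polynomial.natDegree_C_mul_le _ _).trans (h.natDegree m).le
    have hc : (R - Polynomial.C c * p m).coeff m = 0 := by
      rw [Polynomial.coeff_sub, Polynomial.coeff_C_mul, div_mul_cancel₀ _ hlc, sub_self]
    rcases m with _ | m
    · have h0 := Polynomial.eq_C_of_natDegree_le_zero hd
      rw [hc, Polynomial.C_0, sub_eq_zero] at h0
      exact ⟨fun _ => c, by simpa using h0⟩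
    · obtain ⟨c', hc'⟩ := ih (R - Polynomial.C c * p (m + 1)) (by
        rcases hd.lt_or_eq with hlt | heq
        · exact hlt
        · exfalso
          have h0 : (R - Polynomial.C c * p (m + 1)).leadingCoeff = 0 := by
            rw [Polynomial.leadingCoeff, heq, hc]
          rw [Polynomial.leadingCoeff_eq_zero] at h0
          rw [h0] at heq
          simp at heq)
      refine ⟨fun k => if k = m + 1 then c else c' k, ?_⟩
      rw [Finset.sum_range_succ]
      simp only [if_true]
      rw [← sub_eq_iff_eq_add, hc']
      refine Finset.sum_congr rfl fun k hk => ?_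
      rw [if_neg (by have := Finset.mem_range.1 hk; omega)]

end IsJacobiSystem

lemma integral_sum_sq_of_orthogonal {α : Type*} [MeasurableSpace α] {ρ : Measure α}
    {f : ℕ → α → ℝ} {m : ℕ} {κ : ℝ}
    (hint : ∀ j < m, ∀ k < m, Integrable (fun x => f j x * f k x) ρ)
    (horth : ∀ j < m, ∀ k < m, ∫ x, f j x * f k x ∂ρ = if j = k then κ else 0) (c : ℕ → ℝ) :
    ∫ x, (∑ k ∈ Finset.range m, c k * f k x) ^ 2 ∂ρ = κ * ∑ k ∈ Finset.range m, c k ^ 2 := by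
  have e : ∀ x, (∑ k ∈ Finset.range m, c k * f k x) ^ 2 =
      ∑ j ∈ Finset.range m, ∑ k ∈ Finset.range m, c j * c k * (f j x * f k x) := by
    intro x
    rw [sq, Finset.sum_mul_sum]
    exact Finset.sum_congr rfl fun j _ => Finset.sum_congr rfl fun k _ => by ring
  simp only [e]
  rw [integral_finsetSum _ fun j hj => integrable_finsetSum _ fun k hk =>
    (hint j (Finset.mem_range.1 hj) k (Finset.mem_range.1 hk)).const_mul _, Finset.mul_sum]
  refine Finset.sum_congr rfl fun j hj => ?_
  rw [integral_finsetSum _ fun k hk =>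
    (hint j (Finset.mem_range.1 hj) k (Finset.mem_range.1 hk)).const_mul _]
  rw [Finset.sum_eq_single j]
  · rw [integral_const_mul, horth j (Finset.mem_range.1 hj) j (Finset.mem_range.1 hj), if_pos rfl]
    ring
  · intro k hk hkj
    rw [integral_const_mul, horth j (Finset.mem_range.1 hj) k (Finset.mem_range.1 hk),
      if_neg hkj.symm, mul_zero]
  · intro h0; exact absurd hj h0

/-- Carmona's formula: `dx / (π (A² + B²))` integrates squares of polynomials of low degree
to the same value as the spectral measure. -/
lemma IsJacobiSystem.integral_sq_div_carmona {a b : ℕ → ℝ} {p : ℕ → Polynomial ℝ}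
    (h : IsJacobiSystem a b p) {μ : Measure ℝ}
    (hint : ∀ f : Polynomial ℝ, Integrable (fun x => f.eval x) μ)
    (horth : ∀ m n, ∫ x, (p m).eval x * (p n).eval x ∂μ = if m = n then 1 else 0)
    {n : ℕ} {R : Polynomial ℝ} (hR : R.natDegree ≤ n) :
    Integrable (fun x => R.eval x ^ 2 / carmona a p n x) ∧
    ∫ x, R.eval x ^ 2 / carmona a p n x = Real.pi * ∫ x, R.eval x ^ 2 ∂μ := by
  refine ⟨?_, ?_⟩
  · have := h.integrable_div_carmona (n := n) (f := R ^ 2)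
      (Polynomial.natDegree_pow_le.trans (by gcongr))
    simpa using this
  obtain ⟨c, hc⟩ := h.exists_eq_sum (n + 1) R (by omega)
  have e1 := integral_sum_sq_of_orthogonal (ρ := μ) (f := fun k x => (p k).eval x) (m := n + 1)
    (κ := 1) (fun j _ k _ => by simpa using hint (p j * p k)) (fun j _ k _ => horth j k) c
  have hmul : ∀ j k x, (p j).eval x / √(carmona a p n x) * ((p k).eval x / √(carmona a p n x)) =
      (p j * p k).eval x / carmona a p n x := by
    intro j k x
    rw [div_mul_div_comm, Real.mul_self_sqrt (h.carmona_pos n x).le, Polynomial.eval_mul]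
  have e2 := integral_sum_sq_of_orthogonal (ρ := (volume : Measure ℝ))
    (f := fun k x => (p k).eval x / √(carmona a p n x)) (m := n + 1)
    (κ := Real.pi) (fun j hj k hk => by
      simp only [hmul]
      refine h.integrable_div_carmona (Polynomial.natDegree_mul_le.trans ?_)
      rw [h.natDegree, h.natDegree]; omega) (fun j hj k hk => by
      simp only [hmul]
      exact h.carmonaInt_mul (by omega) (by omega)) c
  have hRe : ∀ x, R.eval x = ∑ k ∈ Finset.range (n + 1), c k * (p k).eval x := by
    intro x
    conv_lhs => rw [hc]
    simp [Polynomial.eval_finsetSum]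
  have e3 : ∀ x, R.eval x ^ 2 / carmona a p n x =
      (∑ k ∈ Finset.range (n + 1), c k * ((p k).eval x / √(carmona a p n x))) ^ 2 := by
    intro x
    simp only [← mul_div_assoc]
    rw [← Finset.sum_div, ← hRe, div_pow, Real.sq_sqrt (h.carmona_pos n x).le]
  simp only [e3]
  rw [e2]
  simp only [hRe]
  rw [e1, one_mul]

lemma integrable_of_ae_mem_Icc {μ : Measure ℝ} [IsFiniteMeasure μ] {M : ℝ}
    (hM : ∀ᵐ x ∂μ, x ∈ Icc (-M) M) {f : ℝ → ℝ} (hf : Continuous f) : Integrable f μ := by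
  obtain ⟨C, hC⟩ := isCompact_Icc.exists_bound_of_continuousOn (hf.continuousOn (s := Icc (-M) M))
  exact Integrable.of_bound hf.aestronglyMeasurable C (hM.mono hC)

lemma exists_polynomial_between {f : ℝ → ℝ} (hf : Continuous f) (M : ℝ) {ε : ℝ} (hε : 0 < ε) :
    ∃ R : Polynomial ℝ, ∀ x ∈ Icc (-M) M, f x ≤ R.eval x ∧ R.eval x ≤ f x + ε := by
  obtain ⟨R, hR⟩ := exists_polynomial_near_of_continuousOn (-M) M f hf.continuousOn (ε / 2)
    (by positivity)
  refine ⟨R + Polynomial.C (ε / 2), fun x hx => ?_⟩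
  have := abs_lt.1 (hR x hx)
  simp only [Polynomial.eval_add, Polynomial.eval_C]
  constructor <;> linarith

/-- The density of Carmona's approximation to the spectral measure. -/
def carmonaDensity (a : ℕ → ℝ) (p : ℕ → Polynomial ℝ) (n : ℕ) (x : ℝ) : ENNReal :=
  ENNReal.ofReal (1 / (Real.pi * carmona a p n x))

namespace IsJacobiSystem

variable {a b : ℕ → ℝ} {p : ℕ → Polynomial ℝ} {μ : Measure ℝ} [IsProbabilityMeasure μ] {M : ℝ}

lemma measurable_carmonaDensity (n : ℕ) : Measurable (carmonaDensity a p n) := by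
  unfold carmonaDensity
  exact (measurable_const.div
    (measurable_const.mul (continuous_carmona n).measurable)).ennreal_ofReal

lemma lintegral_sq_mul_carmonaDensity (h : IsJacobiSystem a b p)
    (hM : ∀ᵐ x ∂μ, x ∈ Icc (-M) M)
    (horth : ∀ m n, ∫ x, (p m).eval x * (p n).eval x ∂μ = if m = n then 1 else 0)
    {n : ℕ} {R : Polynomial ℝ} (hR : R.natDegree ≤ n) :
    ∫⁻ x, ENNReal.ofReal (R.eval x ^ 2) * carmonaDensity a p n x =
      ENNReal.ofReal (∫ x, R.eval x ^ 2 ∂μ) := by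
  obtain ⟨h1, h2⟩ := h.integral_sq_div_carmona (μ := μ)
    (fun f => integrable_of_ae_mem_Icc hM f.continuous) horth hR
  have h3 : ∫ x, R.eval x ^ 2 ∂μ = ∫ x, Real.pi⁻¹ * (R.eval x ^ 2 / carmona a p n x) := by
    rw [integral_const_mul, h2, inv_mul_cancel_left₀ Real.pi_ne_zero]
  rw [h3, ofReal_integral_eq_lintegral_ofReal (h1.const_mul _)]
  · refine lintegral_congr fun x => ?_
    rw [carmonaDensity, ← ENNReal.ofReal_mul (sq_nonneg _)]
    congr 1
    have := (h.carmona_pos n x).ne'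
    field_simp
  · refine ae_of_all _ fun x => ?_
    have := h.carmona_pos n x
    simp only [Pi.zero_apply]
    positivity

lemma lintegral_carmonaDensity (h : IsJacobiSystem a b p)
    (hM : ∀ᵐ x ∂μ, x ∈ Icc (-M) M)
    (horth : ∀ m n, ∫ x, (p m).eval x * (p n).eval x ∂μ = if m = n then 1 else 0) (n : ℕ) :
    ∫⁻ x, carmonaDensity a p n x = 1 := by
  have := h.lintegral_sq_mul_carmonaDensity hM horth (n := n) (R := 1) (by simp)
  simpa using this

lemma lintegral_mul_liminf_carmonaDensity_le (h : IsJacobiSystem a b p)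
    (hM : ∀ᵐ x ∂μ, x ∈ Icc (-M) M)
    (horth : ∀ m n, ∫ x, (p m).eval x * (p n).eval x ∂μ = if m = n then 1 else 0)
    {f : ℝ → NNReal} (hf : Continuous f) (hf1 : ∀ x, f x ≤ 1) :
    ∫⁻ x in Ioo (-2) 2, f x * liminf (fun n => carmonaDensity a p n x) atTop ≤
      ∫⁻ x, f x ∂μ := by
  have hfR : Continuous fun x => (f x : ℝ) := NNReal.continuous_coe.comp hf
  have hfi : Integrable (fun x => (f x : ℝ)) μ := integrable_of_ae_mem_Icc hM hfR
  have hle : ∀ ε : ℝ, 0 < ε → ε ≤ 1 →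
      ∫⁻ x in Ioo (-2) 2, f x * liminf (fun n => carmonaDensity a p n x) atTop ≤
      (∫⁻ x, f x ∂μ) + ENNReal.ofReal (3 * ε) := by
    intro ε hε hε1
    obtain ⟨R, hR⟩ := exists_polynomial_between (f := fun x => √(f x : ℝ)) hfR.sqrt (max M 2) hε
    have hRf : ∀ x ∈ Icc (-max M 2) (max M 2), (f x : ℝ) ≤ R.eval x ^ 2 ∧
        R.eval x ^ 2 ≤ f x + 3 * ε := by
      intro x hx
      obtain ⟨h1, h2⟩ := hR x hx
      have h3 : √(f x : ℝ) ^ 2 = f x := Real.sq_sqrt (f x).2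
      have h4 : 0 ≤ √(f x : ℝ) := Real.sqrt_nonneg _
      have h5 : √(f x : ℝ) ≤ 1 := Real.sqrt_le_one.2 (by exact_mod_cast hf1 x)
      constructor <;> nlinarith
    calc ∫⁻ x in Ioo (-2) 2, f x * liminf (fun n => carmonaDensity a p n x) atTop
        = ∫⁻ x in Ioo (-2) 2, liminf (fun n => f x * carmonaDensity a p n x) atTop := by
          refine lintegral_congr fun x => ?_
          rw [ENNReal.liminf_const_mul_of_ne_top ENNReal.coe_ne_top]
      _ ≤ liminf (fun n => ∫⁻ x in Ioo (-2) 2, f x * carmonaDensity a p n x) atTop :=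
          lintegral_liminf_le fun n => (hf.measurable.coe_nnreal_ennreal).mul
            (measurable_carmonaDensity n)
      _ ≤ ENNReal.ofReal (∫ x, R.eval x ^ 2 ∂μ) := by
          refine liminf_le_of_frequently_le' (Eventually.frequently ?_)
          filter_upwards [eventually_ge_atTop R.natDegree] with n hn
          rw [← h.lintegral_sq_mul_carmonaDensity hM horth hn]
          refine (setLIntegral_mono' measurableSet_Ioo fun x hx => ?_).trans
            (setLIntegral_le_lintegral (Ioo (-2) 2) _)
          gcongr
          rw [← ENNReal.ofReal_coe_nnreal]
          refine ENNReal.ofReal_le_ofReal (hRf x ⟨?_, ?_⟩).1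
          · linarith [hx.1, le_max_right M 2]
          · linarith [hx.2, le_max_right M 2]
      _ ≤ ENNReal.ofReal (∫ x, (f x + 3 * ε) ∂μ) := by
          refine ENNReal.ofReal_le_ofReal (integral_mono_ae
            (integrable_of_ae_mem_Icc hM (by fun_prop)) (hfi.add (integrable_const _)) ?_)
          filter_upwards [hM] with x hx
          refine (hRf x ⟨?_, ?_⟩).2
          · linarith [hx.1, le_max_left M 2]
          · linarith [hx.2, le_max_left M 2]
      _ = _ := by
          have h0 : ∫ _, 3 * ε ∂μ = 3 * ε := by simp
          have hf0 : 0 ≤ ∫ x, (f x : ℝ) ∂μ := integral_nonneg fun x => (f x).2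
          rw [integral_add hfi (integrable_const _), h0, ENNReal.ofReal_add hf0 (by positivity),
            ofReal_integral_eq_lintegral_ofReal hfi (ae_of_all _ fun x => (f x).2)]
          simp
  refine ge_of_tendsto (x := nhdsWithin (0 : ℝ) (Ioi 0))
    (f := fun ε => (∫⁻ x, f x ∂μ) + ENNReal.ofReal (3 * ε)) ?_ ?_
  · have : Tendsto (fun ε : ℝ => (∫⁻ x, f x ∂μ) + ENNReal.ofReal (3 * ε)) (nhds 0)
        (nhds ((∫⁻ x, f x ∂μ) + ENNReal.ofReal (3 * 0))) := by
      refine Tendsto.const_add _ (ENNReal.tendsto_ofReal ?_)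
      exact (continuous_const.mul continuous_id).tendsto 0
    simp only [mul_zero, ENNReal.ofReal_zero, add_zero] at this
    exact this.mono_left nhdsWithin_le_nhds
  · filter_upwards [Ioc_mem_nhdsGT (zero_lt_one' ℝ)] with ε hε using hle ε hε.1 hε.2

lemma withDensity_liminf_carmonaDensity_le (h : IsJacobiSystem a b p)
    (hM : ∀ᵐ x ∂μ, x ∈ Icc (-M) M)
    (horth : ∀ m n, ∫ x, (p m).eval x * (p n).eval x ∂μ = if m = n then 1 else 0) :
    (volume.restrict (Ioo (-2) 2)).withDensity
      (fun x => liminf (fun n => carmonaDensity a p n x) atTop) ≤ μ := by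
  set g : ℝ → ENNReal := fun x => liminf (fun n => carmonaDensity a p n x) atTop
  set ν := (volume.restrict (Ioo (-2 : ℝ) 2)).withDensity g
  have hg : Measurable g := Measurable.liminf measurable_carmonaDensity
  have key : ∀ f : ℝ → NNReal, Continuous f → (∀ x, f x ≤ 1) → ∫⁻ x, f x ∂ν ≤ ∫⁻ x, f x ∂μ := by
    intro f hf hf1
    rw [lintegral_withDensity_eq_lintegral_mul _ hg hf.measurable.coe_nnreal_ennreal]
    refine le_trans (le_of_eq ?_) (h.lintegral_mul_liminf_carmonaDensity_le hM horth hf hf1)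
    simp only [Pi.mul_apply, mul_comm, g]
  have hfin : IsFiniteMeasure ν := by
    constructor
    have := key (fun _ => 1) continuous_const fun _ => le_rfl
    simp only [ENNReal.coe_one, lintegral_one, measure_univ] at this
    exact this.trans_lt ENNReal.one_lt_top
  have hclosed : ∀ F, IsClosed F → ν F ≤ μ F := by
    intro F hF
    have hpos : ∀ n : ℕ, (0 : ℝ) < 1 / (n + 1) := fun n => by positivity
    refine le_of_tendsto_of_tendsto'
      (tendsto_lintegral_thickenedIndicator_of_isClosed ν hF hpos
        tendsto_one_div_add_atTop_nhds_zero_nat)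
      (tendsto_lintegral_thickenedIndicator_of_isClosed μ hF hpos
        tendsto_one_div_add_atTop_nhds_zero_nat) fun n => ?_
    exact key _ (thickenedIndicator (hpos n) F).continuous
      (thickenedIndicator_le_one (hpos n) F)
  refine Measure.le_iff.2 fun A hA => ?_
  rw [hA.measure_eq_iSup_isClosed_of_ne_top (measure_ne_top ν A)]
  exact iSup_le fun K => iSup_le fun hK => iSup_le fun hKc =>
    (hclosed K hKc).trans (measure_mono hK)

/-- The Carmona densities bound the absolutely continuous part of the measure from below. -/
lemma ae_liminf_carmonaDensity_le_rnDeriv (h : IsJacobiSystem a b p)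
    (hM : ∀ᵐ x ∂μ, x ∈ Icc (-M) M)
    (horth : ∀ m n, ∫ x, (p m).eval x * (p n).eval x ∂μ = if m = n then 1 else 0) :
    ∀ᵐ x ∂(volume.restrict (Ioo (-2 : ℝ) 2)),
      liminf (fun n => carmonaDensity a p n x) atTop ≤ μ.rnDeriv volume x := by
  have hg : Measurable fun x => liminf (fun n => carmonaDensity a p n x) atTop :=
    Measurable.liminf measurable_carmonaDensity
  refine ae_le_of_forall_setLIntegral_le_of_sigmaFinite hg fun A hA _ => ?_
  obtain ⟨S, hS, hS1, hS2⟩ := Measure.mutuallySingular_singularPart μ volume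
  have hS3 : (volume.restrict (Ioo (-2 : ℝ) 2)) (S ∩ Ioo (-2) 2)ᶜ = 0 := by
    rw [compl_inter]
    refine measure_union_null
      (le_antisymm ((Measure.restrict_apply_le _ _).trans hS2.le) (zero_le)) ?_
    rw [Measure.restrict_apply measurableSet_Ioo.compl, compl_inter_self, measure_empty]
  have e1 : ∫⁻ x in A, liminf (fun n => carmonaDensity a p n x) atTop
        ∂(volume.restrict (Ioo (-2) 2)) =
      ∫⁻ x in A ∩ (S ∩ Ioo (-2) 2), liminf (fun n => carmonaDensity a p n x) atTop
        ∂(volume.restrict (Ioo (-2) 2)) := by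
    refine setLIntegral_congr ?_
    refine (ae_eq_set.2 ⟨?_, ?_⟩)
    · refine measure_mono_null (fun x hx => ?_) hS3
      exact fun hxS => hx.2 ⟨hx.1, hxS⟩
    · rw [sdiff_eq_bot_iff.2 inter_subset_left]
      exact measure_empty
  rw [e1, ← withDensity_apply _ (hA.inter (hS.inter measurableSet_Ioo))]
  refine (h.withDensity_liminf_carmonaDensity_le hM horth _).trans ?_
  conv_lhs => rw [Measure.haveLebesgueDecomposition_add μ volume]
  rw [Measure.add_apply, measure_mono_null (inter_subset_right.trans inter_subset_left) hS1,
    zero_add, withDensity_apply _ (hA.inter (hS.inter measurableSet_Ioo)),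
    Measure.restrict_restrict hA]
  exact lintegral_mono_set (inter_subset_inter_right _ inter_subset_right)

end IsJacobiSystem

lemma ae_ne_circleMap (β : ℂ) : ∀ᵐ θ : ℝ, circleMap 0 1 θ ≠ β := by
  have := (Set.countable_singleton β).preimage_circleMap 0 one_ne_zero
  exact this.ae_notMem volume

lemma integral_log_abs_two_cos_sub_of_add_inv {β : ℂ} (hβ : β ≠ 0) {t : ℝ} (h : β + β⁻¹ = t) :
    IntervalIntegrable (fun θ => Real.log |2 * Real.cos θ - t|) volume 0 (2 * Real.pi) ∧
    ∫ θ in (0 : ℝ)..(2 * Real.pi), Real.log |2 * Real.cos θ - t| =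
      2 * Real.pi * (Real.posLog ‖β‖ + Real.posLog ‖β⁻¹‖) := by
  have i : ∀ γ : ℂ, IntervalIntegrable (fun θ => Real.log ‖circleMap 0 1 θ - γ‖) volume 0
      (2 * Real.pi) := fun γ => circleIntegrable_log_norm_sub_const (a := γ) (c := 0) 1
  have e : ∀ γ : ℂ, ∫ θ in (0 : ℝ)..(2 * Real.pi), Real.log ‖circleMap 0 1 θ - γ‖ =
      2 * Real.pi * Real.posLog ‖γ‖ := by
    intro γ
    have := circleAverage_log_norm_sub_const_eq_posLog (a := γ)
    rw [Real.circleAverage_def, smul_eq_mul, inv_mul_eq_iff_eq_mul₀ (by positivity)] at this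
    exact this
  have key : ∀ᵐ θ : ℝ, Real.log |2 * Real.cos θ - t| =
      Real.log ‖circleMap 0 1 θ - β‖ + Real.log ‖circleMap 0 1 θ - β⁻¹‖ := by
    filter_upwards [ae_ne_circleMap β, ae_ne_circleMap β⁻¹] with θ h1 h2
    rw [← Real.log_mul (norm_ne_zero_iff.2 (sub_ne_zero.2 h1))
      (norm_ne_zero_iff.2 (sub_ne_zero.2 h2)), ← norm_mul]
    congr 1
    have hz : circleMap 0 1 θ = Complex.exp (θ * Complex.I) := by simp [circleMap]
    have hn : ‖Complex.exp (θ * Complex.I)‖ = 1 := Complex.norm_exp_ofReal_mul_I θ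
    have hc : (2 * Real.cos θ : ℂ) = Complex.exp (θ * Complex.I) +
        (Complex.exp (θ * Complex.I))⁻¹ := by
      rw [← Complex.exp_neg, Complex.ofReal_cos, Complex.two_cos, neg_mul]
    rw [hz, ← Real.norm_eq_abs, ← Complex.norm_real]
    rw [Complex.ofReal_sub, Complex.ofReal_mul, Complex.ofReal_ofNat, hc, ← h]
    set z := Complex.exp (θ * Complex.I)
    have hz0 : z ≠ 0 := Complex.exp_ne_zero _
    have : (z - β) * (z - β⁻¹) = z * (z + z⁻¹ - (β + β⁻¹)) := by field_simp; ring
    rw [this, norm_mul, hn, one_mul]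
  constructor
  · exact ((i β).add (i β⁻¹)).congr_ae (ae_restrict_of_ae (key.mono fun θ hθ => hθ.symm))
  · rw [intervalIntegral.integral_congr_ae (key.mono fun θ hθ _ => hθ),
      intervalIntegral.integral_add (i β) (i β⁻¹), e, e]
    ring

lemma exists_integral_log_abs_two_cos_sub (t : ℝ) : ∃ v : ℝ, 0 ≤ v ∧ v ≤ √(|t| - 2) ∧
    |t| / 2 ≤ Real.exp v ∧
    IntervalIntegrable (fun θ => Real.log |2 * Real.cos θ - t|) volume 0 (2 * Real.pi) ∧
    ∫ θ in (0 : ℝ)..(2 * Real.pi), Real.log |2 * Real.cos θ - t| = 2 * Real.pi * v := by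
  rcases le_or_gt |t| 2 with ht | ht
  · have hβ : Complex.exp (Real.arccos (t / 2) * Complex.I) +
        (Complex.exp (Real.arccos (t / 2) * Complex.I))⁻¹ = t := by
      have ht' := abs_le.1 ht
      rw [← Complex.exp_neg, ← neg_mul, ← Complex.two_cos, ← Complex.ofReal_cos,
        Real.cos_arccos (by linarith) (by linarith)]
      push_cast; ring
    obtain ⟨h1, h2⟩ := integral_log_abs_two_cos_sub_of_add_inv (Complex.exp_ne_zero _) hβ
    refine ⟨0, le_rfl, Real.sqrt_nonneg _, by rw [Real.exp_zero]; linarith, h1, ?_⟩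
    rw [h2, norm_inv, Complex.norm_exp_ofReal_mul_I]
    simp
  · set x := Real.arcosh (|t| / 2) with hx
    have hx0 : 0 ≤ x := Real.arcosh_nonneg (by linarith)
    have hc : Real.cosh x = |t| / 2 := Real.cosh_arcosh (by linarith)
    have hb : ∃ β : ℝ, |β| = Real.exp x ∧ β + β⁻¹ = t := by
      have hc2 : Real.exp x + (Real.exp x)⁻¹ = |t| := by
        rw [← Real.exp_neg]; rw [Real.cosh_eq] at hc; linarith
      rcases le_total 0 t with h0 | h0
      · exact ⟨Real.exp x, abs_of_pos (Real.exp_pos x), by rw [hc2, abs_of_nonneg h0]⟩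
      · refine ⟨-Real.exp x, by rw [abs_neg, abs_of_pos (Real.exp_pos x)], ?_⟩
        rw [abs_of_nonpos h0] at hc2
        rw [inv_neg]; linarith
    obtain ⟨β, hβ1, hβ2⟩ := hb
    have hβ0 : (β : ℂ) ≠ 0 := by
      intro h0
      have : β = 0 := by exact_mod_cast h0
      rw [this, abs_zero] at hβ1
      exact (Real.exp_pos x).ne hβ1
    obtain ⟨h1, h2⟩ := integral_log_abs_two_cos_sub_of_add_inv hβ0 (t := t) (by exact_mod_cast hβ2)
    refine ⟨x, hx0, Real.le_sqrt_of_sq_le ?_, ?_, h1, ?_⟩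
    · have h3 : Real.cosh x = 1 + 2 * Real.sinh (x / 2) ^ 2 := by
        have := Real.cosh_two_mul (x / 2)
        rw [mul_div_cancel₀ x two_ne_zero, Real.cosh_sq] at this
        linarith
      have h4 := Real.self_le_sinh_iff.2 (show 0 ≤ x / 2 by linarith)
      have h5 : (x / 2) ^ 2 ≤ Real.sinh (x / 2) ^ 2 := by gcongr
      nlinarith
    · rw [← hc, Real.cosh_eq]
      have : Real.exp (-x) ≤ Real.exp x := Real.exp_le_exp.2 (by linarith)
      linarith
    · rw [h2, norm_inv, Complex.norm_real, Real.norm_eq_abs, hβ1]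
      have h3 : Real.posLog (Real.exp x) = x := by
        rw [Real.posLog_eq_log (by rw [abs_of_pos (Real.exp_pos x)]; exact Real.one_le_exp hx0),
          Real.log_exp]
      have h4 : Real.posLog (Real.exp x)⁻¹ = 0 := by
        rw [Real.posLog_eq_zero_iff, abs_of_pos (by positivity), ← Real.exp_neg]
        exact Real.exp_le_one_iff.2 (by linarith)
      rw [h3, h4, add_zero]

lemma ae_two_cos_ne (t : ℝ) : ∀ᵐ θ : ℝ, 2 * Real.cos θ ≠ t := by
  have h : ∀ β : ℂ, β ≠ 0 → β + β⁻¹ = t → ∀ᵐ θ : ℝ, 2 * Real.cos θ ≠ t := by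
    intro β hβ hβt
    filter_upwards [ae_ne_circleMap β, ae_ne_circleMap β⁻¹] with θ h1 h2 h3
    have hz : circleMap 0 1 θ = Complex.exp (θ * Complex.I) := by simp [circleMap]
    rw [hz] at h1 h2
    have hc : (2 * Real.cos θ : ℂ) = Complex.exp (θ * Complex.I) +
        (Complex.exp (θ * Complex.I))⁻¹ := by
      rw [← Complex.exp_neg, Complex.ofReal_cos, Complex.two_cos, neg_mul]
    have h4 : (2 * Real.cos θ : ℂ) = t := by exact_mod_cast h3
    rw [hc, ← hβt] at h4
    set z := Complex.exp (θ * Complex.I)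
    have hz0 : z ≠ 0 := Complex.exp_ne_zero _
    have : (z - β) * (z - β⁻¹) = z * (z + z⁻¹ - (β + β⁻¹)) := by field_simp; ring
    rw [h4, sub_self, mul_zero] at this
    rcases mul_eq_zero.1 this with h5 | h5
    · exact h1 (sub_eq_zero.1 h5)
    · exact h2 (sub_eq_zero.1 h5)
  obtain ⟨s, hs⟩ := IsAlgClosed.exists_pow_nat_eq ((t : ℂ) ^ 2 - 4) two_pos
  have h1 : ((t + s) / 2) * ((t - s) / 2) = (1 : ℂ) := by linear_combination (-1 / 4 : ℂ) * hs
  refine h ((t + s) / 2) (left_ne_zero_of_mul_eq_one h1) ?_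
  rw [inv_eq_of_mul_eq_one_right h1]
  ring

lemma log_max_abs_le_integral_log_abs_sub_cos_mul {A B : ℝ} (hAB : A ≠ 0 ∨ B ≠ 0) :
    IntervalIntegrable (fun ψ => Real.log |A - Real.cos ψ * B|) volume 0 (2 * Real.pi) ∧
    2 * Real.pi * (Real.log (max |A| |B|) - Real.log 2) ≤
      ∫ ψ in (0 : ℝ)..(2 * Real.pi), Real.log |A - Real.cos ψ * B| := by
  by_cases hB : B = 0
  · subst hB
    simp only [mul_zero, sub_zero, intervalIntegrable_const, true_and, abs_zero,
      max_eq_left (abs_nonneg A), intervalIntegral.integral_const, smul_eq_mul]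
    have := Real.log_nonneg (one_le_two (α := ℝ))
    have := Real.pi_pos
    nlinarith
  · obtain ⟨v, hv0, -, hv, hi, he⟩ := exists_integral_log_abs_two_cos_sub (2 * A / B)
    have hB' : 0 < |B| := abs_pos.2 hB
    have key : ∀ᵐ ψ : ℝ, Real.log |A - Real.cos ψ * B| =
        Real.log (|B| / 2) + Real.log |2 * Real.cos ψ - 2 * A / B| := by
      filter_upwards [ae_two_cos_ne (2 * A / B)] with ψ hψ
      rw [← Real.log_mul (by positivity) (abs_ne_zero.2 (sub_ne_zero.2 hψ))]
      have : A - Real.cos ψ * B = -(B / 2 * (2 * Real.cos ψ - 2 * A / B)) := by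
        field_simp; ring
      rw [this, abs_neg, abs_mul, abs_div, abs_two]
    have hc : IntervalIntegrable (fun _ : ℝ => Real.log (|B| / 2)) volume 0 (2 * Real.pi) :=
      intervalIntegrable_const
    refine ⟨(hc.add hi).congr_ae (ae_restrict_of_ae (key.mono fun θ hθ => hθ.symm)), ?_⟩
    rw [intervalIntegral.integral_congr_ae (key.mono fun θ hθ _ => hθ),
      intervalIntegral.integral_add hc hi, he, intervalIntegral.integral_const, smul_eq_mul,
      sub_zero, ← mul_add]
    refine mul_le_mul_of_nonneg_left ?_ (by positivity)
    have h1 : max |A| |B| ≤ |B| * Real.exp v := by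
      refine max_le ?_ ?_
      · rw [abs_div, abs_mul, abs_two, div_div, div_le_iff₀ (by positivity)] at hv
        linarith
      · exact le_mul_of_one_le_right hB'.le (Real.one_le_exp hv0)
    have h2 := Real.log_le_log (lt_max_of_lt_right hB') h1
    rw [Real.log_mul hB'.ne' (Real.exp_pos v).ne', Real.log_exp] at h2
    rw [Real.log_div hB'.ne' two_ne_zero]
    linarith

/-- If a diagonal quadratic form is dominated by a sum of local forms, each bounded by `E i` and
nonpositive on a hyperplane, then the positive eigenvalues are dominated by the `E i`. -/
lemma sum_sqrt_le_of_local_bounds {ι κ : Type*} [Fintype ι] [Fintype κ] {lam : ι → ℝ}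
    {E : κ → ℝ} {N q : κ → (ι → ℝ) → ℝ} (l : κ → (ι → ℝ) →ₗ[ℝ] ℝ)
    (hE : ∀ i, 0 ≤ E i) (hN : ∀ i c, 0 ≤ N i c) (hNsum : ∀ c, ∑ i, N i c = ∑ j, c j ^ 2)
    (hform : ∀ c, ∑ j, lam j * c j ^ 2 ≤ ∑ i, q i c) (hq : ∀ i c, q i c ≤ E i * N i c)
    (hq0 : ∀ i c, l i c = 0 → q i c ≤ 0) : ∑ j, √(lam j) ≤ ∑ i, √(E i) := by
  classical
  have hall : ∀ T : Finset {j // 0 < lam j}, T.card ≤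
      (T.biUnion fun j => Finset.univ.filter fun i => lam j ≤ E i).card := by
    intro T
    set S := T.biUnion fun j => Finset.univ.filter fun i => lam j ≤ E i with hS
    by_contra! hlt
    have hTne : T.Nonempty := Finset.card_pos.1 (by omega)
    obtain ⟨j₀, hj₀, hmin⟩ := T.exists_min_image (fun j => lam j) hTne
    let ext : (T → ℝ) →ₗ[ℝ] (ι → ℝ) :=
      { toFun := fun x j => if h : ∃ h : 0 < lam j, (⟨j, h⟩ : {j // 0 < lam j}) ∈ T then
          x ⟨⟨j, h.1⟩, h.2⟩ else 0
        map_add' := fun x y => by ext j; by_cases h : ∃ h : 0 < lam j, (⟨j, h⟩ : {j // 0 < lam j}) ∈ T <;> simp [h]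
        map_smul' := fun r x => by ext j; by_cases h : ∃ h : 0 < lam j, (⟨j, h⟩ : {j // 0 < lam j}) ∈ T <;> simp [h] }
    let A : (T → ℝ) →ₗ[ℝ] (S → ℝ) := LinearMap.pi fun i => (l i).comp ext
    have hker : LinearMap.ker A ≠ ⊥ := LinearMap.ker_ne_bot_of_finrank_lt (by simpa using hlt)
    obtain ⟨x, hx, hx0⟩ := (Submodule.ne_bot_iff _).1 hker
    set c := ext x with hc
    have hl : ∀ i ∈ S, l i c = 0 := fun i hi => congrFun (LinearMap.mem_ker.1 hx) ⟨i, hi⟩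
    have hcT : ∀ j, c j ≠ 0 → lam j₀ ≤ lam j := by
      intro j hj
      by_cases h : ∃ h : 0 < lam j, (⟨j, h⟩ : {j // 0 < lam j}) ∈ T
      · exact hmin _ h.2
      · exact absurd (by simp only [hc, ext, LinearMap.coe_mk, AddHom.coe_mk, dif_neg h]) hj
    have hcpos : 0 < ∑ j, c j ^ 2 := by
      obtain ⟨t, ht⟩ := Function.ne_iff.1 hx0
      refine Finset.sum_pos' (fun j _ => sq_nonneg _) ⟨t.1.1, Finset.mem_univ _, ?_⟩
      have : c t.1.1 = x t := by
        have h : ∃ h : 0 < lam t.1.1, (⟨t.1.1, h⟩ : {j // 0 < lam j}) ∈ T := ⟨t.1.2, t.2⟩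
        simp only [hc, ext, LinearMap.coe_mk, AddHom.coe_mk, dif_pos h]
      rw [this]
      have h0 : x t ≠ 0 := ht
      positivity
    have h1 : lam j₀ * ∑ j, c j ^ 2 ≤ ∑ i, q i c := by
      refine le_trans ?_ (hform c)
      rw [Finset.mul_sum]
      refine Finset.sum_le_sum fun j _ => ?_
      by_cases hj : c j = 0
      · simp [hj]
      · exact mul_le_mul_of_nonneg_right (hcT j hj) (sq_nonneg _)
    have hEi : ∀ i ∉ S, E i < lam j₀ := by
      intro i hi
      by_contra! h
      exact hi (Finset.mem_biUnion.2 ⟨j₀, hj₀, by simpa using h⟩)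
    obtain ⟨m, hm, hmS⟩ : ∃ m, m < lam j₀ ∧ 0 ≤ m ∧ ∀ i ∉ S, E i ≤ m := by
      by_cases hne : (Sᶜ).Nonempty
      · obtain ⟨i, hi, him⟩ := (Sᶜ).exists_max_image E hne
        exact ⟨E i, hEi i (Finset.mem_compl.1 hi), hE i,
          fun k hk => him k (Finset.mem_compl.2 hk)⟩
      · refine ⟨0, j₀.2, le_rfl, fun i hi => absurd ⟨i, Finset.mem_compl.2 hi⟩ hne⟩
    have h2 : ∑ i, q i c ≤ m * ∑ j, c j ^ 2 := by
      rw [← hNsum, Finset.mul_sum]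
      refine Finset.sum_le_sum fun i _ => ?_
      by_cases hi : i ∈ S
      · exact (hq0 i c (hl i hi)).trans (mul_nonneg hmS.1 (hN i c))
      · exact (hq i c).trans (mul_le_mul_of_nonneg_right (hmS.2 i hi) (hN i c))
    nlinarith
  obtain ⟨f, hf, hfE⟩ := (Finset.all_card_le_biUnion_card_iff_exists_injective _).1 hall
  calc ∑ j, √(lam j) = ∑ j ∈ Finset.univ.filter (fun j => 0 < lam j), √(lam j) := by
        refine (Finset.sum_filter_of_ne fun j _ h => ?_).symm
        by_contra h0
        exact h (Real.sqrt_eq_zero_of_nonpos (not_lt.1 h0))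
    _ = ∑ j : {j // 0 < lam j}, √(lam j) :=
        Finset.sum_subtype _ (fun j => by simp) fun j => √(lam j)
    _ ≤ ∑ j : {j // 0 < lam j}, √(E (f j)) := Finset.sum_le_sum fun j _ =>
        Real.sqrt_le_sqrt (by simpa using hfE j)
    _ = ∑ i ∈ Finset.univ.image f, √(E i) := 
        (Finset.sum_image (f := fun i => √(E i)) hf.injOn).symm
    _ ≤ ∑ i, √(E i) := Finset.sum_le_sum_of_subset_of_nonneg (Finset.subset_univ _)
        fun i _ _ => Real.sqrt_nonneg _

/-- The comparison form `∑ v u² - ∑ (|u k| - |u (k+1)|)²` on a block of sites. -/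
def blockForm (v : ℕ → ℝ) (s n : ℕ) (u : ℕ → ℝ) : ℝ :=
  ∑ k ∈ Finset.Ico s n, v k * u k ^ 2 - ∑ k ∈ Finset.Ico s (n - 1), (|u k| - |u (k + 1)|) ^ 2

lemma blockForm_le_add (v : ℕ → ℝ) {s e n : ℕ} (hse : s < e) (hen : e < n) (u : ℕ → ℝ) :
    blockForm v s n u ≤ blockForm v s e u + blockForm v e n u := by
  unfold blockForm
  rw [← Finset.sum_Ico_consecutive _ hse.le hen.le,
    ← Finset.sum_Ico_consecutive _ (show s ≤ e - 1 by omega) (show e - 1 ≤ n - 1 by omega),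
    ← Finset.sum_Ico_consecutive _ (show e - 1 ≤ e by omega) (show e ≤ n - 1 by omega)]
  have : 0 ≤ ∑ k ∈ Finset.Ico (e - 1) e, (|u k| - |u (k + 1)|) ^ 2 :=
    Finset.sum_nonneg fun k _ => sq_nonneg _
  linarith

lemma sq_sub_le_mul_sum_sq (w : ℕ → ℝ) {s e : ℕ} {k l : ℕ} (hsk : s ≤ k) (hkl : k ≤ l)
    (hle : l < e) : (w l - w k) ^ 2 ≤ (e - s : ℝ) *
      ∑ i ∈ Finset.Ico s (e - 1), (w i - w (i + 1)) ^ 2 := by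
  have h1 : w l - w k = ∑ i ∈ Finset.Ico k l, (w (i + 1) - w i) :=
    (Finset.sum_Ico_sub w hkl).symm
  rw [h1]
  refine sq_sum_le_card_mul_sum_sq.trans ?_
  rw [Nat.card_Ico]
  have h2 : ((l - k : ℕ) : ℝ) ≤ e - s := by
    rw [Nat.cast_sub hkl]
    have : (l : ℝ) ≤ e := by exact_mod_cast hle.le
    have : (s : ℝ) ≤ k := by exact_mod_cast hsk
    linarith
  refine mul_le_mul h2 ?_ (Finset.sum_nonneg fun _ _ => sq_nonneg _) ?_
  · simp only [sub_sq_comm (w (_ + 1))]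
    exact Finset.sum_le_sum_of_subset_of_nonneg
      (Finset.Ico_subset_Ico hsk (by omega)) fun _ _ _ => sq_nonneg _
  · exact (Nat.cast_nonneg _).trans h2

lemma sq_abs_sub_le_mul_sum_sq (w : ℕ → ℝ) {s e : ℕ} {k l : ℕ} (hk : k ∈ Finset.Ico s e)
    (hl : l ∈ Finset.Ico s e) : (w l - w k) ^ 2 ≤ (e - s : ℝ) *
      ∑ i ∈ Finset.Ico s (e - 1), (w i - w (i + 1)) ^ 2 := by
  rw [Finset.mem_Ico] at hk hl
  rcases le_total k l with h | h
  · exact sq_sub_le_mul_sum_sq w hk.1 h hl.2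
  · rw [sub_sq_comm]; exact sq_sub_le_mul_sum_sq w hl.1 h hk.2

lemma blockForm_le_mul {v : ℕ → ℝ} (hv : ∀ k, 0 ≤ v k) {s e : ℕ} (hse : s < e)
    (hm : (∑ k ∈ Finset.Ico s e, v k) * (e - s : ℝ) ≤ 1 / 2) (u : ℕ → ℝ) : blockForm v s e u ≤
    2 * (∑ k ∈ Finset.Ico s e, v k) / (e - s : ℝ) * ∑ k ∈ Finset.Ico s e, u k ^ 2 := by
  have hL : (0 : ℝ) < e - s := sub_pos.2 (by exact_mod_cast hse)
  unfold blockForm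
  set D := ∑ k ∈ Finset.Ico s (e - 1), (|u k| - |u (k + 1)|) ^ 2 with hD
  set W := ∑ k ∈ Finset.Ico s e, u k ^ 2 with hW
  have hD0 : 0 ≤ D := Finset.sum_nonneg fun _ _ => sq_nonneg _
  have hpt : ∀ k ∈ Finset.Ico s e, (e - s : ℝ) * u k ^ 2 ≤ 2 * W + 2 * (e - s) ^ 2 * D := by
    intro k hk
    have h1 : ∑ l ∈ Finset.Ico s e, u k ^ 2 ≤
        ∑ l ∈ Finset.Ico s e, (2 * u l ^ 2 + 2 * (e - s) * D) := by
      refine Finset.sum_le_sum fun l hl => ?_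
      have := sq_abs_sub_le_mul_sum_sq (fun i => |u i|) hk hl
      have h2 : u k ^ 2 ≤ 2 * u l ^ 2 + 2 * (|u l| - |u k|) ^ 2 := by
        rw [← sq_abs (u k), ← sq_abs (u l)]
        nlinarith [sq_nonneg (2 * |u l| - |u k|)]
      linarith
    rw [Finset.sum_const, Finset.sum_add_distrib, ← Finset.mul_sum, Finset.sum_const, Nat.card_Ico,
      nsmul_eq_mul, nsmul_eq_mul, Nat.cast_sub hse.le] at h1
    linarith
  have h3 : (e - s : ℝ) * ∑ k ∈ Finset.Ico s e, v k * u k ^ 2 ≤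
      (∑ k ∈ Finset.Ico s e, v k) * (2 * W + 2 * (e - s) ^ 2 * D) := by
    rw [Finset.mul_sum, Finset.sum_mul]
    refine Finset.sum_le_sum fun k hk => ?_
    have := mul_le_mul_of_nonneg_left (hpt k hk) (hv k)
    linarith
  rw [div_mul_eq_mul_div, le_div_iff₀ hL]
  have := mul_le_mul_of_nonneg_right hm (mul_nonneg hL.le hD0)
  nlinarith

lemma blockForm_nonpos {v : ℕ → ℝ} (hv : ∀ k, 0 ≤ v k) {s e : ℕ} (hse : s < e)
    (hm : (∑ k ∈ Finset.Ico s e, v k) * (e - s : ℝ) ≤ 1 / 2) (u : ℕ → ℝ) (hs : u s = 0) :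
    blockForm v s e u ≤ 0 := by
  unfold blockForm
  set D := ∑ k ∈ Finset.Ico s (e - 1), (|u k| - |u (k + 1)|) ^ 2 with hD
  have hD0 : 0 ≤ D := Finset.sum_nonneg fun _ _ => sq_nonneg _
  have h3 : ∑ k ∈ Finset.Ico s e, v k * u k ^ 2 ≤
      (∑ k ∈ Finset.Ico s e, v k) * ((e - s) * D) := by
    rw [Finset.sum_mul]
    refine Finset.sum_le_sum fun k hk => mul_le_mul_of_nonneg_left ?_ (hv k)
    have := sq_abs_sub_le_mul_sum_sq (fun i => |u i|) (Finset.mem_Ico.2 ⟨le_rfl, hse⟩) hk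
    simpa [hs] using this
  have := mul_le_mul_of_nonneg_right hm hD0
  nlinarith

/-- The form `blockForm v s n` is dominated by finitely many local forms, each controlled by a
number `E i` and nonpositive on vectors vanishing at a site, with `∑ √(E i) ≤ B`. -/
def HasBlockDecomposition (v : ℕ → ℝ) (s n : ℕ) (B : ℝ) : Prop :=
  ∃ (κ : Type) (_ : Fintype κ) (site : κ → ℕ) (E : κ → ℝ) (N q : κ → (ℕ → ℝ) → ℝ),
    (∀ i, 0 ≤ E i) ∧ (∀ i u, 0 ≤ N i u) ∧ (∀ u, ∑ i, N i u = ∑ k ∈ Finset.Ico s n, u k ^ 2) ∧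
    (∀ u, blockForm v s n u ≤ ∑ i, q i u) ∧ (∀ i u, q i u ≤ E i * N i u) ∧
    (∀ i u, u (site i) = 0 → q i u ≤ 0) ∧ ∑ i, √(E i) ≤ B

lemma HasBlockDecomposition.mono {v : ℕ → ℝ} {s n : ℕ} {B B' : ℝ}
    (h : HasBlockDecomposition v s n B) (hB : B ≤ B') : HasBlockDecomposition v s n B' := by
  obtain ⟨κ, i, site, E, N, q, h1, h2, h3, h4, h5, h6, h7⟩ := h
  exact ⟨κ, i, site, E, N, q, h1, h2, h3, h4, h5, h6, h7.trans hB⟩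

lemma hasBlockDecomposition_single {v : ℕ → ℝ} {s n : ℕ} {E : ℝ} (hE : 0 ≤ E)
    (h1 : ∀ u, blockForm v s n u ≤ E * ∑ k ∈ Finset.Ico s n, u k ^ 2)
    (h0 : ∀ u, u s = 0 → blockForm v s n u ≤ 0) : HasBlockDecomposition v s n √E :=
  ⟨Unit, inferInstance, fun _ => s, fun _ => E, fun _ u => ∑ k ∈ Finset.Ico s n, u k ^ 2,
    fun _ u => blockForm v s n u, fun _ => hE, fun _ u => Finset.sum_nonneg fun _ _ => sq_nonneg _,
    fun u => by simp, fun u => by simp, fun _ u => h1 u, fun _ u h => h0 u h, by simp⟩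

lemma HasBlockDecomposition.cons {v : ℕ → ℝ} {s e n : ℕ} (hse : s < e) (hen : e < n) {E B : ℝ}
    (hE : 0 ≤ E) (h1 : ∀ u, blockForm v s e u ≤ E * ∑ k ∈ Finset.Ico s e, u k ^ 2)
    (h0 : ∀ u, u s = 0 → blockForm v s e u ≤ 0) (h : HasBlockDecomposition v e n B) :
    HasBlockDecomposition v s n (√E + B) := by
  obtain ⟨κ, _, site, E', N, q, g1, g2, g3, g4, g5, g6, g7⟩ := h
  refine ⟨Option κ, inferInstance, fun i => i.elim s site, fun i => i.elim E E',
    fun i => i.elim (fun u => ∑ k ∈ Finset.Ico s e, u k ^ 2) N,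
    fun i => i.elim (fun u => blockForm v s e u) q, ?_, ?_, ?_, ?_, ?_, ?_, ?_⟩
  · rintro (_ | i)
    exacts [hE, g1 i]
  · rintro (_ | i) u
    exacts [Finset.sum_nonneg fun _ _ => sq_nonneg _, g2 i u]
  · intro u
    rw [Fintype.sum_option, ← Finset.sum_Ico_consecutive _ hse.le hen.le, ← g3 u]
    rfl
  · intro u
    rw [Fintype.sum_option]
    exact (blockForm_le_add v hse hen u).trans (add_le_add_right (g4 u) _)
  · rintro (_ | i) u
    exacts [h1 u, g5 i u]
  · rintro (_ | i) u hu
    exacts [h0 u hu, g6 i u hu]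
  · rw [Fintype.sum_option]
    exact add_le_add_right g7 _

lemma hasBlockDecomposition {v : ℕ → ℝ} (hv : ∀ k, 0 ≤ v k) (n : ℕ) {s : ℕ} (hs : s < n) :
    HasBlockDecomposition v s n (8 * ∑ k ∈ Finset.Ico s n, v k + 1 - 4 * v s) := by
  induction hd : n - s using Nat.strong_induction_on generalizing s with
  | _ d ih =>
  have hIH : ∀ e, s < e → e < n →
      HasBlockDecomposition v e n (8 * ∑ k ∈ Finset.Ico e n, v k + 1 - 4 * v e) :=
    fun e h1 h2 => ih (n - e) (by omega) h2 rfl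
  by_cases hvs : 1 / 2 < v s
  · have hb : ∀ u : ℕ → ℝ, blockForm v s (s + 1) u = v s * u s ^ 2 := fun u => by simp [blockForm]
    have h1 : ∀ u, blockForm v s (s + 1) u ≤ v s * ∑ k ∈ Finset.Ico s (s + 1), u k ^ 2 :=
      fun u => by simp [hb]
    have h0 : ∀ u : ℕ → ℝ, u s = 0 → blockForm v s (s + 1) u ≤ 0 := fun u hu => by simp [hb, hu]
    have hsq : √(v s) ≤ 2 * v s := Real.sqrt_le_iff.2 ⟨by linarith, by nlinarith⟩
    rcases (show s + 1 ≤ n from hs).eq_or_lt with rfl | hlt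
    · refine (hasBlockDecomposition_single (hv s) h1 h0).mono ?_
      simp
      linarith
    · refine (HasBlockDecomposition.cons (Nat.lt_succ_self s) hlt (hv s) h1 h0
        (hIH _ (Nat.lt_succ_self s) hlt)).mono ?_
      rw [← Finset.sum_Ico_consecutive _ (Nat.le_succ s) hlt.le]
      simp
      linarith [hv (s + 1)]
  · push Not at hvs
    set P : ℕ → Prop := fun e => s < e ∧
      (∑ k ∈ Finset.Ico s e, v k) * (e - s : ℝ) ≤ 1 / 2 with hP
    classical
    have hP1 : P (s + 1) := ⟨Nat.lt_succ_self s, by simpa using hvs⟩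
    have hPe : P (Nat.findGreatest P n) := Nat.findGreatest_spec hs hP1
    have hle : Nat.findGreatest P n ≤ n := Nat.findGreatest_le n
    have hmax : ∀ k, Nat.findGreatest P n < k → k ≤ n → ¬ P k :=
      fun k => Nat.findGreatest_is_greatest
    set e := Nat.findGreatest P n
    obtain ⟨hse, hm⟩ := hPe
    have hL : (1 : ℝ) ≤ e - s := by
      have : ((s + 1 : ℕ) : ℝ) ≤ e := by exact_mod_cast hse
      push_cast at this
      linarith
    set m := ∑ k ∈ Finset.Ico s e, v k with hmdef
    have hm0 : 0 ≤ m := Finset.sum_nonneg fun k _ => hv k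
    have hsm : v s ≤ m := Finset.single_le_sum (f := v) (fun k _ => hv k) (Finset.mem_Ico.2 ⟨le_rfl, hse⟩)
    have hE0 : 0 ≤ 2 * m / (e - s : ℝ) := div_nonneg (by linarith) (by linarith)
    have hsq : √(2 * m / (e - s : ℝ)) ≤ 1 / (e - s : ℝ) := by
      refine Real.sqrt_le_iff.2 ⟨by positivity, ?_⟩
      rw [div_pow, div_le_div_iff₀ (by linarith) (by positivity)]
      nlinarith
    have h1 := blockForm_le_mul hv hse hm
    have h0 := blockForm_nonpos hv hse hm
    rcases hle.eq_or_lt with heq | hlt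
    · rw [← heq]
      refine (hasBlockDecomposition_single hE0 h1 h0).mono (hsq.trans ?_)
      have : 1 / (e - s : ℝ) ≤ 1 := (div_le_one (by linarith)).2 hL
      linarith
    · refine (HasBlockDecomposition.cons hse hlt hE0 h1 h0 (hIH e hse hlt)).mono ?_
      have hnot := hmax (e + 1) (Nat.lt_succ_self e) hlt
      have hgt : 1 / 2 < (m + v e) * ((e + 1 : ℕ) - s : ℝ) := by
        by_contra! h
        exact hnot ⟨by omega, by rwa [Finset.sum_Ico_succ_top hse.le]⟩
      push_cast at hgt
      have h4 : 1 / (e - s : ℝ) ≤ 4 * (m + v e) := by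
        rw [div_le_iff₀ (by linarith)]
        nlinarith [hv e]
      rw [← Finset.sum_Ico_consecutive _ hse.le hlt.le]
      linarith

/-- A one-dimensional Lieb–Thirring type inequality for finite Jacobi matrices. -/
lemma sum_sqrt_le_of_blockForm {ι : Type*} [Fintype ι] {n : ℕ} (hn : 0 < n) {v : ℕ → ℝ}
    (hv : ∀ k, 0 ≤ v k) {lam : ι → ℝ} (e : ι → ℕ → ℝ)
    (hnorm : ∀ c : ι → ℝ, ∑ k ∈ Finset.range n, (∑ j, c j * e j k) ^ 2 = ∑ j, c j ^ 2)
    (hform : ∀ c : ι → ℝ, ∑ j, lam j * c j ^ 2 ≤ blockForm v 0 n fun k => ∑ j, c j * e j k) :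
    ∑ j, √(lam j) ≤ 8 * ∑ k ∈ Finset.range n, v k + 1 := by
  obtain ⟨κ, _, site, E, N, q, h1, h2, h3, h4, h5, h6, h7⟩ := hasBlockDecomposition hv n hn
  let l : κ → (ι → ℝ) →ₗ[ℝ] ℝ := fun i =>
    { toFun := fun c => ∑ j, c j * e j (site i)
      map_add' := fun x y => by simp [add_mul, Finset.sum_add_distrib]
      map_smul' := fun r x => by simp [Finset.mul_sum, mul_assoc] }
  refine (sum_sqrt_le_of_local_bounds (lam := lam)
    (N := fun i c => N i fun k => ∑ j, c j * e j k)
    (q := fun i c => q i fun k => ∑ j, c j * e j k) l h1 (fun i c => h2 i _)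
    (fun c => ?_) (fun c => (hform c).trans (h4 _)) (fun i c => h5 i _)
    (fun i c hc => h6 i _ hc)).trans (h7.trans ?_)
  · rw [h3, ← hnorm c, Finset.range_eq_Ico]
  · rw [Finset.range_eq_Ico]
    linarith [hv 0]

/-- Action of the Jacobi matrix with coefficients `a (k + 1)`, `b (k + 1)` on a sequence. -/
def jacobiAct (a b : ℕ → ℝ) (u : ℕ → ℝ) (k : ℕ) : ℝ :=
  (if k = 0 then 0 else a k * u (k - 1)) + b (k + 1) * u k + a (k + 1) * u (k + 1)

/-- An orthonormal eigenbasis of the Jacobi matrix of size `n + 1` whose last diagonal entry is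
perturbed by `τ`. -/
lemma exists_jacobi_eigenbasis (a b : ℕ → ℝ) (n : ℕ) (τ : ℝ) :
    ∃ (lam : Fin (n + 1) → ℝ) (e : Fin (n + 1) → ℕ → ℝ),
      (∀ i j, ∑ k ∈ Finset.range (n + 1), e i k * e j k = if i = j then 1 else 0) ∧
      (∀ j, e j (n + 1) = 0) ∧
      ∀ j, ∀ k ≤ n, jacobiAct a b (e j) k + (if k = n then τ * e j k else 0) = lam j * e j k := by
  classical
  let J : ℕ → ℕ → ℝ := fun k i => (if i = k + 1 then a (k + 1) else 0) +
    (if k = i + 1 then a (i + 1) else 0) +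
    (if i = k then b (k + 1) + (if k = n then τ else 0) else 0)
  let M : Matrix (Fin (n + 1)) (Fin (n + 1)) ℝ := Matrix.of fun k i => J k i
  have hM : M.IsHermitian := by
    ext k i
    simp only [Matrix.conjTranspose_apply, star_trivial, M, Matrix.of_apply, J]
    by_cases hki : (i : ℕ) = k
    · simp [hki]
    · simp only [hki, Ne.symm hki, if_false, add_zero]
      ring
  refine ⟨hM.eigenvalues, fun j k => if h : k < n + 1 then hM.eigenvectorBasis j ⟨k, h⟩ else 0,
    fun i j => ?_, fun j => by simp, fun j k hk => ?_⟩
  · rw [Finset.sum_range]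
    have := (orthonormal_iff_ite.1 hM.eigenvectorBasis.orthonormal) i j
    rw [PiLp.inner_apply] at this
    simp only [RCLike.inner_apply, conj_trivial] at this
    rw [← this]
    exact Finset.sum_congr rfl fun k _ => by simp [mul_comm, Nat.le_of_lt_succ k.2]
  · have h1 := congrFun (hM.mulVec_eigenvectorBasis j) ⟨k, Nat.lt_succ_of_le hk⟩
    simp only [Matrix.mulVec, dotProduct, Pi.smul_apply, smul_eq_mul] at h1
    set u : ℕ → ℝ := fun k => if h : k < n + 1 then hM.eigenvectorBasis j ⟨k, h⟩ else 0 with hu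
    have h2 : ∀ i : Fin (n + 1), hM.eigenvectorBasis j i = u i := fun i => by
      simp only [hu, i.2, dif_pos]
    simp only [h2, M, Matrix.of_apply] at h1
    rw [← Finset.sum_range (fun i => J k i * u i)] at h1
    rw [← h1]
    simp only [J, add_mul, Finset.sum_add_distrib, ite_mul, zero_mul, jacobiAct]
    rw [Finset.sum_ite_eq', Finset.sum_ite_eq']
    have hun : u (n + 1) = 0 := by simp [hu]
    have h3 : ∑ i ∈ Finset.range (n + 1), (if k = i + 1 then a (i + 1) * u i else 0) =
        if k = 0 then 0 else a k * u (k - 1) := by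
      rcases k with _ | k
      · simp
      · simp only [Nat.add_right_cancel_iff]
        rw [Finset.sum_ite_eq]
        simp [show k < n + 1 by omega]
    have h4 : (if k + 1 ∈ Finset.range (n + 1) then a (k + 1) * u (k + 1) else 0) =
        a (k + 1) * u (k + 1) := by
      split_ifs with h
      · rfl
      · rw [show k = n by simp at h; omega, hun, mul_zero]
    rw [h3, h4, if_pos (Finset.mem_range.2 (Nat.lt_succ_of_le hk))]
    ring

lemma sum_mul_jacobiAct (a b u : ℕ → ℝ) (n : ℕ) :
    ∑ k ∈ Finset.range (n + 1), u k * jacobiAct a b u k =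
      ∑ k ∈ Finset.range (n + 1), b (k + 1) * u k ^ 2 +
        2 * ∑ k ∈ Finset.range n, a (k + 1) * (u k * u (k + 1)) +
        a (n + 1) * (u n * u (n + 1)) := by
  induction n with
  | zero => simp [jacobiAct]; ring
  | succ n ih =>
    rw [Finset.sum_range_succ, ih, Finset.sum_range_succ (fun k => b (k + 1) * u k ^ 2) (n + 1),
      Finset.sum_range_succ (fun k => a (k + 1) * (u k * u (k + 1))) n]
    simp [jacobiAct]
    ring

/-- Local potential dominating the perturbation of the free Jacobi matrix. -/
def jacobiPotential (a b : ℕ → ℝ) (k : ℕ) : ℝ :=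
  |b (k + 1)| + |a (k + 1) - 1| + if k = 0 then 0 else |a k - 1|

lemma jacobiPotential_nonneg (a b : ℕ → ℝ) (k : ℕ) : 0 ≤ jacobiPotential a b k := by
  unfold jacobiPotential
  split_ifs <;> positivity

lemma sum_jacobiPotential_le {a b : ℕ → ℝ}
    (hsum : Summable fun n : ℕ => |a (n + 1) - 1| + |b (n + 1)|) (n : ℕ) :
    ∑ k ∈ Finset.range n, jacobiPotential a b k ≤ 2 * ∑' n, (|a (n + 1) - 1| + |b (n + 1)|) := by
  have h0 : ∀ k, 0 ≤ |a (k + 1) - 1| + |b (k + 1)| := fun k => by positivity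
  have h1 : ∑ k ∈ Finset.range n, jacobiPotential a b k ≤
      2 * ∑ k ∈ Finset.range n, (|a (k + 1) - 1| + |b (k + 1)|) - 
        if n = 0 then 0 else |a n - 1| := by
    induction n with
    | zero => simp
    | succ n ih =>
      rw [Finset.sum_range_succ, Finset.sum_range_succ]
      have e : jacobiPotential a b n = |b (n + 1)| + |a (n + 1) - 1| + if n = 0 then 0 else |a n - 1| :=
        rfl
      have := abs_nonneg (b (n + 1))
      rw [e, if_neg n.succ_ne_zero]
      linarith
  have h2 := hsum.sum_le_tsum (Finset.range n) fun k _ => h0 k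
  have h3 : (0 : ℝ) ≤ if n = 0 then 0 else |a n - 1| := by split_ifs <;> positivity
  linarith

lemma sum_jacobiPotential_mul_sq (a b u : ℕ → ℝ) (n : ℕ) :
    ∑ k ∈ Finset.range (n + 1), |b (k + 1)| * u k ^ 2 +
        ∑ k ∈ Finset.range n, |a (k + 1) - 1| * (u k ^ 2 + u (k + 1) ^ 2) ≤
      ∑ k ∈ Finset.range (n + 1), jacobiPotential a b k * u k ^ 2 - |a (n + 1) - 1| * u n ^ 2 := by
  induction n with
  | zero => simp [jacobiPotential]; linarith
  | succ n ih =>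
    rw [Finset.sum_range_succ _ (n + 1),
      Finset.sum_range_succ (fun k => |a (k + 1) - 1| * (u k ^ 2 + u (k + 1) ^ 2)) n,
      Finset.sum_range_succ (fun k => jacobiPotential a b k * u k ^ 2) (n + 1)]
    have : jacobiPotential a b (n + 1) = |b (n + 2)| + |a (n + 2) - 1| + |a (n + 1) - 1| := by
      simp [jacobiPotential]
    rw [this]
    linarith

lemma jacobi_form_le_blockForm {a b u : ℕ → ℝ} {n : ℕ} {σ τ : ℝ} (hσ : |σ| = 1) (hτ : |τ| ≤ 1)
    (hu : u (n + 1) = 0) :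
    σ * (∑ k ∈ Finset.range (n + 1), u k * jacobiAct a b u k + τ * u n ^ 2) -
      2 * ∑ k ∈ Finset.range (n + 1), u k ^ 2 ≤ blockForm (jacobiPotential a b) 0 (n + 1) u := by
  have hD : ∀ n, ∑ k ∈ Finset.range n, (|u k| - |u (k + 1)|) ^ 2 =
      2 * ∑ k ∈ Finset.range (n + 1), u k ^ 2 - u 0 ^ 2 - u n ^ 2 -
        2 * ∑ k ∈ Finset.range n, |u k * u (k + 1)| := by
    intro n
    induction n with
    | zero => simp; ring
    | succ n ih =>
      rw [Finset.sum_range_succ, ih, Finset.sum_range_succ (fun k => u k ^ 2) (n + 1),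
        Finset.sum_range_succ (fun k => |u k * u (k + 1)|) n,
        abs_mul, sub_sq, sq_abs, sq_abs]
      ring
  have hab : ∀ x, σ * x ≤ |x| := fun x => (le_abs_self _).trans (by rw [abs_mul, hσ, one_mul])
  have h1 : σ * ∑ k ∈ Finset.range (n + 1), b (k + 1) * u k ^ 2 ≤
      ∑ k ∈ Finset.range (n + 1), |b (k + 1)| * u k ^ 2 := by
    rw [Finset.mul_sum]
    refine Finset.sum_le_sum fun k _ => ?_
    have := mul_le_mul_of_nonneg_right (hab (b (k + 1))) (sq_nonneg (u k))
    linarith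
  have h2 : 2 * (σ * ∑ k ∈ Finset.range n, a (k + 1) * (u k * u (k + 1))) ≤
      2 * ∑ k ∈ Finset.range n, |u k * u (k + 1)| +
        ∑ k ∈ Finset.range n, |a (k + 1) - 1| * (u k ^ 2 + u (k + 1) ^ 2) := by
    rw [Finset.mul_sum, Finset.mul_sum, Finset.mul_sum, ← Finset.sum_add_distrib]
    refine Finset.sum_le_sum fun k _ => ?_
    have e1 := hab (u k * u (k + 1))
    have e2 := hab ((a (k + 1) - 1) * (u k * u (k + 1)))
    rw [abs_mul] at e2
    have e3 : 2 * |u k * u (k + 1)| ≤ u k ^ 2 + u (k + 1) ^ 2 := by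
      rw [abs_mul, ← sq_abs (u k), ← sq_abs (u (k + 1))]
      nlinarith [sq_nonneg (|u k| - |u (k + 1)|)]
    have e4 := mul_le_mul_of_nonneg_left e3 (abs_nonneg (a (k + 1) - 1))
    linarith
  have h3 : σ * (τ * u n ^ 2) ≤ u n ^ 2 := by
    refine (hab _).trans ?_
    rw [abs_mul, abs_of_nonneg (sq_nonneg (u n))]
    exact mul_le_of_le_one_left (sq_nonneg _) hτ
  have h4 := sum_jacobiPotential_mul_sq a b u n
  have h5 : 0 ≤ |a (n + 1) - 1| * u n ^ 2 := by positivity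
  rw [blockForm, ← Finset.range_eq_Ico, ← Finset.range_eq_Ico, Nat.add_sub_cancel, hD,
    sum_mul_jacobiAct, hu]
  nlinarith [sq_nonneg (u 0)]

lemma sum_sqrt_jacobi_eigenvalues_le {a b : ℕ → ℝ} {n : ℕ} {σ τ : ℝ} (hσ : |σ| = 1)
    (hτ : |τ| ≤ 1) {lam : Fin (n + 1) → ℝ} {e : Fin (n + 1) → ℕ → ℝ}
    (h1 : ∀ i j, ∑ k ∈ Finset.range (n + 1), e i k * e j k = if i = j then 1 else 0)
    (h2 : ∀ j, e j (n + 1) = 0)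
    (h3 : ∀ j, ∀ k ≤ n, jacobiAct a b (e j) k + (if k = n then τ * e j k else 0) =
      lam j * e j k) :
    ∑ j, √(σ * lam j - 2) ≤ 8 * ∑ k ∈ Finset.range (n + 1), jacobiPotential a b k + 1 := by
  have hexp : ∀ c d : Fin (n + 1) → ℝ, ∑ k ∈ Finset.range (n + 1),
      (∑ j, c j * e j k) * (∑ j, d j * e j k) = ∑ j, c j * d j := by
    intro c d
    simp only [Finset.sum_mul_sum]
    rw [Finset.sum_comm]
    refine Finset.sum_congr rfl fun i _ => ?_
    rw [Finset.sum_comm]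
    have : ∀ j, ∑ k ∈ Finset.range (n + 1), c i * e i k * (d j * e j k) =
        c i * d j * if i = j then 1 else 0 := by
      intro j
      rw [← h1 i j, Finset.mul_sum]
      exact Finset.sum_congr rfl fun k _ => by ring
    simp [this]
  have hnorm : ∀ c : Fin (n + 1) → ℝ, ∑ k ∈ Finset.range (n + 1), (∑ j, c j * e j k) ^ 2 =
      ∑ j, c j ^ 2 := fun c => by simpa only [sq] using hexp c c
  refine sum_sqrt_le_of_blockForm n.succ_pos (jacobiPotential_nonneg a b) e hnorm fun c => ?_
  set u : ℕ → ℝ := fun k => ∑ j, c j * e j k with hu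
  have hact : ∀ k ≤ n, jacobiAct a b u k + (if k = n then τ * u k else 0) =
      ∑ j, (lam j * c j) * e j k := by
    intro k hk
    have : ∀ j, (lam j * c j) * e j k =
        c j * (jacobiAct a b (e j) k + (if k = n then τ * e j k else 0)) := fun j => by
      rw [h3 j k hk]; ring
    simp only [this, jacobiAct, hu]
    split_ifs <;> simp only [Finset.mul_sum, ← Finset.sum_add_distrib, zero_add, add_zero] <;>
      exact Finset.sum_congr rfl fun j _ => by ring
  have hq : ∑ k ∈ Finset.range (n + 1), u k * jacobiAct a b u k + τ * u n ^ 2 =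
      ∑ j, lam j * c j ^ 2 := by
    have : ∑ k ∈ Finset.range (n + 1), u k * (jacobiAct a b u k + (if k = n then τ * u k else 0)) =
        ∑ j, lam j * c j ^ 2 := by
      rw [show ∑ j, lam j * c j ^ 2 = ∑ j, c j * (lam j * c j) from
        Finset.sum_congr rfl fun j _ => by ring, ← hexp]
      refine Finset.sum_congr rfl fun k hk => ?_
      rw [hact k (Nat.lt_succ_iff.1 (Finset.mem_range.1 hk))]
    rw [← this]
    simp only [mul_add, Finset.sum_add_distrib, mul_ite, mul_zero]
    rw [Finset.sum_ite_eq' , if_pos (Finset.self_mem_range_succ n)]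
    ring
  refine le_trans (le_of_eq ?_) (jacobi_form_le_blockForm hσ hτ (by simp [hu, h2]))
  rw [hq, hnorm c, Finset.mul_sum, Finset.mul_sum, ← Finset.sum_sub_distrib]
  exact Finset.sum_congr rfl fun j _ => by ring

namespace IsJacobiSystem

variable {a b : ℕ → ℝ} {p : ℕ → Polynomial ℝ}

lemma jacobiAct_eval (h : IsJacobiSystem a b p) (x : ℝ) (k : ℕ) :
    jacobiAct a b (fun i => (p i).eval x) k = x * (p k).eval x := by
  rcases k with _ | k
  · have := congrArg (Polynomial.eval x) h.rec_zero
    simp at this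
    simp [jacobiAct]
    linarith
  · have := congrArg (Polynomial.eval x) (h.rec_succ k)
    simp at this
    simp [jacobiAct]
    linarith

lemma eq_mul_eval (h : IsJacobiSystem a b p) {u : ℕ → ℝ} {x : ℝ} {n : ℕ}
    (hu : ∀ k < n, jacobiAct a b u k = x * u k) {k : ℕ} (hk : k ≤ n) :
    u k = u 0 * (p k).eval x := by
  induction k using Nat.strong_induction_on with
  | _ k ih =>
  rcases k with _ | k
  · simp [h.zero]
  · have e1 := hu k (by omega)
    have e2 := h.jacobiAct_eval x k
    have e3 := ih k (by omega) (by omega)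
    refine mul_left_cancel₀ (h.pos k).ne' ?_
    rcases k with _ | k
    · simp only [jacobiAct, if_true] at e1 e2
      rw [e3] at e1
      linear_combination e1 - u 0 * e2
    · have e4 := ih k (by omega) (by omega)
      simp only [jacobiAct, Nat.succ_ne_zero, if_false, Nat.add_sub_cancel] at e1 e2
      rw [e3, e4] at e1
      linear_combination e1 - u 0 * e2

/-- Factorization of `a (n + 1) * p (n + 1) - τ * p n` over the eigenvalues of the truncated
Jacobi matrix, with the resulting bound on the eigenvalues outside `[-2, 2]`. -/
lemma exists_eq_prod (h : IsJacobiSystem a b p) (n : ℕ) {τ : ℝ} (hτ : |τ| ≤ 1) :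
    ∃ lam : Fin (n + 1) → ℝ,
      (∑ j, √(|lam j| - 2) ≤ 2 * (8 * ∑ k ∈ Finset.range (n + 1), jacobiPotential a b k + 1)) ∧
      ∀ x, a (n + 1) * (p (n + 1)).eval x - τ * (p n).eval x =
        (p n).leadingCoeff * ∏ j, (x - lam j) := by
  obtain ⟨lam, e, h1, h2, h3⟩ := exists_jacobi_eigenbasis a b n τ
  refine ⟨lam, ?_, ?_⟩
  · have p1 := sum_sqrt_jacobi_eigenvalues_le (σ := 1) (by simp) hτ h1 h2 h3
    have p2 := sum_sqrt_jacobi_eigenvalues_le (σ := -1) (by simp) hτ h1 h2 h3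
    have : ∑ j, √(|lam j| - 2) ≤ ∑ j, √(1 * lam j - 2) + ∑ j, √(-1 * lam j - 2) := by
      rw [← Finset.sum_add_distrib]
      refine Finset.sum_le_sum fun j _ => ?_
      rcases abs_cases (lam j) with ⟨hj, _⟩ | ⟨hj, _⟩ <;> rw [hj]
      · simp [Real.sqrt_nonneg]
      · simp [Real.sqrt_nonneg]
    linarith
  have heq : ∀ j, ∀ k ≤ n, e j k = e j 0 * (p k).eval (lam j) := fun j k hk =>
    h.eq_mul_eval (n := n) (fun k hk => by simpa [hk.ne] using h3 j k hk.le) hk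
  have h0 : ∀ j, e j 0 ≠ 0 := by
    intro j hj
    have := h1 j j
    rw [Finset.sum_eq_zero, if_pos rfl] at this
    · exact zero_ne_one this
    · intro k hk
      rw [heq j k (Nat.lt_succ_iff.1 (Finset.mem_range.1 hk)), hj]
      simp
  have hinj : Function.Injective lam := by
    intro i j hij
    by_contra hne
    have e1 := h1 i j
    have e2 := h1 i i
    rw [if_neg hne] at e1
    rw [if_pos rfl] at e2
    have : ∑ k ∈ Finset.range (n + 1), e i k * e j k * e i 0 =
        ∑ k ∈ Finset.range (n + 1), e i k * e i k * e j 0 := by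
      refine Finset.sum_congr rfl fun k hk => ?_
      have hk' := Nat.lt_succ_iff.1 (Finset.mem_range.1 hk)
      rw [heq i k hk', heq j k hk', hij]
      ring
    rw [← Finset.sum_mul, ← Finset.sum_mul, e1, e2] at this
    exact h0 j (by linarith)
  set A : Polynomial ℝ := Polynomial.C (a (n + 1)) * p (n + 1) with hA
  set B : Polynomial ℝ := Polynomial.C τ * p n with hB
  have hAd : A.degree = (n + 1 : ℕ) := by
    rw [hA, Polynomial.degree_C_mul (h.pos n).ne', Polynomial.degree_eq_natDegree (h.ne_zero _),
      h.natDegree]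
  have hBd : B.degree < (n + 1 : ℕ) := by
    rw [hB, ← Polynomial.smul_eq_C_mul]
    refine (Polynomial.degree_smul_le _ _).trans_lt ?_
    rw [Polynomial.degree_eq_natDegree (h.ne_zero _), h.natDegree]
    exact_mod_cast Nat.lt_succ_self n
  have hlA : A.leadingCoeff = (p n).leadingCoeff := by
    rw [hA, Polynomial.leadingCoeff_mul, Polynomial.leadingCoeff_C, h.leadingCoeff_succ]
  set P : Polynomial ℝ := ∏ j, (Polynomial.X - Polynomial.C (lam j)) with hP
  have hPm : P.Monic := Polynomial.monic_prod_of_monic _ _ fun j _ => Polynomial.monic_X_sub_C _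
  have hPd : P.degree = (n + 1 : ℕ) := by
    rw [hP, Polynomial.degree_prod]
    simp
  have hlc : (p n).leadingCoeff ≠ 0 := Polynomial.leadingCoeff_ne_zero.2 (h.ne_zero n)
  have hQd : (A - B).degree = (n + 1 : ℕ) := by
    rw [Polynomial.degree_sub_eq_left_of_degree_lt (by rw [hAd]; exact hBd), hAd]
  have hQl : (A - B).leadingCoeff = (p n).leadingCoeff := by
    rw [Polynomial.leadingCoeff_sub_of_degree_lt (by rw [hAd]; exact hBd), hlA]
  have key : A - B = Polynomial.C (p n).leadingCoeff * P := by
    classical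
    refine Polynomial.eq_of_degree_sub_lt_of_eval_finset_eq (Finset.univ.image lam) ?_ ?_
    · rw [Finset.card_image_of_injective _ hinj, Finset.card_univ, Fintype.card_fin, ← hQd]
      refine Polynomial.degree_sub_lt_left ?_ ?_ ?_
      · rw [hQd, Polynomial.degree_C_mul hlc, hPd]
      · intro h0
        rw [h0] at hQl
        exact hlc (by simpa using hQl.symm)
      · rw [hQl, Polynomial.leadingCoeff_mul, Polynomial.leadingCoeff_C, hPm.leadingCoeff, mul_one]
    · intro x hx
      obtain ⟨j, -, rfl⟩ := Finset.mem_image.1 hx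
      have hz : P.eval (lam j) = 0 := by
        rw [hP, Polynomial.eval_prod]
        exact Finset.prod_eq_zero (Finset.mem_univ j) (by simp)
      have e1 := h3 j n le_rfl
      have e2 := h.jacobiAct_eval (lam j) n
      rw [if_pos rfl] at e1
      simp only [jacobiAct, h2] at e1 e2
      have e3 : e j 0 * (a (n + 1) * (p (n + 1)).eval (lam j) - τ * (p n).eval (lam j)) = 0 := by
        rcases n with _ | n
        · simp only [if_true] at e1 e2
          rw [heq j 0 le_rfl] at e1
          simp only [h.zero, Polynomial.eval_one] at *
          linear_combination e j 0 * e2 - e1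
        · simp only [Nat.succ_ne_zero, if_false, Nat.add_sub_cancel] at e1 e2
          rw [heq j (n + 1) le_rfl, heq j n (Nat.le_succ n)] at e1
          linear_combination e j 0 * e2 - e1
      have e4 := (mul_eq_zero.1 e3).resolve_left (h0 j)
      simpa [hA, hB, hz] using e4
  intro x
  have := congrArg (Polynomial.eval x) key
  simpa [hA, hB, hP, Polynomial.eval_prod] using this

end IsJacobiSystem

lemma exists_lintegral_le_of_forall_lintegral_le {ν : Measure ℝ} [IsFiniteMeasure ν] (hν : ν ≠ 0)
    {f : ℝ → ℝ → ENNReal} (hf : Measurable fun q : ℝ × ℝ => f q.1 q.2) {K : ENNReal}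
    (hK : ∀ x, ∫⁻ y, f x y ∂ν ≤ K) : ∃ y, ∫⁻ x, f x y ∂ν ≤ K := by
  have hm : Measurable fun y => ∫⁻ x, f x y ∂ν :=
    Measurable.lintegral_prod_left' (f := fun q : ℝ × ℝ => f q.1 q.2) hf
  obtain ⟨y, hy⟩ := exists_le_laverage hν hm.aemeasurable
  refine ⟨y, hy.trans ?_⟩
  rw [laverage_eq, ← lintegral_lintegral_swap (f := f) hf.aemeasurable]
  refine ENNReal.div_le_of_le_mul ((lintegral_mono hK).trans ?_)
  simp

namespace IsJacobiSystem

variable {a b : ℕ → ℝ} {p : ℕ → Polynomial ℝ}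

lemma log_leadingCoeff (h : IsJacobiSystem a b p) (n : ℕ) :
    Real.log (p n).leadingCoeff = -∑ k ∈ Finset.range n, Real.log (a (k + 1)) := by
  induction n with
  | zero => simp [h.zero]
  | succ n ih =>
    have h0 : (p (n + 1)).leadingCoeff ≠ 0 := Polynomial.leadingCoeff_ne_zero.2 (h.ne_zero _)
    rw [Finset.sum_range_succ, neg_add, ← ih, ← h.leadingCoeff_succ n,
      Real.log_mul (h.pos n).ne' h0]
    ring

lemma _root_.summable_abs_log_of_summable {a b : ℕ → ℝ}
    (hsum : Summable fun n : ℕ => |a (n + 1) - 1| + |b (n + 1)|) :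
    Summable fun n => |Real.log (a (n + 1))| := by
  have h1 : Summable fun n : ℕ => a (n + 1) - 1 := by
    refine Summable.of_norm_bounded hsum fun n => ?_
    rw [Real.norm_eq_abs]
    linarith [abs_nonneg (b (n + 1))]
  have := Real.summable_log_one_add_of_summable h1
  simpa using this.abs

/-- Uniform upper bound for the means of `log |a (n + 1) * p (n + 1) - τ * p n|` over `[-2, 2]`
with respect to the equilibrium measure. -/
lemma exists_integral_log_abs_sub_le (h : IsJacobiSystem a b p)
    (hsum : Summable fun n : ℕ => |a (n + 1) - 1| + |b (n + 1)|) :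
    ∃ C : ℝ, ∀ (n : ℕ) (τ : ℝ), |τ| ≤ 1 →
      (∀ᵐ θ : ℝ, a (n + 1) * (p (n + 1)).eval (2 * Real.cos θ) -
        τ * (p n).eval (2 * Real.cos θ) ≠ 0) ∧
      IntervalIntegrable (fun θ => Real.log |a (n + 1) * (p (n + 1)).eval (2 * Real.cos θ) -
        τ * (p n).eval (2 * Real.cos θ)|) volume 0 (2 * Real.pi) ∧
      ∫ θ in (0 : ℝ)..(2 * Real.pi), Real.log |a (n + 1) * (p (n + 1)).eval (2 * Real.cos θ) -
        τ * (p n).eval (2 * Real.cos θ)| ≤ C := by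
  refine ⟨2 * Real.pi * (∑' n, |Real.log (a (n + 1))| +
    2 * (8 * (2 * ∑' n, (|a (n + 1) - 1| + |b (n + 1)|)) + 1)), fun n τ hτ => ?_⟩
  obtain ⟨lam, hlam, hprod⟩ := h.exists_eq_prod n hτ
  have hlc : (p n).leadingCoeff ≠ 0 := Polynomial.leadingCoeff_ne_zero.2 (h.ne_zero _)
  choose V hV0 hV1 _ hVi hVe using fun j => exists_integral_log_abs_two_cos_sub (lam j)
  have hne : ∀ᵐ θ : ℝ, ∀ j, 2 * Real.cos θ - lam j ≠ 0 := by
    rw [ae_all_iff]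
    intro j
    filter_upwards [ae_two_cos_ne (lam j)] with θ hθ
    exact sub_ne_zero.2 hθ
  have hlog : ∀ᵐ θ : ℝ, Real.log (p n).leadingCoeff + ∑ j, Real.log |2 * Real.cos θ - lam j| =
      Real.log |a (n + 1) * (p (n + 1)).eval (2 * Real.cos θ) -
        τ * (p n).eval (2 * Real.cos θ)| := by
    filter_upwards [hne] with θ hθ
    rw [hprod, Real.log_abs, Real.log_mul hlc (Finset.prod_ne_zero_iff.2 fun j _ => hθ j),
      Real.log_prod fun j _ => hθ j]
    simp only [Real.log_abs]
  have hVs : IntervalIntegrable (fun θ => ∑ j, Real.log |2 * Real.cos θ - lam j|) volume 0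
      (2 * Real.pi) := by
    simpa only [Finset.sum_fn] using IntervalIntegrable.sum Finset.univ fun j _ => hVi j
  have hI : IntervalIntegrable (fun θ => Real.log (p n).leadingCoeff +
      ∑ j, Real.log |2 * Real.cos θ - lam j|) volume 0 (2 * Real.pi) :=
    intervalIntegrable_const.add hVs
  refine ⟨?_, hI.congr_ae (ae_restrict_of_ae hlog), ?_⟩
  · filter_upwards [hne] with θ hθ
    rw [hprod]
    exact mul_ne_zero hlc (Finset.prod_ne_zero_iff.2 fun j _ => hθ j)
  · rw [← intervalIntegral.integral_congr_ae (hlog.mono fun θ hθ _ => hθ),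
      intervalIntegral.integral_add intervalIntegrable_const hVs,
      intervalIntegral.integral_finsetSum fun j _ => hVi j]
    simp only [hVe, intervalIntegral.integral_const, sub_zero, smul_eq_mul]
    rw [← Finset.mul_sum, ← mul_add]
    refine mul_le_mul_of_nonneg_left (add_le_add ?_ ?_) (by positivity)
    · rw [h.log_leadingCoeff, ← Finset.sum_neg_distrib]
      exact (Finset.sum_le_sum fun k _ => neg_le_abs _).trans
        ((summable_abs_log_of_summable hsum).sum_le_tsum _ fun k _ => abs_nonneg _)
    · refine (Finset.sum_le_sum fun j _ => hV1 j).trans (hlam.trans ?_)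
      have := sum_jacobiPotential_le hsum (n + 1)
      linarith

/-- Uniform upper bound for the means of the logarithm of the size of the orthonormal
polynomials over `[-2, 2]` with respect to the equilibrium measure. -/
lemma exists_integral_log_max_le (h : IsJacobiSystem a b p)
    (hsum : Summable fun n : ℕ => |a (n + 1) - 1| + |b (n + 1)|) :
    ∃ C : ℝ, ∀ n : ℕ,
      IntegrableOn (fun θ => Real.log (max |a (n + 1) * (p (n + 1)).eval (2 * Real.cos θ)|
        |(p n).eval (2 * Real.cos θ)|)) (Ioc 0 (2 * Real.pi)) ∧
      ∫ θ in Ioc 0 (2 * Real.pi), Real.log (max |a (n + 1) * (p (n + 1)).eval (2 * Real.cos θ)|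
        |(p n).eval (2 * Real.cos θ)|) ≤ C := by
  obtain ⟨C, hC⟩ := h.exists_integral_log_abs_sub_le hsum
  refine ⟨4 * Real.pi * Real.log 2 + C, fun n => ?_⟩
  set A : ℝ → ℝ := fun θ => a (n + 1) * (p (n + 1)).eval (2 * Real.cos θ) with hA
  set B : ℝ → ℝ := fun θ => (p n).eval (2 * Real.cos θ) with hB
  have hAc : Measurable A := by
    have : Continuous A := by fun_prop
    exact this.measurable
  have hBc : Measurable B := by
    have : Continuous B := by fun_prop
    exact this.measurable
  set G : ℝ → ℝ := fun θ => Real.log (max |A θ| |B θ|) with hG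
  have h2pi : (0 : ℝ) ≤ 2 * Real.pi := by positivity
  have hAB : ∀ θ, A θ ≠ 0 ∨ B θ ≠ 0 := by
    intro θ
    by_contra! h0
    have := h.carmona_pos n (2 * Real.cos θ)
    rw [carmona, show a (n + 1) * (p (n + 1)).eval (2 * Real.cos θ) = 0 from h0.1,
      show (p n).eval (2 * Real.cos θ) = 0 from h0.2] at this
    simp at this
  have hmax : ∀ θ, 0 < max |A θ| |B θ| := fun θ => by
    rcases hAB θ with h0 | h0
    · exact lt_max_of_lt_left (abs_pos.2 h0)
    · exact lt_max_of_lt_right (abs_pos.2 h0)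
  have hnn : ∀ θ τ, |τ| ≤ 1 → A θ - τ * B θ ≠ 0 →
      0 ≤ G θ + Real.log 2 - Real.log |A θ - τ * B θ| := by
    intro θ τ hτ h0
    rw [sub_nonneg, hG, ← Real.log_mul (hmax θ).ne' two_ne_zero]
    refine Real.log_le_log (abs_pos.2 h0) ?_
    have e1 : |τ * B θ| ≤ |B θ| := by
      rw [abs_mul]; exact mul_le_of_le_one_left (abs_nonneg _) hτ
    have := abs_sub (A θ) (τ * B θ)
    linarith [le_max_left |A θ| |B θ|, le_max_right |A θ| |B θ|]
  set ν : Measure ℝ := volume.restrict (Ioc 0 (2 * Real.pi)) with hν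
  have hinner : ∀ θ, ∫⁻ ψ, ENNReal.ofReal (G θ + Real.log 2 - Real.log |A θ - Real.cos ψ * B θ|) ∂ν ≤
      ENNReal.ofReal (4 * Real.pi * Real.log 2) := by
    intro θ
    obtain ⟨i1, i2⟩ := log_max_abs_le_integral_log_abs_sub_cos_mul (hAB θ)
    have hae : ∀ᵐ ψ : ℝ, A θ - Real.cos ψ * B θ ≠ 0 := by
      by_cases hb : B θ = 0
      · simp [hb, (hAB θ).resolve_right (not_not.2 hb)]
      · filter_upwards [ae_two_cos_ne (2 * A θ / B θ)] with ψ hψ h0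
        apply hψ
        rw [eq_div_iff hb]
        linarith
    have i1' := (intervalIntegrable_iff_integrableOn_Ioc_of_le h2pi).1 i1
    rw [intervalIntegral.integral_of_le h2pi] at i2
    have hint : Integrable (fun ψ => G θ + Real.log 2 - Real.log |A θ - Real.cos ψ * B θ|) ν :=
      (integrable_const _).sub i1'
    rw [← ofReal_integral_eq_lintegral_ofReal hint
      (ae_restrict_of_ae (hae.mono fun ψ hψ => hnn θ _ (Real.abs_cos_le_one ψ) hψ))]
    refine ENNReal.ofReal_le_ofReal ?_
    rw [integral_sub (integrable_const _) i1', integral_const]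
    have : ν.real univ = 2 * Real.pi := by simp [hν, h2pi]
    rw [this, smul_eq_mul]
    change 2 * Real.pi * (G θ - Real.log 2) ≤ _ at i2
    linarith
  have hmeas : Measurable (fun q : ℝ × ℝ =>
      ENNReal.ofReal (G q.1 + Real.log 2 - Real.log |A q.1 - Real.cos q.2 * B q.1|)) := by
    have m1 : Measurable fun q : ℝ × ℝ => A q.1 := hAc.comp measurable_fst
    have m2 : Measurable fun q : ℝ × ℝ => B q.1 := hBc.comp measurable_fst
    have m3 : Measurable fun q : ℝ × ℝ => Real.cos q.2 := Real.measurable_cos.comp measurable_snd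
    have m4 : Measurable fun q : ℝ × ℝ => G q.1 := (m1.abs.max m2.abs).log
    exact ((m4.add_const _).sub ((m1.sub (m3.mul m2)).abs.log)).ennreal_ofReal
  have hν0 : ν ≠ 0 := fun h0 => by
    have := congrArg (fun m => m univ) h0
    simp [hν] at this
    linarith [Real.pi_pos]
  have : IsFiniteMeasure ν := by
    rw [hν]; infer_instance
  obtain ⟨ψ, hψ⟩ := exists_lintegral_le_of_forall_lintegral_le hν0 hmeas hinner
  obtain ⟨c1, c2, c3⟩ := hC n (Real.cos ψ) (Real.abs_cos_le_one ψ)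
  change ∀ᵐ θ, A θ - Real.cos ψ * B θ ≠ 0 at c1
  have c2' : Integrable (fun θ => Real.log |A θ - Real.cos ψ * B θ|) ν :=
    (intervalIntegrable_iff_integrableOn_Ioc_of_le h2pi).1 c2
  rw [intervalIntegral.integral_of_le h2pi] at c3
  change ∫ θ, Real.log |A θ - Real.cos ψ * B θ| ∂ν ≤ C at c3
  set g : ℝ → ℝ := fun θ => G θ + Real.log 2 - Real.log |A θ - Real.cos ψ * B θ| with hg
  have hgm : Measurable g :=
    ((hAc.abs.max hBc.abs).log.add_const _).sub ((hAc.sub (hBc.const_mul _)).abs.log)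
  have hg0 : 0 ≤ᵐ[ν] g :=
    ae_restrict_of_ae (c1.mono fun θ hθ => hnn θ _ (Real.abs_cos_le_one ψ) hθ)
  have hgi : Integrable g ν :=
    (lintegral_ofReal_ne_top_iff_integrable hgm.aestronglyMeasurable hg0).1
      (hψ.trans_lt ENNReal.ofReal_lt_top).ne
  have hgle : ∫ θ, g θ ∂ν ≤ 4 * Real.pi * Real.log 2 := by
    rw [← ofReal_integral_eq_lintegral_ofReal hgi hg0] at hψ
    refine (ENNReal.ofReal_le_ofReal_iff ?_).1 hψ
    have := Real.log_nonneg (one_le_two (α := ℝ))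
    positivity
  have hGe : G = fun θ => g θ - Real.log 2 + Real.log |A θ - Real.cos ψ * B θ| := by
    funext θ
    simp only [hg]
    ring
  have hgi' : Integrable (fun θ => g θ - Real.log 2) ν := hgi.sub (integrable_const _)
  change Integrable G ν ∧ ∫ θ, G θ ∂ν ≤ _
  rw [hGe]
  refine ⟨hgi'.add c2', ?_⟩
  rw [integral_add hgi' c2', integral_sub hgi (integrable_const _), integral_const]
  have : 0 ≤ ν.real univ • Real.log 2 :=
    mul_nonneg measureReal_nonneg (Real.log_nonneg one_le_two)
  linarith

end IsJacobiSystem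

/-- Size of the vector `(a (n + 1) * p (n + 1), p n)` at `x` in the maximum norm. -/
def jacobiMax (a : ℕ → ℝ) (p : ℕ → Polynomial ℝ) (n : ℕ) (x : ℝ) : ℝ :=
  max |a (n + 1) * (p (n + 1)).eval x| |(p n).eval x|

/-- A positive majorant of `log (jacobiMax a p n (2 * cos θ))`. -/
def logMaxMajorant (a : ℕ → ℝ) (p : ℕ → Polynomial ℝ) (n : ℕ) (θ : ℝ) : ℝ :=
  Real.log (jacobiMax a p n (2 * Real.cos θ)) +
    (|Real.sin θ| / jacobiMax a p n (2 * Real.cos θ) ^ 2 - Real.log |Real.sin θ|) / 2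

namespace IsJacobiSystem

variable {a b : ℕ → ℝ} {p : ℕ → Polynomial ℝ}

lemma jacobiMax_pos (h : IsJacobiSystem a b p) (n : ℕ) (x : ℝ) : 0 < jacobiMax a p n x := by
  unfold jacobiMax
  by_contra! h0
  have h1 : a (n + 1) * (p (n + 1)).eval x = 0 :=
    abs_nonpos_iff.1 ((le_max_left _ _).trans h0)
  have h2 : (p n).eval x = 0 := abs_nonpos_iff.1 ((le_max_right _ _).trans h0)
  have := h.carmona_pos n x
  rw [carmona, h1, h2] at this
  simp at this

lemma carmona_le (n : ℕ) (x : ℝ) : carmona a p n x ≤ 2 * jacobiMax a p n x ^ 2 := by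
  have h1 : (a (n + 1) * (p (n + 1)).eval x) ^ 2 ≤ jacobiMax a p n x ^ 2 := by
    rw [← sq_abs]
    exact pow_le_pow_left₀ (abs_nonneg _) (le_max_left _ _) 2
  have h2 : (p n).eval x ^ 2 ≤ jacobiMax a p n x ^ 2 := by
    rw [← sq_abs]
    exact pow_le_pow_left₀ (abs_nonneg _) (le_max_right _ _) 2
  unfold carmona
  linarith

/-- The Jost-type function `a (n + 1) * p (n + 1) - exp (I * θ) * p n` at `2 * cos θ`. -/
def jost (a : ℕ → ℝ) (p : ℕ → Polynomial ℝ) (θ : ℝ) (n : ℕ) : ℂ :=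
  (a (n + 1) * (p (n + 1)).eval (2 * Real.cos θ) : ℝ) -
    Complex.exp (θ * Complex.I) * ((p n).eval (2 * Real.cos θ) : ℝ)

lemma norm_jost_le (θ : ℝ) (n : ℕ) :
    ‖jost a p θ n‖ ≤ 2 * jacobiMax a p n (2 * Real.cos θ) := by
  unfold jost
  refine (norm_sub_le _ _).trans ?_
  rw [norm_mul, Complex.norm_exp_ofReal_mul_I, one_mul, Complex.norm_real, Complex.norm_real,
    Real.norm_eq_abs, Real.norm_eq_abs]
  unfold jacobiMax
  linarith [le_max_left |a (n + 1) * (p (n + 1)).eval (2 * Real.cos θ)|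
    |(p n).eval (2 * Real.cos θ)|, le_max_right |a (n + 1) * (p (n + 1)).eval (2 * Real.cos θ)|
    |(p n).eval (2 * Real.cos θ)|]

lemma jacobiMax_le_norm_jost {θ : ℝ} (hθ : 0 < Real.sin θ) (n : ℕ) :
    jacobiMax a p n (2 * Real.cos θ) ≤ 2 / Real.sin θ * ‖jost a p θ n‖ := by
  have him : (jost a p θ n).im = -(Real.sin θ * (p n).eval (2 * Real.cos θ)) := by
    simp [jost, Complex.exp_ofReal_mul_I_im, Complex.exp_ofReal_mul_I_re]
  have h1 : Real.sin θ * |(p n).eval (2 * Real.cos θ)| ≤ ‖jost a p θ n‖ := by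
    have := Complex.abs_im_le_norm (jost a p θ n)
    rwa [him, abs_neg, abs_mul, abs_of_pos hθ] at this
  have h2 : |(p n).eval (2 * Real.cos θ)| ≤ ‖jost a p θ n‖ / Real.sin θ :=
    (le_div_iff₀ hθ).2 (by linarith)
  have h4 : ‖jost a p θ n‖ ≤ ‖jost a p θ n‖ / Real.sin θ :=
    (le_div_iff₀ hθ).2 (mul_le_of_le_one_right (norm_nonneg _) (Real.sin_le_one θ))
  have h3 : |a (n + 1) * (p (n + 1)).eval (2 * Real.cos θ)| ≤
      ‖jost a p θ n‖ + |(p n).eval (2 * Real.cos θ)| := by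
    have e : ((a (n + 1) * (p (n + 1)).eval (2 * Real.cos θ) : ℝ) : ℂ) = jost a p θ n +
        Complex.exp (θ * Complex.I) * ((p n).eval (2 * Real.cos θ) : ℝ) := by
      simp [jost]
    have := norm_add_le (jost a p θ n)
      (Complex.exp (θ * Complex.I) * ((p n).eval (2 * Real.cos θ) : ℝ))
    rw [← e, norm_mul, Complex.norm_exp_ofReal_mul_I, one_mul, Complex.norm_real,
      Complex.norm_real, Real.norm_eq_abs, Real.norm_eq_abs] at this
    exact this
  rw [div_mul_eq_mul_div, mul_div_assoc]
  exact max_le (by linarith) (by linarith [norm_nonneg (jost a p θ n)])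

lemma jost_succ (h : IsJacobiSystem a b p) (θ : ℝ) (n : ℕ) :
    Complex.exp (θ * Complex.I) * jost a p θ (n + 1) = a (n + 1) * jost a p θ n +
      (1 - a (n + 1) ^ 2 - b (n + 2) * Complex.exp (θ * Complex.I)) *
        ((p (n + 1)).eval (2 * Real.cos θ) : ℝ) := by
  have h1 := congrArg (Polynomial.eval (2 * Real.cos θ)) (h.rec_succ n)
  simp only [Polynomial.eval_mul, Polynomial.eval_add, Polynomial.eval_X, Polynomial.eval_C] at h1
  have h2 := congrArg (fun y : ℝ => (y : ℂ)) h1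
  have h3 : (2 * Real.cos θ : ℂ) = Complex.exp (θ * Complex.I) + Complex.exp (-(θ * Complex.I)) := by
    rw [Complex.ofReal_cos, Complex.two_cos, neg_mul]
  have h4 : Complex.exp (θ * Complex.I) * Complex.exp (-(θ * Complex.I)) = 1 := by
    rw [← Complex.exp_add]; simp
  unfold jost
  push_cast at h2 h3 ⊢
  rw [h3] at h2
  set z := Complex.exp (θ * Complex.I)
  set w := Complex.exp (-(θ * Complex.I))
  linear_combination (-z) * h2 + ((Polynomial.eval (2 * Real.cos θ) (p (n + 1)) : ℝ) : ℂ) * h4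

lemma norm_jost_pos (h : IsJacobiSystem a b p) {θ : ℝ} (hθ : 0 < Real.sin θ) (n : ℕ) :
    0 < ‖jost a p θ n‖ := by
  refine lt_of_le_of_ne (norm_nonneg _) fun h0 => ?_
  have := jacobiMax_le_norm_jost (a := a) (p := p) hθ n
  rw [← h0, mul_zero] at this
  exact absurd (h.jacobiMax_pos n (2 * Real.cos θ)) (not_lt.2 this)

lemma abs_norm_jost_succ_sub_le (h : IsJacobiSystem a b p) {θ : ℝ} (hθ : 0 < Real.sin θ) (n : ℕ) :
    |‖jost a p θ (n + 1)‖ / ‖jost a p θ n‖ - 1| ≤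
      (1 + (2 + a (n + 1)) * (2 / Real.sin θ) / a (n + 1)) *
        (|a (n + 1) - 1| + |b (n + 2)|) := by
  have hr := h.norm_jost_pos hθ n
  have ha := h.pos n
  set r := ‖jost a p θ n‖
  set r' := ‖jost a p θ (n + 1)‖
  have hp : |(p (n + 1)).eval (2 * Real.cos θ)| ≤ 2 / Real.sin θ * r / a (n + 1) := by
    rw [le_div_iff₀ ha]
    have := (le_max_left _ _).trans (jacobiMax_le_norm_jost (a := a) (p := p) hθ n)
    rw [abs_mul, abs_of_pos ha] at this
    linarith
  have h1 : |r' - a (n + 1) * r| ≤ (|1 - a (n + 1) ^ 2| + |b (n + 2)|) *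
      (2 / Real.sin θ * r / a (n + 1)) := by
    have e1 : r' = ‖Complex.exp (θ * Complex.I) * jost a p θ (n + 1)‖ := by
      rw [norm_mul, Complex.norm_exp_ofReal_mul_I, one_mul]
    have e2 : a (n + 1) * r = ‖(a (n + 1) : ℂ) * jost a p θ n‖ := by
      rw [norm_mul, Complex.norm_real, Real.norm_of_nonneg ha.le]
    rw [e1, e2]
    refine (abs_norm_sub_norm_le _ _).trans ?_
    rw [h.jost_succ, add_sub_cancel_left, norm_mul, Complex.norm_real, Real.norm_eq_abs]
    refine mul_le_mul ((norm_sub_le _ _).trans ?_) hp (abs_nonneg _) (by positivity)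
    rw [norm_mul, Complex.norm_exp_ofReal_mul_I, mul_one, Complex.norm_real, Real.norm_eq_abs]
    have : (1 - (a (n + 1) : ℂ) ^ 2) = ((1 - a (n + 1) ^ 2 : ℝ) : ℂ) := by push_cast; ring
    rw [this, Complex.norm_real, Real.norm_eq_abs]
  have h2 : |1 - a (n + 1) ^ 2| ≤ |a (n + 1) - 1| * (1 + a (n + 1)) := by
    rw [show 1 - a (n + 1) ^ 2 = -((a (n + 1) - 1) * (1 + a (n + 1))) by ring, abs_neg, abs_mul,
      abs_of_pos (show 0 < 1 + a (n + 1) by linarith)]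
  have h3 : |r' - r| ≤ |r' - a (n + 1) * r| + |a (n + 1) - 1| * r := by
    have := abs_add_le (r' - a (n + 1) * r) ((a (n + 1) - 1) * r)
    rw [abs_mul, abs_of_pos hr] at this
    calc |r' - r| = |r' - a (n + 1) * r + (a (n + 1) - 1) * r| := by ring_nf
      _ ≤ _ := this
  rw [div_sub_one hr.ne', abs_div, abs_of_pos hr, div_le_iff₀ hr]
  set k := 2 / Real.sin θ / a (n + 1) with hk
  have hk0 : 0 < k := by positivity
  have e1 : 2 / Real.sin θ * r / a (n + 1) = k * r := by rw [hk]; ring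
  have e2 : (2 + a (n + 1)) * (2 / Real.sin θ) / a (n + 1) = (2 + a (n + 1)) * k := by
    rw [hk]; ring
  rw [e1] at h1
  rw [e2]
  have h5 : (|1 - a (n + 1) ^ 2| + |b (n + 2)|) ≤
      (2 + a (n + 1)) * (|a (n + 1) - 1| + |b (n + 2)|) := by
    nlinarith [abs_nonneg (a (n + 1) - 1), abs_nonneg (b (n + 2)),
      mul_nonneg ha.le (abs_nonneg (b (n + 2)))]
  have h6 := mul_le_mul_of_nonneg_right h5 (mul_pos hk0 hr).le
  have h7 := mul_nonneg (abs_nonneg (b (n + 2))) hr.le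
  nlinarith

/-- The size of the Jost-type functions converges on the interior of the spectrum. -/
lemma exists_tendsto_log_norm_jost (h : IsJacobiSystem a b p)
    (hsum : Summable fun n : ℕ => |a (n + 1) - 1| + |b (n + 1)|) {θ : ℝ} (hθ : 0 < Real.sin θ) :
    ∃ l, Tendsto (fun n => Real.log ‖jost a p θ n‖) atTop (nhds l) := by
  have hA : Summable fun n : ℕ => |a (n + 1) - 1| :=
    hsum.of_nonneg_of_le (fun _ => abs_nonneg _) fun n => by linarith [abs_nonneg (b (n + 1))]
  have hB : Summable fun n : ℕ => |b (n + 1)| :=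
    hsum.of_nonneg_of_le (fun _ => abs_nonneg _) fun n => by linarith [abs_nonneg (a (n + 1) - 1)]
  have hlim : Tendsto (fun n => a (n + 1)) atTop (nhds 1) := by
    have := (tendsto_zero_iff_abs_tendsto_zero _).2 hA.tendsto_atTop_zero
    simpa using this.add_const 1
  have hK : Tendsto (fun n => 1 + (2 + a (n + 1)) * (2 / Real.sin θ) / a (n + 1)) atTop
      (nhds (1 + (2 + 1) * (2 / Real.sin θ) / 1)) :=
    (((hlim.const_add 2).mul_const _).div hlim one_ne_zero).const_add 1
  obtain ⟨K, hK⟩ := hK.bddAbove_range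
  have hε : Summable fun n => ‖jost a p θ (n + 1)‖ / ‖jost a p θ n‖ - 1 := by
    refine Summable.of_norm_bounded
      ((hA.add ((summable_nat_add_iff 1).2 hB)).mul_left K) fun n => ?_
    rw [Real.norm_eq_abs]
    refine (h.abs_norm_jost_succ_sub_le hθ n).trans ?_
    exact mul_le_mul_of_nonneg_right (hK ⟨n, rfl⟩) (by positivity)
  have hs := Real.summable_log_one_add_of_summable hε
  have e : ∀ n, Real.log ‖jost a p θ n‖ = ∑ k ∈ Finset.range n,
      Real.log (1 + (‖jost a p θ (k + 1)‖ / ‖jost a p θ k‖ - 1)) + Real.log ‖jost a p θ 0‖ := by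
    intro n
    induction n with
    | zero => simp
    | succ n ih =>
      rw [Finset.sum_range_succ, add_right_comm, ← ih, add_sub_cancel,
        Real.log_div (h.norm_jost_pos hθ _).ne' (h.norm_jost_pos hθ _).ne']
      ring
  exact ⟨_, (hs.hasSum.tendsto_sum_nat.add_const _).congr fun n => (e n).symm⟩

lemma log_jacobiMax_le_majorant (n : ℕ) (θ : ℝ) :
    Real.log (jacobiMax a p n (2 * Real.cos θ)) ≤ logMaxMajorant a p n θ := by
  have h1 : Real.log |Real.sin θ| ≤ 0 :=
    Real.log_nonpos (abs_nonneg _) (Real.abs_sin_le_one θ)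
  have h2 : 0 ≤ |Real.sin θ| / jacobiMax a p n (2 * Real.cos θ) ^ 2 := by positivity
  unfold logMaxMajorant
  linarith

lemma logMaxMajorant_nonneg (h : IsJacobiSystem a b p) (n : ℕ) {θ : ℝ} (hθ : Real.sin θ ≠ 0) :
    0 ≤ logMaxMajorant a p n θ := by
  have hm := h.jacobiMax_pos n (2 * Real.cos θ)
  have hs := abs_pos.2 hθ
  have h1 := Real.log_le_sub_one_of_pos
    (show 0 < |Real.sin θ| / jacobiMax a p n (2 * Real.cos θ) ^ 2 by positivity)
  rw [Real.log_div hs.ne' (by positivity), Real.log_pow] at h1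
  unfold logMaxMajorant
  push_cast at h1
  linarith

/-- Pointwise bound for the logarithm of any density dominating the limit inferior of the Carmona
densities. -/
lemma ofReal_neg_log_le (h : IsJacobiSystem a b p)
    (hsum : Summable fun n : ℕ => |a (n + 1) - 1| + |b (n + 1)|) {θ : ℝ} (hθ : 0 < Real.sin θ)
    {D : ENNReal} (hD : liminf (fun n => carmonaDensity a p n (2 * Real.cos θ)) atTop ≤ D)
    (hDt : D ≠ ⊤) :
    ENNReal.ofReal (max (-Real.log D.toReal) 0) ≤
      ENNReal.ofReal (Real.log (8 * Real.pi) + 2 * Real.log 2) +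
        2 * ENNReal.ofReal (-Real.log (Real.sin θ)) +
        2 * liminf (fun n => ENNReal.ofReal (logMaxMajorant a p n θ)) atTop := by
  obtain ⟨l, hl⟩ := h.exists_tendsto_log_norm_jost hsum hθ
  set κ : ℝ := Real.sin θ ^ 2 / (8 * Real.pi) * Real.exp (-2 * l) with hκ
  have hκ0 : 0 < κ := by positivity
  have h1 : ENNReal.ofReal κ ≤ D := by
    refine le_trans ?_ hD
    have ht : Tendsto (fun n => ENNReal.ofReal (Real.sin θ ^ 2 / (8 * Real.pi) *
        Real.exp (-2 * Real.log ‖jost a p θ n‖))) atTop (nhds (ENNReal.ofReal κ)) :=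
      (ENNReal.continuous_ofReal.tendsto _).comp
        (((Real.continuous_exp.tendsto _).comp (hl.const_mul (-2))).const_mul _)
    rw [← ht.liminf_eq]
    refine liminf_le_liminf (Eventually.of_forall fun n => ENNReal.ofReal_le_ofReal ?_)
    have hr := h.norm_jost_pos hθ n
    have hm := jacobiMax_le_norm_jost (a := a) (p := p) hθ n
    have hmp := h.jacobiMax_pos n (2 * Real.cos θ)
    have hexp : Real.exp (-2 * Real.log ‖jost a p θ n‖) = (‖jost a p θ n‖ ^ 2)⁻¹ := by
      rw [neg_mul, Real.exp_neg, ← Real.log_rpow hr, Real.exp_log (by positivity)]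
      norm_num
    rw [hexp]
    have hc : carmona a p n (2 * Real.cos θ) ≤ 2 * (2 / Real.sin θ * ‖jost a p θ n‖) ^ 2 :=
      (carmona_le n _).trans (by gcongr)
    calc Real.sin θ ^ 2 / (8 * Real.pi) * (‖jost a p θ n‖ ^ 2)⁻¹
        = 1 / (Real.pi * (2 * (2 / Real.sin θ * ‖jost a p θ n‖) ^ 2)) := by
          field_simp; ring
      _ ≤ _ := by
          have := h.carmona_pos n (2 * Real.cos θ)
          gcongr
  have h2 : κ ≤ D.toReal := (ENNReal.ofReal_le_iff_le_toReal hDt).1 h1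
  have h3 : -Real.log D.toReal ≤ (Real.log (8 * Real.pi) + 2 * Real.log 2) +
      2 * (-Real.log (Real.sin θ)) + 2 * (l - Real.log 2) := by
    have := Real.log_le_log hκ0 h2
    rw [hκ, Real.log_mul (by positivity) (by positivity), Real.log_div (by positivity)
      (by positivity), Real.log_pow, Real.log_exp] at this
    push_cast at this
    linarith
  have h4 : ENNReal.ofReal (l - Real.log 2) ≤
      liminf (fun n => ENNReal.ofReal (logMaxMajorant a p n θ)) atTop := by
    have ht : Tendsto (fun n => ENNReal.ofReal (Real.log ‖jost a p θ n‖ - Real.log 2)) atTop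
        (nhds (ENNReal.ofReal (l - Real.log 2))) :=
      (ENNReal.continuous_ofReal.tendsto _).comp (hl.sub_const _)
    rw [← ht.liminf_eq]
    refine liminf_le_liminf (Eventually.of_forall fun n => ENNReal.ofReal_le_ofReal ?_)
    refine le_trans ?_ (log_jacobiMax_le_majorant n θ)
    have := Real.log_le_log (h.norm_jost_pos hθ n) (norm_jost_le (a := a) (p := p) θ n)
    rw [Real.log_mul two_ne_zero (h.jacobiMax_pos n _).ne'] at this
    linarith
  rw [ENNReal.ofReal_max, ENNReal.ofReal_zero, max_eq_left zero_le]
  have h5 : ∀ y : ℝ, ENNReal.ofReal (2 * y) = 2 * ENNReal.ofReal y := fun y => by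
    rw [ENNReal.ofReal_mul zero_le_two, ENNReal.ofReal_ofNat]
  refine (ENNReal.ofReal_le_ofReal h3).trans (ENNReal.ofReal_add_le.trans ?_)
  rw [h5]
  refine add_le_add (ENNReal.ofReal_add_le.trans ?_) (mul_le_mul_right h4 2)
  rw [h5]

end IsJacobiSystem

lemma lintegral_abs_two_sin_mul_comp_eq {s : Set ℝ} (hs : MeasurableSet s) (hi : InjOn Real.cos s)
    (g : ℝ → ENNReal) :
    ∫⁻ θ in s, ENNReal.ofReal |2 * Real.sin θ| * g (2 * Real.cos θ) =
      ∫⁻ x in (fun θ => 2 * Real.cos θ) '' s, g x := by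
  rw [lintegral_image_eq_lintegral_abs_deriv_mul hs (f := fun θ => 2 * Real.cos θ)
    (f' := fun θ => 2 * -Real.sin θ)
    (fun θ _ => ((Real.hasDerivAt_cos θ).const_mul 2).hasDerivWithinAt)
    (fun x hx y hy hxy => hi hx hy (mul_left_cancel₀ two_ne_zero hxy))]
  simp only [mul_neg, abs_neg]

lemma image_two_cos_Ioo : (fun θ => 2 * Real.cos θ) '' Ioo 0 Real.pi = Ioo (-2) 2 := by
  ext x
  constructor
  · rintro ⟨θ, hθ, rfl⟩
    have hs := Real.sin_pos_of_mem_Ioo hθ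
    have := Real.sin_sq_add_cos_sq θ
    constructor <;> dsimp only <;> nlinarith
  · rintro ⟨h1, h2⟩
    refine ⟨Real.arccos (x / 2), ⟨Real.arccos_pos.2 (by linarith), ?_⟩, ?_⟩
    · refine lt_of_le_of_ne (Real.arccos_le_pi _) fun h => ?_
      rw [Real.arccos_eq_pi] at h
      linarith
    · dsimp only
      rw [Real.cos_arccos (by linarith) (by linarith)]
      ring

lemma lintegral_two_sin_mul_comp (g : ℝ → ENNReal) :
    ∫⁻ θ in Ioo 0 Real.pi, ENNReal.ofReal |2 * Real.sin θ| * g (2 * Real.cos θ) =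
      ∫⁻ x in Ioo (-2) 2, g x := by
  rw [lintegral_abs_two_sin_mul_comp_eq measurableSet_Ioo
    (Real.injOn_cos.mono Ioo_subset_Icc_self), image_two_cos_Ioo]

lemma ae_two_cos_of_ae {P : ℝ → Prop} (hP : ∀ᵐ x ∂(volume.restrict (Ioo (-2) 2)), P x) :
    ∀ᵐ θ ∂(volume.restrict (Ioo 0 Real.pi)), P (2 * Real.cos θ) := by
  set N := toMeasurable (volume.restrict (Ioo (-2 : ℝ) 2)) {x | ¬ P x} with hN
  have hNm : MeasurableSet N := measurableSet_toMeasurable _ _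
  have h0 : ∫⁻ x in Ioo (-2) 2, N.indicator 1 x = 0 := by
    rw [lintegral_indicator_one hNm, measure_toMeasurable]
    exact hP
  rw [← lintegral_two_sin_mul_comp, lintegral_eq_zero_iff (by
    have : Measurable (N.indicator (1 : ℝ → ENNReal)) := measurable_one.indicator hNm
    fun_prop)] at h0
  filter_upwards [h0, ae_restrict_mem measurableSet_Ioo] with θ h1 hθ
  by_contra h2
  have h3 : (2 * Real.cos θ) ∈ N := subset_toMeasurable _ _ h2
  have hs := Real.sin_pos_of_mem_Ioo hθ
  simp [h3, hs.ne'] at h1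

lemma lintegral_rpow_mul_eq (m : ℝ → ℝ) :
    ∫⁻ x in Ioo (-2 : ℝ) 2, ENNReal.ofReal ((4 - x ^ 2) ^ (-(1 : ℝ) / 2) * m x) =
      ∫⁻ θ in Ioo 0 Real.pi, ENNReal.ofReal (m (2 * Real.cos θ)) := by
  rw [← lintegral_two_sin_mul_comp]
  refine setLIntegral_congr_fun measurableSet_Ioo fun θ hθ => ?_
  have hs := Real.sin_pos_of_mem_Ioo hθ
  have e : (4 - (2 * Real.cos θ) ^ 2) ^ (-(1 : ℝ) / 2) = (2 * Real.sin θ)⁻¹ := by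
    rw [show 4 - (2 * Real.cos θ) ^ 2 = (2 * Real.sin θ) ^ (2 : ℝ) by
        rw [Real.rpow_two]; linear_combination -4 * Real.sin_sq_add_cos_sq θ,
      ← Real.rpow_mul (by positivity)]
    norm_num [Real.rpow_neg_one]
  rw [← ENNReal.ofReal_mul (abs_nonneg _), e, abs_of_pos (by positivity),
    mul_inv_cancel_left₀ (by positivity)]

lemma integrableOn_log_abs_sin :
    IntegrableOn (fun θ => Real.log |Real.sin θ|) (Ioc 0 (2 * Real.pi)) := by
  simp only [Real.log_abs]
  exact (intervalIntegrable_iff_integrableOn_Ioc_of_le (by positivity)).1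
    intervalIntegrable_log_sin

lemma ae_sin_ne_zero : ∀ᵐ θ : ℝ, Real.sin θ ≠ 0 := by
  filter_upwards [ae_two_cos_ne 2, ae_two_cos_ne (-2)] with θ h1 h2 h3
  have h4 := Real.sin_sq_add_cos_sq θ
  rw [h3] at h4
  have h5 : (2 * Real.cos θ - 2) * (2 * Real.cos θ - -2) = 0 := by linear_combination 4 * h4
  exact (mul_ne_zero (sub_ne_zero.2 h1) (sub_ne_zero.2 h2)) h5

namespace IsJacobiSystem

variable {a b : ℕ → ℝ} {p : ℕ → Polynomial ℝ} {μ : Measure ℝ} {M : ℝ}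

lemma continuous_jacobiMax (n : ℕ) : Continuous (jacobiMax a p n) := by
  unfold jacobiMax
  fun_prop

lemma measurable_logMaxMajorant (n : ℕ) : Measurable (logMaxMajorant a p n) := by
  have := (continuous_jacobiMax (a := a) (p := p) n).measurable
  unfold logMaxMajorant
  fun_prop

lemma lintegral_abs_sin_div_le [IsProbabilityMeasure μ] (h : IsJacobiSystem a b p)
    (hM : ∀ᵐ x ∂μ, x ∈ Icc (-M) M)
    (horth : ∀ m n, ∫ x, (p m).eval x * (p n).eval x ∂μ = if m = n then 1 else 0) (n : ℕ) :
    ∫⁻ θ in Ioc 0 (2 * Real.pi),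
      ENNReal.ofReal (|Real.sin θ| / jacobiMax a p n (2 * Real.cos θ) ^ 2) ≤
        ENNReal.ofReal (2 * Real.pi) := by
  have hpi := Real.pi_pos
  have hpt : ∀ θ, ENNReal.ofReal (|Real.sin θ| / jacobiMax a p n (2 * Real.cos θ) ^ 2) ≤
      ENNReal.ofReal Real.pi *
        (ENNReal.ofReal |2 * Real.sin θ| * carmonaDensity a p n (2 * Real.cos θ)) := by
    intro θ
    have hm := h.jacobiMax_pos n (2 * Real.cos θ)
    have hc := h.carmona_pos n (2 * Real.cos θ)
    rw [carmonaDensity, ← ENNReal.ofReal_mul (abs_nonneg _), ← ENNReal.ofReal_mul hpi.le]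
    refine ENNReal.ofReal_le_ofReal ?_
    rw [show Real.pi * (|2 * Real.sin θ| * (1 / (Real.pi * carmona a p n (2 * Real.cos θ)))) =
        |2 * Real.sin θ| / carmona a p n (2 * Real.cos θ) by field_simp,
      div_le_div_iff₀ (by positivity) hc, abs_mul, abs_two]
    nlinarith [carmona_le (a := a) (p := p) n (2 * Real.cos θ), abs_nonneg (Real.sin θ)]
  have key : ∀ s : Set ℝ, MeasurableSet s → InjOn Real.cos s →
      ∫⁻ θ in s, ENNReal.ofReal (|Real.sin θ| / jacobiMax a p n (2 * Real.cos θ) ^ 2) ≤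
        ENNReal.ofReal Real.pi := by
    intro s hs hi
    refine (lintegral_mono hpt).trans ?_
    rw [lintegral_const_mul' _ _ ENNReal.ofReal_ne_top,
      lintegral_abs_two_sin_mul_comp_eq hs hi]
    calc _ ≤ ENNReal.ofReal Real.pi * ∫⁻ x, carmonaDensity a p n x := by
          exact mul_le_mul_right (setLIntegral_le_lintegral _ _) _
      _ = _ := by rw [h.lintegral_carmonaDensity hM horth, mul_one]
  rw [← Ioc_union_Ioc_eq_Ioc hpi.le (by linarith : Real.pi ≤ 2 * Real.pi), two_mul,
    ENNReal.ofReal_add hpi.le hpi.le]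
  refine (lintegral_union_le _ _ _).trans (add_le_add (key _ measurableSet_Ioc
    (Real.injOn_cos.mono Ioc_subset_Icc_self)) (key _ measurableSet_Ioc ?_))
  intro x hx y hy hxy
  have := Real.injOn_cos (x₁ := 2 * Real.pi - x) (x₂ := 2 * Real.pi - y)
    ⟨by linarith [hx.2], by linarith [hx.1]⟩ ⟨by linarith [hy.2], by linarith [hy.1]⟩
    (by rwa [Real.cos_two_pi_sub, Real.cos_two_pi_sub])
  linarith

lemma lintegral_liminf_logMaxMajorant_lt_top [IsProbabilityMeasure μ] (h : IsJacobiSystem a b p)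
    (hsum : Summable fun n : ℕ => |a (n + 1) - 1| + |b (n + 1)|)
    (hM : ∀ᵐ x ∂μ, x ∈ Icc (-M) M)
    (horth : ∀ m n, ∫ x, (p m).eval x * (p n).eval x ∂μ = if m = n then 1 else 0) :
    ∫⁻ θ in Ioo 0 Real.pi,
      liminf (fun n => ENNReal.ofReal (logMaxMajorant a p n θ)) atTop < ⊤ := by
  obtain ⟨C, hC⟩ := h.exists_integral_log_max_le hsum
  set K := ∫ θ in Ioc 0 (2 * Real.pi), Real.log |Real.sin θ|
  have hpi := Real.pi_pos
  have hle : ∀ n, ∫⁻ θ in Ioc 0 (2 * Real.pi), ENNReal.ofReal (logMaxMajorant a p n θ) ≤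
      ENNReal.ofReal (C + (2 * Real.pi - K) / 2) := by
    intro n
    obtain ⟨hi, hCn⟩ := hC n
    have hE := h.lintegral_abs_sin_div_le hM horth n
    set E : ℝ → ℝ := fun θ => |Real.sin θ| / jacobiMax a p n (2 * Real.cos θ) ^ 2
    have hE0 : ∀ θ, 0 ≤ E θ := fun θ => by positivity
    have hEm : Measurable E := by
      have := (continuous_jacobiMax (a := a) (p := p) n).measurable
      fun_prop
    have hEi : IntegrableOn E (Ioc 0 (2 * Real.pi)) :=
      ⟨hEm.aestronglyMeasurable, (hasFiniteIntegral_iff_ofReal (ae_of_all _ hE0)).2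
        (hE.trans_lt ENNReal.ofReal_lt_top)⟩
    have hEle : ∫ θ in Ioc 0 (2 * Real.pi), E θ ≤ 2 * Real.pi := by
      rw [← ofReal_integral_eq_lintegral_ofReal hEi (ae_of_all _ hE0)] at hE
      exact (ENNReal.ofReal_le_ofReal_iff (by positivity)).1 hE
    have hd : IntegrableOn (fun θ => (E θ - Real.log |Real.sin θ|) / 2) (Ioc 0 (2 * Real.pi)) :=
      (hEi.sub integrableOn_log_abs_sin).div_const 2
    have hFi : IntegrableOn (logMaxMajorant a p n) (Ioc 0 (2 * Real.pi)) := hi.add hd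
    rw [← ofReal_integral_eq_lintegral_ofReal hFi (ae_restrict_of_ae
      (ae_sin_ne_zero.mono fun θ hθ => h.logMaxMajorant_nonneg n hθ))]
    refine ENNReal.ofReal_le_ofReal ?_
    calc ∫ θ in Ioc 0 (2 * Real.pi), logMaxMajorant a p n θ
        = _ + ∫ θ in Ioc 0 (2 * Real.pi), (E θ - Real.log |Real.sin θ|) / 2 := integral_add hi hd
      _ ≤ _ := by
        rw [integral_div, integral_sub hEi integrableOn_log_abs_sin]
        exact add_le_add hCn (by gcongr)
  calc _ ≤ ∫⁻ θ in Ioc 0 (2 * Real.pi),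
        liminf (fun n => ENNReal.ofReal (logMaxMajorant a p n θ)) atTop :=
        lintegral_mono_set fun θ hθ => ⟨hθ.1, by linarith [hθ.2]⟩
    _ ≤ liminf (fun n => ∫⁻ θ in Ioc 0 (2 * Real.pi),
        ENNReal.ofReal (logMaxMajorant a p n θ)) atTop :=
        lintegral_liminf_le fun n => (measurable_logMaxMajorant n).ennreal_ofReal
    _ ≤ ENNReal.ofReal (C + (2 * Real.pi - K) / 2) :=
        liminf_le_of_frequently_le' (Frequently.of_forall hle)
    _ < ⊤ := ENNReal.ofReal_lt_top

/-- The Szegő condition for the orthogonality measure of an `ℓ¹` perturbation of the free Jacobi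
system. -/
lemma lintegral_log_rnDeriv_lt_top [IsProbabilityMeasure μ] (h : IsJacobiSystem a b p)
    (hsum : Summable fun n : ℕ => |a (n + 1) - 1| + |b (n + 1)|)
    (hM : ∀ᵐ x ∂μ, x ∈ Icc (-M) M)
    (horth : ∀ m n, ∫ x, (p m).eval x * (p n).eval x ∂μ = if m = n then 1 else 0) :
    ∫⁻ x in Ioo (-2 : ℝ) 2, ENNReal.ofReal ((4 - x ^ 2) ^ (-(1 : ℝ) / 2) *
      max (-Real.log (μ.rnDeriv volume x).toReal) 0) < ⊤ := by
  rw [lintegral_rpow_mul_eq (fun x => max (-Real.log (μ.rnDeriv volume x).toReal) 0)]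
  have hsin : ∫⁻ θ in Ioo 0 Real.pi, ENNReal.ofReal (-Real.log (Real.sin θ)) < ⊤ := by
    have hi : IntegrableOn (fun θ => -Real.log (Real.sin θ)) (Ioo 0 Real.pi) := by
      refine Integrable.neg (IntegrableOn.mono_set (t := Ioc 0 (2 * Real.pi)) ?_
        fun θ hθ => ⟨hθ.1, by linarith [hθ.2, Real.pi_pos]⟩)
      simpa only [Real.log_abs] using integrableOn_log_abs_sin
    exact (lintegral_mono fun θ => Real.ofReal_le_enorm _).trans_lt hi.2
  have hbound : ∀ᵐ θ ∂(volume.restrict (Ioo 0 Real.pi)),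
      ENNReal.ofReal (max (-Real.log (μ.rnDeriv volume (2 * Real.cos θ)).toReal) 0) ≤
      ENNReal.ofReal (Real.log (8 * Real.pi) + 2 * Real.log 2) +
        2 * ENNReal.ofReal (-Real.log (Real.sin θ)) +
        2 * liminf (fun n => ENNReal.ofReal (logMaxMajorant a p n θ)) atTop := by
    filter_upwards [ae_two_cos_of_ae (h.ae_liminf_carmonaDensity_le_rnDeriv hM horth),
      ae_two_cos_of_ae (ae_restrict_of_ae (Measure.rnDeriv_lt_top μ volume)),
      ae_restrict_mem measurableSet_Ioo] with θ h1 h2 hθ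
    exact h.ofReal_neg_log_le hsum (Real.sin_pos_of_mem_Ioo hθ) h1 h2.ne
  refine (lintegral_mono_ae hbound).trans_lt ?_
  have hmeas : Measurable fun θ =>
      liminf (fun n => ENNReal.ofReal (logMaxMajorant a p n θ)) atTop :=
    .liminf fun n => (measurable_logMaxMajorant n).ennreal_ofReal
  rw [lintegral_add_right _ (hmeas.const_mul 2), lintegral_add_left measurable_const,
    lintegral_const_mul' _ _ ENNReal.ofNat_ne_top, lintegral_const_mul' _ _ ENNReal.ofNat_ne_top,
    setLIntegral_const]
  refine ENNReal.add_lt_top.2 ⟨ENNReal.add_lt_top.2 ⟨?_, ?_⟩, ?_⟩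
  · exact ENNReal.mul_lt_top ENNReal.ofReal_lt_top (by simp)
  · exact ENNReal.mul_lt_top (by simp) hsin
  · exact ENNReal.mul_lt_top (by simp)
      (h.lintegral_liminf_logMaxMajorant_lt_top hsum hM horth)

end IsJacobiSystem

lemma exists_ae_mem_Icc_of_isCompact_msupport {μ : Measure ℝ} (hcpt : IsCompact (msupport μ)) :
    ∃ M : ℝ, ∀ᵐ x ∂μ, x ∈ Icc (-M) M := by
  have hs : msupport μ = μ.support := by
    ext x
    exact (μ.mem_support_iff_forall x).symm
  obtain ⟨M, hM⟩ := hcpt.isBounded.exists_norm_le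
  refine ⟨M, ?_⟩
  filter_upwards [Measure.support_mem_ae (μ := μ)] with x hx
  exact abs_le.1 (hM x (hs ▸ hx))

lemma IsJacobiParams.exists_isJacobiSystem {μ : Measure ℝ} [IsProbabilityMeasure μ] {a b : ℕ → ℝ}
    (hpos : ∀ n, 1 ≤ n → 0 < a n) (hJ : IsJacobiParams μ a b) :
    ∃ p, IsJacobiSystem a b p ∧
      ∀ m n, ∫ x, (p m).eval x * (p n).eval x ∂μ = if m = n then 1 else 0 := by
  obtain ⟨p, hdeg, hlc, horth, hrec⟩ := hJ
  refine ⟨p, ⟨fun n => hpos _ (Nat.le_add_left 1 n), ?_, hdeg, ?_, fun n => ?_⟩, horth⟩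
  · obtain ⟨c, hc⟩ := Polynomial.natDegree_eq_zero.1 (hdeg 0)
    have h1 := horth 0 0
    have h2 := hlc 0
    simp only [← hc, Polynomial.eval_C, integral_const, probReal_univ, one_smul, if_true] at h1
    rw [← hc, Polynomial.leadingCoeff_C] at h2
    rw [← hc, show c = 1 by nlinarith, Polynomial.C_1]
  · exact Polynomial.funext fun x => by simpa using hrec 0 x
  · exact Polynomial.funext fun x => by simpa using hrec (n + 1) x

/-- Nevai's conjecture: an ℓ¹ perturbation of the free Jacobi matrix satisfies
the Szegő condition on `[-2,2]`. -/
theorem nevai_conjecture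
    (a b : ℕ → ℝ) (hpos : ∀ n, 1 ≤ n → 0 < a n)
    (hsum : Summable fun n : ℕ => |a (n + 1) - 1| + |b (n + 1)|)
    (μ : Measure ℝ) (hprob : IsProbabilityMeasure μ)
    (hcpt : IsCompact (msupport μ)) (hinf : (msupport μ).Infinite)
    (hJ : IsJacobiParams μ a b) :
    ∫⁻ x in Set.Ioo (-2 : ℝ) 2,
        ENNReal.ofReal ((4 - x ^ 2) ^ (-(1 : ℝ) / 2) *
          max (-Real.log (densityOf μ x)) 0) < ⊤ := by
  obtain ⟨M, hM⟩ := exists_ae_mem_Icc_of_isCompact_msupport hcpt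
  obtain ⟨p, h, horth⟩ := hJ.exists_isJacobiSystem hpos
  exact h.lintegral_log_rnDeriv_lt_top hsum hM horth
end
end

section
/- Let {a_n, b_n}_{n=1}^∞ be Jacobi parameters with ∑_{n=1}^∞ (|a_n − 1| + |b_n|) < ∞, and let μ be the associated measure. Then σ_ess(μ) = [−2,2] and the eigenvalues {E_j} = supp(μ)∖[−2,2] satisfy ∑_j (|E_j| − 2)^{1/2} < ∞. -/
open MeasureTheory Filter Set Metric

noncomputable section

lemma exists_next_block (V : ℕ → ℝ) (hV : ∀ n, 0 < V n) (s : ℕ) :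
    ∃ t, s < t ∧ 2 * ((t : ℝ) - s - 1) * ∑ n ∈ Finset.Ico s t, V n ≤ 1 ∧
      1 < 2 * ((t : ℝ) - s) * ∑ n ∈ Finset.Ico s (t + 1), V n := by
  classical
  have hex : ∃ t, s < t ∧ 1 < 2 * ((t : ℝ) - s) * ∑ n ∈ Finset.Ico s (t + 1), V n := by
    obtain ⟨m, hm⟩ := exists_nat_gt (1 / V s)
    refine ⟨s + m + 1, by omega, ?_⟩
    have h1 : V s ≤ ∑ n ∈ Finset.Ico s (s + m + 1 + 1), V n :=
      Finset.single_le_sum (fun n _ => (hV n).le) (by simp; omega)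
    have h2 : 1 < m * V s := by rwa [div_lt_iff₀ (hV s)] at hm
    have h3 : (0 : ℝ) ≤ m := by positivity
    have h4 := hV s
    push_cast
    nlinarith
  refine ⟨Nat.find hex, (Nat.find_spec hex).1, ?_, (Nat.find_spec hex).2⟩
  have hlt := (Nat.find_spec hex).1
  by_contra! hcon
  obtain ⟨r, hr⟩ : ∃ r, Nat.find hex = r + 1 := ⟨Nat.find hex - 1, by omega⟩
  rw [hr] at hlt hcon
  rcases Nat.lt_succ_iff_lt_or_eq.1 hlt with h | h
  · refine Nat.find_min hex (m := r) (by omega) ⟨h, ?_⟩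
    push_cast at hcon
    rwa [show (r : ℝ) + 1 - s - 1 = r - s by ring] at hcon
  · subst h
    push_cast at hcon
    norm_num at hcon

lemma exists_blocks (V : ℕ → ℝ) (hV : ∀ n, 0 < V n) :
    ∃ s : ℕ → ℕ, s 0 = 0 ∧ ∀ k, s k < s (k + 1) ∧
      2 * ((s (k + 1) : ℝ) - s k - 1) * ∑ n ∈ Finset.Ico (s k) (s (k + 1)), V n ≤ 1 ∧
      1 < 2 * ((s (k + 1) : ℝ) - s k) * ∑ n ∈ Finset.Ico (s k) (s (k + 1) + 1), V n := by
  choose t ht using exists_next_block V hV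
  exact ⟨fun k => Nat.rec 0 (fun _ r => t r) k, rfl, fun k => ht _⟩

/-- Cauchy–Schwarz for increments of a sequence on a block. -/
lemma sq_sub_le_block (u : ℕ → ℝ) {s t m n : ℕ} (hsm : s ≤ m) (hmn : m ≤ n) (hnt : n < t) :
    (u n - u m) ^ 2 ≤ ((t : ℝ) - s - 1) * ∑ j ∈ Finset.Ico s (t - 1), (u (j + 1) - u j) ^ 2 := by
  have h1 : u n - u m = ∑ j ∈ Finset.Ico m n, (u (j + 1) - u j) :=
    (Finset.sum_Ico_sub u hmn).symm
  rw [h1]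
  refine (sq_sum_le_card_mul_sum_sq).trans ?_
  have hc : (((Finset.Ico m n).card : ℕ) : ℝ) ≤ (t : ℝ) - s - 1 := by
    have : (Finset.Ico m n).card + s + 1 ≤ t := by simp; omega
    have : (((Finset.Ico m n).card : ℕ) : ℝ) + s + 1 ≤ t := by exact_mod_cast this
    linarith
  have hs : ∑ j ∈ Finset.Ico m n, (u (j + 1) - u j) ^ 2 ≤
      ∑ j ∈ Finset.Ico s (t - 1), (u (j + 1) - u j) ^ 2 :=
    Finset.sum_le_sum_of_subset_of_nonneg (Finset.Ico_subset_Ico hsm (by omega))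
      fun _ _ _ => sq_nonneg _
  exact mul_le_mul hc hs (Finset.sum_nonneg fun _ _ => sq_nonneg _)
    (le_trans (by positivity) hc)

lemma sq_sub_le_block' (u : ℕ → ℝ) {s t m n : ℕ} (hm : m ∈ Finset.Ico s t)
    (hn : n ∈ Finset.Ico s t) :
    (u n - u m) ^ 2 ≤ ((t : ℝ) - s - 1) * ∑ j ∈ Finset.Ico s (t - 1), (u (j + 1) - u j) ^ 2 := by
  rw [Finset.mem_Ico] at hm hn
  rcases le_total m n with h | h
  · exact sq_sub_le_block u hm.1 h hn.2
  · rw [← neg_sub, neg_sq]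
    exact sq_sub_le_block u hn.1 h hm.2

lemma sum_Ico_sub_one_le (u : ℕ → ℝ) (s t : ℕ) :
    ∑ j ∈ Finset.Ico s (t - 1), (u (j + 1) - u j) ^ 2 ≤
      ∑ j ∈ Finset.Ico s t, (u (j + 1) - u j) ^ 2 :=
  Finset.sum_le_sum_of_subset_of_nonneg (Finset.Ico_subset_Ico le_rfl (by omega))
    fun _ _ _ => sq_nonneg _

/-- On a short block the potential is dominated by the kinetic energy, up to the mean. -/
lemma block_form_le (V : ℕ → ℝ) (hV : ∀ n, 0 < V n) (u : ℕ → ℝ) {s t : ℕ} (hst : s < t)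
    (h : 2 * ((t : ℝ) - s - 1) * ∑ n ∈ Finset.Ico s t, V n ≤ 1) :
    ∑ n ∈ Finset.Ico s t, (V n * u n ^ 2 - (u (n + 1) - u n) ^ 2) ≤
      (2 * (∑ n ∈ Finset.Ico s t, V n) / ((t : ℝ) - s)) * ∑ n ∈ Finset.Ico s t, u n ^ 2 := by
  set D := ∑ j ∈ Finset.Ico s (t - 1), (u (j + 1) - u j) ^ 2 with hD
  have hD0 : 0 ≤ D := Finset.sum_nonneg fun _ _ => sq_nonneg _
  have hl : (0 : ℝ) < (t : ℝ) - s := by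
    have : (s : ℝ) < t := by exact_mod_cast hst
    linarith
  have key : ∀ n ∈ Finset.Ico s t, u n ^ 2 ≤
      2 / ((t : ℝ) - s) * ∑ m ∈ Finset.Ico s t, u m ^ 2 + 2 * ((t : ℝ) - s - 1) * D := by
    intro n hn
    have h1 : ∑ _m ∈ Finset.Ico s t, u n ^ 2 ≤
        ∑ m ∈ Finset.Ico s t, (2 * u m ^ 2 + 2 * (((t : ℝ) - s - 1) * D)) := by
      refine Finset.sum_le_sum fun m hm => ?_
      have := sq_sub_le_block' u hm hn
      nlinarith [sq_nonneg (u n - 2 * u m)]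
    rw [Finset.sum_add_distrib, ← Finset.mul_sum, Finset.sum_const, Finset.sum_const,
      Nat.card_Ico, nsmul_eq_mul, nsmul_eq_mul, Nat.cast_sub hst.le] at h1
    have h2 : u n ^ 2 = (((t : ℝ) - s) * u n ^ 2) / ((t : ℝ) - s) := by field_simp
    rw [h2, div_le_iff₀ hl]
    refine h1.trans (le_of_eq ?_)
    field_simp
  have h3 : ∑ n ∈ Finset.Ico s t, V n * u n ^ 2 ≤ (∑ n ∈ Finset.Ico s t, V n) *
      (2 / ((t : ℝ) - s) * ∑ m ∈ Finset.Ico s t, u m ^ 2 + 2 * ((t : ℝ) - s - 1) * D) := by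
    rw [Finset.sum_mul]
    exact Finset.sum_le_sum fun n hn => mul_le_mul_of_nonneg_left (key n hn) (hV n).le
  have h4 := sum_Ico_sub_one_le u s t
  rw [Finset.sum_sub_distrib]
  have h5 := mul_le_mul_of_nonneg_right h hD0
  have h6 : (2 * (∑ n ∈ Finset.Ico s t, V n) / ((t : ℝ) - s)) * ∑ n ∈ Finset.Ico s t, u n ^ 2 =
    (∑ n ∈ Finset.Ico s t, V n) * (2 / ((t : ℝ) - s) * ∑ m ∈ Finset.Ico s t, u m ^ 2) := by
    ring
  rw [h6]
  linarith

lemma block_form_nonpos (V : ℕ → ℝ) (hV : ∀ n, 0 < V n) (u : ℕ → ℝ) {s t : ℕ} (hst : s < t)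
    (h : 2 * ((t : ℝ) - s - 1) * ∑ n ∈ Finset.Ico s t, V n ≤ 1) (hu : u s = 0) :
    ∑ n ∈ Finset.Ico s t, (V n * u n ^ 2 - (u (n + 1) - u n) ^ 2) ≤ 0 := by
  set D := ∑ j ∈ Finset.Ico s (t - 1), (u (j + 1) - u j) ^ 2 with hD
  have hD0 : 0 ≤ D := Finset.sum_nonneg fun _ _ => sq_nonneg _
  have h3 : ∑ n ∈ Finset.Ico s t, V n * u n ^ 2 ≤ (∑ n ∈ Finset.Ico s t, V n) *
      (((t : ℝ) - s - 1) * D) := by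
    rw [Finset.sum_mul]
    refine Finset.sum_le_sum fun n hn => mul_le_mul_of_nonneg_left ?_ (hV n).le
    have := sq_sub_le_block' u (Finset.left_mem_Ico.2 hst) hn
    rwa [hu, sub_zero] at this
  have h4 := sum_Ico_sub_one_le u s t
  rw [Finset.sum_sub_distrib]
  have h5 := mul_le_mul_of_nonneg_right h hD0
  linarith

/-- Discrete Neumann bracketing: a positive summable potential decouples into blocks, each of
which carries at most one bound state, with square-root summable bounds on their energies. -/
lemma exists_bracketing (V : ℕ → ℝ) (hV : ∀ n, 0 < V n) (hs : Summable V) :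
    ∃ (s : ℕ → ℕ) (w : ℕ → ℝ), (∀ k, k ≤ s k) ∧ (∀ k, 0 ≤ w k) ∧
      Summable (fun k => Real.sqrt (w k)) ∧
      ∀ (r : ℝ) (u : ℕ → ℝ), 0 ≤ r → (∀ k, r < w k → u (s k) = 0) → ∀ K,
        ∑ n ∈ Finset.range (s K), (V n * u n ^ 2 - (u (n + 1) - u n) ^ 2) ≤
          r * ∑ n ∈ Finset.range (s K), u n ^ 2 := by
  obtain ⟨s, hs0, hsk⟩ := exists_blocks V hV
  have hmono : StrictMono s := strictMono_nat_of_lt_succ fun k => (hsk k).1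
  set v : ℕ → ℝ := fun k => ∑ n ∈ Finset.Ico (s k) (s (k + 1)), V n with hv
  have hv0 : ∀ k, 0 ≤ v k := fun k => Finset.sum_nonneg fun n _ => (hV n).le
  have hl : ∀ k, (0 : ℝ) < (s (k + 1) : ℝ) - s k := fun k => by
    have : (s k : ℝ) < s (k + 1) := by exact_mod_cast (hsk k).1
    linarith
  have hsplit : ∀ (f : ℕ → ℝ) (K : ℕ), ∑ n ∈ Finset.range (s K), f n =
      ∑ k ∈ Finset.range K, ∑ n ∈ Finset.Ico (s k) (s (k + 1)), f n := by
    intro f K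
    induction K with
    | zero => simp [hs0]
    | succ K ih =>
      rw [Finset.sum_range_succ, ← ih, Finset.range_eq_Ico, Finset.range_eq_Ico,
        Finset.sum_Ico_consecutive f (Nat.zero_le _) (hsk K).1.le]
  have hvs : Summable v := by
    refine summable_of_sum_range_le (c := ∑' n, V n) hv0 fun K => ?_
    rw [← hsplit V K]
    exact hs.sum_le_tsum _ fun n _ => (hV n).le
  refine ⟨s, fun k => 2 * v k / ((s (k + 1) : ℝ) - s k), fun k => hmono.id_le k,
    fun k => div_nonneg (by linarith [hv0 k]) (hl k).le, ?_, ?_⟩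
  · have hb : Summable fun k => 2 * (v k + v (k + 1)) :=
      (hvs.add ((summable_nat_add_iff 1).2 hvs)).mul_left 2
    refine Summable.of_nonneg_of_le (fun k => Real.sqrt_nonneg _) (fun k => ?_) hb
    have h1 := (hsk k).2.2
    rw [Finset.sum_Ico_succ_top (hsk k).1.le] at h1
    have h2 : V (s (k + 1)) ≤ v (k + 1) :=
      Finset.single_le_sum (f := V) (fun n _ => (hV n).le)
        (Finset.left_mem_Ico.2 (hsk (k + 1)).1)
    have h3 : 1 < 2 * ((s (k + 1) : ℝ) - s k) * (v k + v (k + 1)) := by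
      refine h1.trans_le (mul_le_mul_of_nonneg_left ?_ (by linarith [hl k]))
      exact add_le_add le_rfl h2
    have h0 := hv0 k
    have h0' := hv0 (k + 1)
    refine Real.sqrt_le_iff.2 ⟨by positivity, ?_⟩
    rw [div_le_iff₀ (hl k)]
    nlinarith
  · intro r u hr hu K
    rw [hsplit, hsplit, Finset.mul_sum]
    refine Finset.sum_le_sum fun k _ => ?_
    rcases lt_or_ge r (2 * v k / ((s (k + 1) : ℝ) - s k)) with h | h
    · exact (block_form_nonpos V hV u (hsk k).1 (hsk k).2.1 (hu k h)).trans
        (mul_nonneg hr (Finset.sum_nonneg fun _ _ => sq_nonneg _))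
    · exact (block_form_le V hV u (hsk k).1 (hsk k).2.1).trans
        (mul_le_mul_of_nonneg_right h (Finset.sum_nonneg fun _ _ => sq_nonneg _))

/-- The Jacobi form minus the edge `2` of the free spectrum is at most a Schrödinger form. -/
lemma jacobi_form_le (a b u : ℕ → ℝ) (M : ℕ) :
    ∑ n ∈ Finset.range M, ((b (n + 1) - 2) * u n ^ 2 + 2 * a (n + 1) * u n * u (n + 1)) ≤
      ∑ n ∈ Finset.range M,
        ((|b (n + 1)| + |a (n + 1) - 1| + |a n - 1|) * u n ^ 2 - (u (n + 1) - u n) ^ 2) +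
      (|a M - 1| + 1) * u M ^ 2 := by
  induction M with
  | zero => simp; positivity
  | succ M ih =>
    rw [Finset.sum_range_succ, Finset.sum_range_succ]
    have h1 : b (M + 1) * u M ^ 2 ≤ |b (M + 1)| * u M ^ 2 :=
      mul_le_mul_of_nonneg_right (le_abs_self _) (sq_nonneg _)
    have h2 : 2 * (a (M + 1) - 1) * u M * u (M + 1) ≤
        |a (M + 1) - 1| * (u M ^ 2 + u (M + 1) ^ 2) := by
      rcases abs_cases (a (M + 1) - 1) with ⟨h, h'⟩ | ⟨h, h'⟩ <;> rw [h]
      · nlinarith [mul_nonneg h' (sq_nonneg (u M - u (M + 1)))]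
      · nlinarith [mul_nonneg (neg_nonneg.2 h'.le) (sq_nonneg (u M + u (M + 1)))]
    nlinarith

/-- Comparison of sums by comparison of the counting functions. -/
lemma tsum_le_tsum_of_encard_le {ι κ : Type*} (x : ι → ℝ) (y : κ → ℝ) (hx : ∀ i, 0 ≤ x i)
    (hy : ∀ k, 0 ≤ y k) (h : ∀ t, 0 < t → {i | t < x i}.encard ≤ {k | t < y k}.encard) :
    ∑' i, ENNReal.ofReal (x i) ≤ ∑' k, ENNReal.ofReal (y k) := by
  let _ : MeasurableSpace ι := ⊤
  let _ : MeasurableSpace κ := ⊤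
  rw [← lintegral_count, ← lintegral_count,
    lintegral_eq_lintegral_meas_lt _ (ae_of_all _ hx) (Measurable.of_discrete (f := x)).aemeasurable,
    lintegral_eq_lintegral_meas_lt _ (ae_of_all _ hy) (Measurable.of_discrete (f := y)).aemeasurable]
  refine setLIntegral_mono' measurableSet_Ioi fun t ht => ?_
  rw [Measure.count_apply .of_discrete, Measure.count_apply .of_discrete]
  exact_mod_cast h t ht

lemma msupport_eq_support {X : Type*} [TopologicalSpace X] [MeasurableSpace X] (μ : Measure X) :
    msupport μ = μ.support := by
  ext x
  rw [Measure.mem_support_iff_forall]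
  rfl

lemma ae_mem_msupport (μ : Measure ℝ) : ∀ᵐ x ∂μ, x ∈ msupport μ := by
  rw [msupport_eq_support]
  exact Measure.support_mem_ae

lemma integrable_of_isCompact_msupport {μ : Measure ℝ} [IsFiniteMeasure μ]
    (hcpt : IsCompact (msupport μ)) {f : ℝ → ℝ} (hf : Continuous f) : Integrable f μ := by
  have h := hf.continuousOn.integrableOn_compact (μ := μ) hcpt
  rwa [IntegrableOn, Measure.restrict_eq_self_of_ae_mem (ae_mem_msupport μ)] at h

/-- The orthonormality and recursion data of a compactly supported measure, unbundled from
the existential in `IsJacobiParams`. -/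
structure JacobiSystem (μ : Measure ℝ) (a b : ℕ → ℝ) (p : ℕ → Polynomial ℝ) : Prop where
  natDegree : ∀ n, (p n).natDegree = n
  leadingCoeff_pos : ∀ n, 0 < (p n).leadingCoeff
  orthonormal : ∀ m n, ∫ x, (p m).eval x * (p n).eval x ∂μ = if m = n then 1 else 0
  recursion : ∀ n : ℕ, ∀ x : ℝ, x * (p n).eval x =
    a (n + 1) * (p (n + 1)).eval x + b (n + 1) * (p n).eval x +
      (if n = 0 then 0 else a n * (p (n - 1)).eval x)
  integrable : ∀ f : ℝ → ℝ, Continuous f → Integrable f μ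

namespace JacobiSystem

variable {μ : Measure ℝ} {a b : ℕ → ℝ} {p : ℕ → Polynomial ℝ}

lemma exists_coeff (h : JacobiSystem μ a b p) (M : ℕ) (g : Polynomial ℝ) (hg : g.degree < M) :
    ∃ u : ℕ → ℝ, ∀ x, g.eval x = ∑ n ∈ Finset.range M, u n * (p n).eval x := by
  induction M generalizing g with
  | zero =>
    have : g = 0 := by simpa [Polynomial.degree_eq_bot] using hg
    exact ⟨0, by simp [this]⟩
  | succ M ih =>
    set c := g.coeff M / (p M).leadingCoeff with hc
    have hl := (h.leadingCoeff_pos M).ne'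
    have hdeg : (p M).degree ≤ M := by
      simpa [h.natDegree M] using (p M).degree_le_natDegree
    have hd : (g - Polynomial.C c * p M).degree < M := by
      rw [Polynomial.degree_lt_iff_coeff_zero]
      intro m hm
      rw [Polynomial.coeff_sub, Polynomial.coeff_C_mul]
      rcases Nat.lt_or_eq_of_le hm with hm | rfl
      · rw [Polynomial.coeff_eq_zero_of_degree_lt (lt_of_lt_of_le hg (by exact_mod_cast hm)),
          Polynomial.coeff_eq_zero_of_degree_lt (lt_of_le_of_lt hdeg (by exact_mod_cast hm))]
        simp
      · have : (p M).coeff M = (p M).leadingCoeff := by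
          rw [Polynomial.leadingCoeff, h.natDegree]
        rw [this, hc, div_mul_cancel₀ _ hl, sub_self]
    obtain ⟨u, hu⟩ := ih _ hd
    refine ⟨Function.update u M c, fun x => ?_⟩
    have hx := hu x
    rw [Polynomial.eval_sub, Polynomial.eval_mul, Polynomial.eval_C] at hx
    rw [Finset.sum_range_succ, Function.update_self,
      Finset.sum_congr rfl (g := fun n => u n * (p n).eval x), ← hx]
    · ring
    · intro n hn
      rw [Function.update_of_ne (Finset.mem_range.1 hn).ne]

lemma integral_sum_mul (h : JacobiSystem μ a b p) (S : Finset ℕ) (u : ℕ → ℝ) (f : ℝ → ℝ)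
    (hf : Continuous f) :
    ∫ x, (∑ n ∈ S, u n * (p n).eval x) * f x ∂μ =
      ∑ n ∈ S, u n * ∫ x, (p n).eval x * f x ∂μ := by
  simp_rw [Finset.sum_mul, mul_assoc]
  rw [integral_finsetSum]
  · simp_rw [integral_const_mul]
  · exact fun n _ => h.integrable _ (by fun_prop)

lemma integral_sum_mul_eval (h : JacobiSystem μ a b p) (S : Finset ℕ) (u : ℕ → ℝ) (m : ℕ) :
    ∫ x, (∑ n ∈ S, u n * (p n).eval x) * (p m).eval x ∂μ = if m ∈ S then u m else 0 := by
  rw [h.integral_sum_mul S u _ (by fun_prop)]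
  simp [h.orthonormal]

lemma integral_sum_sq (h : JacobiSystem μ a b p) (S : Finset ℕ) (u : ℕ → ℝ) :
    ∫ x, (∑ n ∈ S, u n * (p n).eval x) ^ 2 ∂μ = ∑ n ∈ S, u n ^ 2 := by
  simp_rw [sq]
  rw [h.integral_sum_mul S u _ (by fun_prop)]
  refine Finset.sum_congr rfl fun n hn => ?_
  simp_rw [mul_comm (Polynomial.eval _ (p n))]
  rw [h.integral_sum_mul_eval, if_pos hn]

lemma integral_mul_sum_sq (h : JacobiSystem μ a b p) (M : ℕ) (u : ℕ → ℝ)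
    (hu : ∀ n, M ≤ n → u n = 0) :
    ∫ x, x * (∑ n ∈ Finset.range M, u n * (p n).eval x) ^ 2 ∂μ =
      ∑ n ∈ Finset.range M, (b (n + 1) * u n ^ 2 + 2 * a (n + 1) * u n * u (n + 1)) := by
  set F : ℝ → ℝ := fun x => ∑ n ∈ Finset.range M, u n * (p n).eval x with hF
  have hFc : Continuous F := by fun_prop
  have hm : ∀ m, ∫ x, (p m).eval x * F x ∂μ = u m := fun m => by
    simp_rw [mul_comm (Polynomial.eval _ (p m)), hF]
    rw [h.integral_sum_mul_eval]
    split_ifs with hmM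
    · rfl
    · exact (hu m (by simpa using hmM)).symm
  have h1 : ∫ x, x * F x ^ 2 ∂μ = ∫ x, F x * (x * F x) ∂μ :=
    integral_congr_ae (ae_of_all _ fun x => by ring)
  have h2 : ∀ n, ∫ x, (p n).eval x * (x * F x) ∂μ =
      a (n + 1) * u (n + 1) + b (n + 1) * u n + (if n = 0 then 0 else a n * u (n - 1)) := by
    intro n
    have : ∀ x, (p n).eval x * (x * F x) = a (n + 1) * ((p (n + 1)).eval x * F x) +
        b (n + 1) * ((p n).eval x * F x) +
        (if n = 0 then 0 else a n) * ((p (n - 1)).eval x * F x) := by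
      intro x
      rw [← mul_assoc, mul_comm _ x, h.recursion]
      split_ifs <;> ring
    simp_rw [this]
    rw [integral_add (h.integrable _ (by fun_prop)) (h.integrable _ (by fun_prop)),
      integral_add (h.integrable _ (by fun_prop)) (h.integrable _ (by fun_prop)),
      integral_const_mul, integral_const_mul, integral_const_mul, hm, hm, hm]
    split_ifs <;> ring
  have h3 : ∑ n ∈ Finset.range M, u n * (if n = 0 then 0 else a n * u (n - 1)) =
      ∑ n ∈ Finset.range M, u n * (a (n + 1) * u (n + 1)) := by
    have e1 := Finset.sum_range_succ (fun n => u n * (if n = 0 then 0 else a n * u (n - 1))) M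
    rw [Finset.sum_range_succ', hu M le_rfl] at e1
    simp only [zero_mul, if_true, mul_zero, add_zero] at e1
    rw [← e1]
    refine Finset.sum_congr rfl fun n _ => ?_
    simp only [Nat.add_eq_zero_iff, one_ne_zero, and_false, if_false, Nat.add_sub_cancel]
    ring
  calc ∫ x, x * F x ^ 2 ∂μ = ∑ n ∈ Finset.range M, u n * ∫ x, (p n).eval x * (x * F x) ∂μ := by
        rw [h1]
        exact h.integral_sum_mul _ u _ (by fun_prop)
    _ = _ := by
        simp_rw [h2, mul_add, Finset.sum_add_distrib]
        rw [h3, ← Finset.sum_add_distrib, ← Finset.sum_add_distrib, ← Finset.sum_add_distrib]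
        exact Finset.sum_congr rfl fun n _ => by ring

/-- A quadratic-form bound on polynomials with finitely many vanishing coefficients extends to
continuous functions. -/
lemma integral_mul_sq_nonpos (h : JacobiSystem μ a b p) (hcpt : IsCompact (msupport μ))
    (S : Finset ℕ) (W : ℝ → ℝ) (hW : Continuous W)
    (hS : ∀ g : Polynomial ℝ, (∀ n ∈ S, ∫ x, g.eval x * (p n).eval x ∂μ = 0) →
      ∫ x, W x * g.eval x ^ 2 ∂μ ≤ 0)
    (f : ℝ → ℝ) (hf : Continuous f) (hfS : ∀ n ∈ S, ∫ x, f x * (p n).eval x ∂μ = 0) :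
    ∫ x, W x * f x ^ 2 ∂μ ≤ 0 := by
  obtain ⟨R, hR⟩ := hcpt.isBounded.subset_closedBall 0
  rw [Real.closedBall_eq_Icc, zero_sub, zero_add] at hR
  have hae : ∀ᵐ x ∂μ, x ∈ Icc (-R) R := (ae_mem_msupport μ).mono fun x hx => hR hx
  set ε : ℕ → ℝ := fun k => 1 / ((k : ℝ) + 1) with hε
  have hε0 : ∀ k, 0 < ε k := fun k => Nat.one_div_pos_of_nat
  have hε1 : ∀ k, ε k ≤ 1 := fun k => by
    rw [hε]
    exact div_le_one_of_le₀ (by simp) (by positivity)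
  choose g hg using fun k => exists_polynomial_near_of_continuousOn (-R) R f hf.continuousOn
    (ε k) (hε0 k)
  set c : ℕ → ℕ → ℝ := fun k n => ∫ x, (g k).eval x * (p n).eval x ∂μ with hc
  set P : ℕ → ℝ := fun n => ∫ x, |(p n).eval x| ∂μ with hP
  have hcP : ∀ k, ∀ n ∈ S, |c k n| ≤ ε k * P n := by
    intro k n hn
    have e : c k n = ∫ x, ((g k).eval x - f x) * (p n).eval x ∂μ := by
      simp_rw [sub_mul]
      rw [integral_sub (h.integrable _ (by fun_prop)) (h.integrable _ (by fun_prop)), hfS n hn,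
        sub_zero]
    rw [e, hP, ← integral_const_mul]
    refine (abs_integral_le_integral_abs).trans
      (integral_mono_ae (h.integrable _ (by fun_prop)) (h.integrable _ (by fun_prop)) ?_)
    filter_upwards [hae] with x hx
    rw [abs_mul]
    exact mul_le_mul_of_nonneg_right (hg k x hx).le (abs_nonneg _)
  set q : ℕ → Polynomial ℝ := fun k => g k - ∑ n ∈ S, Polynomial.C (c k n) * p n with hq
  have hqe : ∀ k x, (q k).eval x = (g k).eval x - ∑ n ∈ S, c k n * (p n).eval x := by
    intro k x
    simp [hq, Polynomial.eval_finsetSum]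
  have hqS : ∀ k, ∀ n ∈ S, ∫ x, (q k).eval x * (p n).eval x ∂μ = 0 := by
    intro k n hn
    simp_rw [hqe, sub_mul]
    rw [integral_sub (h.integrable _ (by fun_prop)) (h.integrable _ (by fun_prop)),
      h.integral_sum_mul_eval, if_pos hn, sub_self]
  set Q : ℝ → ℝ := fun x => 1 + ∑ n ∈ S, P n * |(p n).eval x| with hQ
  have hQc : Continuous Q := by fun_prop
  have hP0 : ∀ n, 0 ≤ P n := fun n => integral_nonneg fun x => abs_nonneg _
  have hQ0 : ∀ x, 0 ≤ Q x := fun x =>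
    add_nonneg zero_le_one (Finset.sum_nonneg fun n _ => mul_nonneg (hP0 n) (abs_nonneg _))
  have hqf : ∀ k, ∀ x ∈ Icc (-R) R, |(q k).eval x - f x| ≤ ε k * Q x := by
    intro k x hx
    have e1 : |∑ n ∈ S, c k n * (p n).eval x| ≤ ε k * ∑ n ∈ S, P n * |(p n).eval x| := by
      rw [Finset.mul_sum]
      refine (Finset.abs_sum_le_sum_abs _ _).trans (Finset.sum_le_sum fun n hn => ?_)
      rw [abs_mul, ← mul_assoc]
      exact mul_le_mul_of_nonneg_right (hcP k n hn) (abs_nonneg _)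
    have e2 := (hg k x hx).le
    rw [hqe, hQ]
    rw [abs_le] at e1 e2 ⊢
    constructor <;> linarith [e1.1, e1.2, e2.1, e2.2]
  have hlim : Tendsto (fun k => ∫ x, W x * (q k).eval x ^ 2 ∂μ) atTop
      (nhds (∫ x, W x * f x ^ 2 ∂μ)) := by
    refine tendsto_integral_of_dominated_convergence (fun x => |W x| * (|f x| + Q x) ^ 2)
      (fun k => (h.integrable _ (by fun_prop)).aestronglyMeasurable)
      (h.integrable _ (by fun_prop)) (fun k => ?_) ?_
    · filter_upwards [hae] with x hx
      rw [norm_mul, norm_pow, Real.norm_eq_abs, Real.norm_eq_abs]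
      refine mul_le_mul_of_nonneg_left (pow_le_pow_left₀ (abs_nonneg _) ?_ 2) (abs_nonneg _)
      have e1 := hqf k x hx
      have e2 : ε k * Q x ≤ 1 * Q x := mul_le_mul_of_nonneg_right (hε1 k) (hQ0 x)
      have e3 := abs_sub_abs_le_abs_sub ((q k).eval x) (f x)
      linarith
    · filter_upwards [hae] with x hx
      have e1 : Tendsto (fun k => (q k).eval x - f x) atTop (nhds 0) := by
        refine squeeze_zero_norm (fun k => hqf k x hx) ?_
        simpa [hε] using (tendsto_one_div_add_atTop_nhds_zero_nat (𝕜 := ℝ)).mul_const (Q x)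
      have e2 : Tendsto (fun k => (q k).eval x) atTop (nhds (f x)) := by
        simpa using e1.add_const (f x)
      exact (e2.pow 2).const_mul _
  exact le_of_tendsto' hlim fun k => hS (q k) (hqS k)

lemma integral_form_nonpos (h : JacobiSystem μ a b p) {σ : ℝ} (hσ : σ ^ 2 = 1) (V : ℕ → ℝ)
    (hV : ∀ n, |b (n + 1)| + |a (n + 1) - 1| + |a n - 1| ≤ V n) {s : ℕ → ℕ} {w : ℕ → ℝ}
    (hs : ∀ k, k ≤ s k) {r : ℝ}
    (hb : ∀ u : ℕ → ℝ, (∀ k, r < w k → u (s k) = 0) → ∀ K,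
      ∑ n ∈ Finset.range (s K), (V n * u n ^ 2 - (u (n + 1) - u n) ^ 2) ≤
        r * ∑ n ∈ Finset.range (s K), u n ^ 2)
    (g : Polynomial ℝ) (hg : ∀ k, r < w k → ∫ x, g.eval x * (p (s k)).eval x ∂μ = 0) :
    ∫ x, (σ * x - 2 - r) * g.eval x ^ 2 ∂μ ≤ 0 := by
  set K := g.natDegree + 1 with hK
  set N := s K with hN
  obtain ⟨v, hv⟩ := h.exists_coeff N g (lt_of_le_of_lt Polynomial.degree_le_natDegree (by
    have := hs K
    exact_mod_cast (by omega : g.natDegree < N)))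
  set u : ℕ → ℝ := fun n => if n < N then v n else 0 with hu
  have hu0 : ∀ n, N ≤ n → u n = 0 := fun n hn => if_neg (not_lt.2 hn)
  have hgu : ∀ x, g.eval x = ∑ n ∈ Finset.range N, u n * (p n).eval x := by
    intro x
    rw [hv]
    exact Finset.sum_congr rfl fun n hn => by simp [hu, Finset.mem_range.1 hn]
  have hcoef : ∀ k, r < w k → u (s k) = 0 := by
    intro k hk
    have := hg k hk
    simp_rw [hgu] at this
    rw [h.integral_sum_mul_eval] at this
    by_cases hkN : s k < N
    · simpa [hkN] using this
    · exact hu0 _ (not_lt.1 hkN)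
  have hσabs : |σ| = 1 := by
    rw [← Real.sqrt_sq_eq_abs, hσ, Real.sqrt_one]
  have hz2 : ∀ n, (σ ^ n * u n) ^ 2 = u n ^ 2 := fun n => by
    rw [mul_pow, ← pow_mul, mul_comm n, pow_mul, hσ, one_pow, one_mul]
  have hz1 : ∀ n, (σ ^ n * u n) * (σ ^ (n + 1) * u (n + 1)) = σ * (u n * u (n + 1)) := fun n => by
    calc _ = (σ ^ 2) ^ n * (σ * (u n * u (n + 1))) := by ring
      _ = _ := by rw [hσ, one_pow, one_mul]
  have e1 := jacobi_form_le a (fun n => σ * b n) (fun n => σ ^ n * u n) N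
  have e2 := hb (fun n => σ ^ n * u n) (fun k hk => by simp [hcoef k hk]) K
  simp only [hu0 N le_rfl, hz2, abs_mul, hσabs, one_mul] at e1 e2
  have e3 : ∑ n ∈ Finset.range N, ((|b (n + 1)| + |a (n + 1) - 1| + |a n - 1|) * u n ^ 2 -
      (σ ^ (n + 1) * u (n + 1) - σ ^ n * u n) ^ 2) ≤
      ∑ n ∈ Finset.range N, (V n * u n ^ 2 - (σ ^ (n + 1) * u (n + 1) - σ ^ n * u n) ^ 2) :=
    Finset.sum_le_sum fun n _ =>
      sub_le_sub_right (mul_le_mul_of_nonneg_right (hV n) (sq_nonneg _)) _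
  have e4 : ∑ n ∈ Finset.range N, ((σ * b (n + 1) - 2) * u n ^ 2 +
      2 * a (n + 1) * (σ ^ n * u n) * (σ ^ (n + 1) * u (n + 1))) =
      σ * ∑ n ∈ Finset.range N, (b (n + 1) * u n ^ 2 + 2 * a (n + 1) * u n * u (n + 1)) -
        2 * ∑ n ∈ Finset.range N, u n ^ 2 := by
    rw [Finset.mul_sum, Finset.mul_sum, ← Finset.sum_sub_distrib]
    exact Finset.sum_congr rfl fun n _ => by linear_combination 2 * a (n + 1) * hz1 n
  have e5 : ∫ x, (σ * x - 2 - r) * g.eval x ^ 2 ∂μ =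
      σ * ∫ x, x * g.eval x ^ 2 ∂μ - (2 + r) * ∫ x, g.eval x ^ 2 ∂μ := by
    rw [← integral_const_mul, ← integral_const_mul,
      ← integral_sub (h.integrable _ (by fun_prop)) (h.integrable _ (by fun_prop))]
    exact integral_congr_ae (ae_of_all _ fun x => by ring)
  rw [e5]
  simp_rw [hgu]
  rw [h.integral_mul_sum_sq N u hu0, h.integral_sum_sq]
  rw [e4] at e1
  simp only [mul_zero, ne_eq, OfNat.ofNat_ne_zero, not_false_eq_true, zero_pow] at e1
  linarith

/-- The number of support points beyond an energy is at most the number of blocks whose energy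
bound exceeds it. -/
lemma encard_le (h : JacobiSystem μ a b p) (hcpt : IsCompact (msupport μ)) {σ : ℝ} {s : ℕ → ℕ}
    {w : ℕ → ℝ} {r : ℝ}
    (hform : ∀ g : Polynomial ℝ, (∀ k, r < w k → ∫ x, g.eval x * (p (s k)).eval x ∂μ = 0) →
      ∫ x, (σ * x - 2 - r) * g.eval x ^ 2 ∂μ ≤ 0) :
    {x | x ∈ msupport μ ∧ 2 + r < σ * x}.encard ≤ {k | r < w k}.encard := by
  by_contra! hlt
  have hfin : {k | r < w k}.Finite := Set.encard_lt_top_iff.1 (hlt.trans_le le_top)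
  set T := hfin.toFinset with hT
  have hTm : ∀ k, k ∈ T ↔ r < w k := fun k => by simp [hT]
  rw [hfin.encard_eq_coe_toFinset_card] at hlt
  obtain ⟨A, hAs, hAc⟩ := Set.exists_subset_encard_eq (Order.add_one_le_of_lt hlt)
  have hAfin : A.Finite := Set.finite_of_encard_eq_coe (k := T.card + 1) (by exact_mod_cast hAc)
  have hAcard : hAfin.toFinset.card = T.card + 1 := by
    rw [hAfin.encard_eq_coe_toFinset_card] at hAc
    exact_mod_cast hAc
  set ψ : ℝ → ℝ := fun x => max 0 (σ * x - 2 - r) with hψ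
  have hψc : Continuous ψ := by fun_prop
  let L : Polynomial.degreeLT ℝ (T.card + 1) →ₗ[ℝ] (T → ℝ) :=
    { toFun := fun q k => ∫ x, ψ x * (q : Polynomial ℝ).eval x * (p (s k)).eval x ∂μ
      map_add' := fun q q' => by
        funext k
        simp only [Submodule.coe_add, Polynomial.eval_add, Pi.add_apply, mul_add, add_mul]
        exact integral_add (h.integrable _ (by fun_prop)) (h.integrable _ (by fun_prop))
      map_smul' := fun c q => by
        funext k
        simp only [Submodule.coe_smul, Polynomial.eval_smul, Pi.smul_apply, smul_eq_mul,
          RingHom.id_apply]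
        rw [← integral_const_mul]
        exact integral_congr_ae (ae_of_all _ fun x => by ring) }
  have hker : LinearMap.ker (L.comp (Polynomial.degreeLTEquiv ℝ (T.card + 1)).symm.toLinearMap)
      ≠ ⊥ := LinearMap.ker_ne_bot_of_finrank_lt (by simp)
  obtain ⟨c, hc, hc0⟩ := Submodule.exists_mem_ne_zero_of_ne_bot hker
  set q := (Polynomial.degreeLTEquiv ℝ (T.card + 1)).symm c with hq
  have hq0 : (q : Polynomial ℝ) ≠ 0 := by
    simpa [hq] using hc0
  have hLq : L q = 0 := hc
  obtain ⟨E, hEA, hE⟩ : ∃ E ∈ hAfin.toFinset, (q : Polynomial ℝ).eval E ≠ 0 := by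
    by_contra! hcon
    refine hq0 (Polynomial.eq_zero_of_degree_lt_of_eval_finset_eq_zero hAfin.toFinset ?_ hcon)
    rw [hAcard]
    exact Polynomial.mem_degreeLT.1 q.2
  obtain ⟨hEs, hE2⟩ := hAs (hAfin.mem_toFinset.1 hEA)
  have hle := h.integral_mul_sq_nonpos hcpt (T.image s) (fun x => σ * x - 2 - r) (by fun_prop)
    (fun g hg => hform g fun k hk => hg _ (Finset.mem_image_of_mem _ ((hTm k).2 hk)))
    (fun x => ψ x * (q : Polynomial ℝ).eval x) (by fun_prop) (by
      intro n hn
      obtain ⟨k, hk, rfl⟩ := Finset.mem_image.1 hn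
      exact congrFun hLq ⟨k, hk⟩)
  have hnn : ∀ x, 0 ≤ (σ * x - 2 - r) * (ψ x * (q : Polynomial ℝ).eval x) ^ 2 := by
    intro x
    rcases le_total 0 (σ * x - 2 - r) with hx | hx
    · exact mul_nonneg hx (sq_nonneg _)
    · simp [hψ, max_eq_left hx]
  refine absurd hle (not_le.2 ?_)
  have hcont : Continuous fun x => (σ * x - 2 - r) * (ψ x * (q : Polynomial ℝ).eval x) ^ 2 := by
    fun_prop
  rw [integral_pos_iff_support_of_nonneg hnn (h.integrable _ hcont)]
  refine hEs _ (hcont.isOpen_support.mem_nhds ?_)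
  have hW : 0 < σ * E - 2 - r := by linarith
  have : ψ E = σ * E - 2 - r := max_eq_right hW.le
  rw [Function.mem_support, this]
  exact mul_ne_zero hW.ne' (pow_ne_zero _ (mul_ne_zero hW.ne' hE))

/-- Truncated generalized eigenfunctions: the free part of the recursion leaves only a boundary
term. -/
lemma sub_mul_sum_eq (h : JacobiSystem μ a b p) (E : ℝ) (u : ℕ → ℝ) (L : ℕ) (x : ℝ) :
    (x - E) * ∑ n ∈ Finset.range (L + 1), u n * (p n).eval x =
      ∑ n ∈ Finset.range (L + 1), (a (n + 1) * u (n + 1) + (b (n + 1) - E) * u n +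
        (if n = 0 then 0 else a n * u (n - 1))) * (p n).eval x +
      (-(a (L + 1) * u (L + 1)) * (p L).eval x + a (L + 1) * u L * (p (L + 1)).eval x) := by
  induction L with
  | zero =>
    have := h.recursion 0 x
    simp only [if_true, add_zero, zero_add] at this
    simp only [zero_add, Finset.sum_range_one, if_true, add_zero]
    linear_combination u 0 * this
  | succ L ih =>
    rw [Finset.sum_range_succ, mul_add, ih, Finset.sum_range_succ _ (L + 1)]
    have := h.recursion (L + 1) x
    simp only [Nat.add_eq_zero_iff, one_ne_zero, and_false, if_false, Nat.add_sub_cancel] at this ⊢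
    linear_combination u (L + 1) * this

lemma integral_sub_sq_mul_le (h : JacobiSystem μ a b p) {V : ℕ → ℝ} (hVs : Summable V)
    (hV0 : ∀ n, 0 ≤ V n) (hV : ∀ n, |b (n + 1)| + |a (n + 1) - 1| + |a n - 1| ≤ V n)
    (θ φ : ℝ) (L : ℕ) :
    ∫ x, (x - 2 * Real.cos θ) ^ 2 *
        (∑ n ∈ Finset.range (L + 1), Real.cos (n * θ + φ) * (p n).eval x) ^ 2 ∂μ ≤
      9 * (3 + |a 0| + ∑' n, V n) ^ 2 := by
  set B := ∑' n, V n with hB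
  have hVB : ∀ n, V n ≤ B := fun n => hVs.le_tsum n fun m _ => hV0 m
  have hB0 : 0 ≤ B := (hV0 0).trans (hVB 0)
  set u : ℕ → ℝ := fun n => Real.cos (n * θ + φ) with hu
  have hu1 : ∀ n, |u n| ≤ 1 := fun n => Real.abs_cos_le_one _
  set ρ : ℕ → ℝ := fun n => a (n + 1) * u (n + 1) + (b (n + 1) - 2 * Real.cos θ) * u n +
        (if n = 0 then 0 else a n * u (n - 1)) with hρ
  set V' : ℕ → ℝ := fun n => V n + (if n = 0 then 1 + |a 0| else 0) with hV'
  have hmul : ∀ (y : ℝ) (n : ℕ), |y * u n| ≤ |y| := fun y n => by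
    rw [abs_mul]
    exact mul_le_of_le_one_right (abs_nonneg _) (hu1 n)
  have hV'0 : ∀ n, 0 ≤ V' n := fun n => by
    refine add_nonneg (hV0 n) ?_
    split_ifs <;> positivity
  have hρV : ∀ n, |ρ n| ≤ V' n := by
    intro n
    have h1 := hV n
    have h2 := hmul (a (n + 1) - 1) (n + 1)
    have h3 := hmul (b (n + 1)) n
    rcases n with _ | n
    · have h4 : u 1 - 2 * Real.cos θ * u 0 = -Real.cos (φ - θ) := by
        simp only [hu]
        rw [Nat.cast_one, Nat.cast_zero, one_mul, zero_mul, zero_add, Real.cos_add, Real.cos_sub]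
        ring
      have h5 : ρ 0 = (a 1 - 1) * u 1 + b 1 * u 0 - Real.cos (φ - θ) := by
        simp only [hρ, if_true, zero_add]
        linear_combination h4
      have h6 := Real.abs_cos_le_one (φ - θ)
      have h7 : V' 0 = V 0 + (1 + |a 0|) := by simp [hV']
      rw [h5, h7]
      rw [zero_add] at h2 h3 h1
      have := abs_nonneg (a 0)
      have := abs_nonneg (a 0 - 1)
      rw [abs_le] at h2 h3 h6 ⊢
      constructor <;> linarith [h2.1, h2.2, h3.1, h3.2, h6.1, h6.2]
    · have h4 : u (n + 1 + 1) + u n = 2 * Real.cos θ * u (n + 1) := by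
        simp only [hu]
        have e1 : ((n + 1 + 1 : ℕ) : ℝ) * θ + φ = (((n + 1 : ℕ) : ℝ) * θ + φ) + θ := by
          push_cast; ring
        have e2 : (n : ℝ) * θ + φ = (((n + 1 : ℕ) : ℝ) * θ + φ) - θ := by
          push_cast; ring
        rw [e1, e2, Real.cos_add _ θ, Real.cos_sub _ θ]
        ring
      have h5 : ρ (n + 1) = (a (n + 1 + 1) - 1) * u (n + 1 + 1) + b (n + 1 + 1) * u (n + 1) +
          (a (n + 1) - 1) * u n := by
        simp only [hρ, Nat.add_eq_zero_iff, one_ne_zero, and_false, if_false, Nat.add_sub_cancel]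
        linear_combination h4
      have h6 := hmul (a (n + 1) - 1) n
      have h7 : V' (n + 1) = V (n + 1) := by simp [hV']
      rw [h5, h7]
      rw [abs_le] at h2 h3 h6 ⊢
      constructor <;> linarith [h2.1, h2.2, h3.1, h3.2, h6.1, h6.2]
  have hρsum : ∑ n ∈ Finset.range (L + 1), ρ n ^ 2 ≤ (3 + |a 0| + B) ^ 2 := by
    calc ∑ n ∈ Finset.range (L + 1), ρ n ^ 2 ≤ ∑ n ∈ Finset.range (L + 1), V' n ^ 2 :=
          Finset.sum_le_sum fun n _ => by
            rw [← sq_abs]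
            exact pow_le_pow_left₀ (abs_nonneg _) (hρV n) 2
      _ ≤ (∑ n ∈ Finset.range (L + 1), V' n) ^ 2 :=
          Finset.sum_sq_le_sq_sum_of_nonneg fun n _ => hV'0 n
      _ ≤ _ := by
          refine pow_le_pow_left₀ (Finset.sum_nonneg fun n _ => hV'0 n) ?_ 2
          have h1 : ∑ n ∈ Finset.range (L + 1), V n ≤ B := hVs.sum_le_tsum _ fun n _ => hV0 n
          have h2 : ∑ n ∈ Finset.range (L + 1), (if n = 0 then 1 + |a 0| else 0) = 1 + |a 0| := by
            rw [Finset.sum_ite_eq' (Finset.range (L + 1)) 0 fun _ => 1 + |a 0|]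
            simp
          rw [hV', Finset.sum_add_distrib, h2]
          linarith
  have haB : |a (L + 1)| ≤ 3 + |a 0| + B := by
    have h1 := hV L
    have h2 := hVB L
    have h3 := abs_sub_abs_le_abs_sub (a (L + 1)) 1
    rw [abs_one] at h3
    linarith [abs_nonneg (b (L + 1)), abs_nonneg (a L - 1), abs_nonneg (a 0)]
  have hau : ∀ n, (a (L + 1) * u n) ^ 2 ≤ (3 + |a 0| + B) ^ 2 := fun n => by
    rw [← sq_abs]
    exact pow_le_pow_left₀ (abs_nonneg _) ((hmul _ n).trans haB) 2
  have hpp : ∀ m, ∫ x, (p m).eval x ^ 2 ∂μ = 1 := fun m => by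
    simp_rw [sq]
    simpa using h.orthonormal m m
  calc _ = ∫ x, (∑ n ∈ Finset.range (L + 1), ρ n * (p n).eval x +
        (-(a (L + 1) * u (L + 1)) * (p L).eval x +
          a (L + 1) * u L * (p (L + 1)).eval x)) ^ 2 ∂μ := by
        refine integral_congr_ae (ae_of_all _ fun x => ?_)
        simp only
        rw [← mul_pow, h.sub_mul_sum_eq]
    _ ≤ ∫ x, (3 * (∑ n ∈ Finset.range (L + 1), ρ n * (p n).eval x) ^ 2 +
        3 * (a (L + 1) * u (L + 1)) ^ 2 * (p L).eval x ^ 2 +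
        3 * (a (L + 1) * u L) ^ 2 * (p (L + 1)).eval x ^ 2) ∂μ := by
        refine integral_mono (h.integrable _ (by fun_prop)) (h.integrable _ (by fun_prop))
          fun x => ?_
        have : ∀ X Y Z y z : ℝ, (X + (-Y * y + Z * z)) ^ 2 ≤
            3 * X ^ 2 + 3 * Y ^ 2 * y ^ 2 + 3 * Z ^ 2 * z ^ 2 := fun X Y Z y z => by
          nlinarith [sq_nonneg (X + Y * y), sq_nonneg (X - Z * z), sq_nonneg (Y * y + Z * z)]
        exact this _ _ _ _ _
    _ = 3 * ∑ n ∈ Finset.range (L + 1), ρ n ^ 2 + 3 * (a (L + 1) * u (L + 1)) ^ 2 +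
        3 * (a (L + 1) * u L) ^ 2 := by
        rw [integral_add (h.integrable _ (by fun_prop)) (h.integrable _ (by fun_prop)),
          integral_add (h.integrable _ (by fun_prop)) (h.integrable _ (by fun_prop)),
          integral_const_mul, integral_const_mul, integral_const_mul, h.integral_sum_sq,
          hpp, hpp, mul_one, mul_one]
    _ ≤ _ := by linarith [hau L, hau (L + 1)]

lemma Icc_subset_msupport (h : JacobiSystem μ a b p) {V : ℕ → ℝ} (hVs : Summable V)
    (hV0 : ∀ n, 0 ≤ V n) (hV : ∀ n, |b (n + 1)| + |a (n + 1) - 1| + |a n - 1| ≤ V n) :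
    Icc (-2 : ℝ) 2 ⊆ msupport μ := by
  intro E hE
  by_contra hnot
  obtain ⟨U, hU, hμU⟩ : ∃ U ∈ nhds E, μ U = 0 := by
    simpa [msupport] using hnot
  obtain ⟨ε, hε, hεU⟩ := Metric.mem_nhds_iff.1 hU
  have hae : ∀ᵐ x ∂μ, ε ^ 2 ≤ (x - E) ^ 2 := by
    have : ∀ᵐ x ∂μ, x ∉ ball E ε := measure_eq_zero_iff_ae_notMem.1 (measure_mono_null hεU hμU)
    filter_upwards [this] with x hx
    rw [mem_ball, not_lt, Real.dist_eq] at hx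
    rw [← sq_abs (x - E)]
    exact pow_le_pow_left₀ hε.le hx 2
  set θ := Real.arccos (E / 2) with hθ
  have hEθ : 2 * Real.cos θ = E := by
    rw [hθ, Real.cos_arccos (by linarith [hE.1]) (by linarith [hE.2])]
    ring
  set C := 9 * (3 + |a 0| + ∑' n, V n) ^ 2 with hC
  have key : ∀ φ L, ε ^ 2 * ∑ n ∈ Finset.range (L + 1), Real.cos ((n : ℕ) * θ + φ) ^ 2 ≤ C := by
    intro φ L
    have h1 := h.integral_sub_sq_mul_le hVs hV0 hV θ φ L
    rw [hEθ] at h1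
    refine le_trans ?_ h1
    rw [← h.integral_sum_sq _ fun n : ℕ => Real.cos (n * θ + φ), ← integral_const_mul]
    refine integral_mono_ae (h.integrable _ (by fun_prop)) (h.integrable _ (by fun_prop)) ?_
    filter_upwards [hae] with x hx
    exact mul_le_mul_of_nonneg_right hx (sq_nonneg _)
  have hL : ∀ L : ℕ, ε ^ 2 * ((L : ℝ) + 1) ≤ 2 * C := by
    intro L
    have h1 := key 0 L
    have h2 := key (-(Real.pi / 2)) L
    have h3 : ∑ n ∈ Finset.range (L + 1), Real.cos ((n : ℕ) * θ + 0) ^ 2 +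
        ∑ n ∈ Finset.range (L + 1), Real.cos ((n : ℕ) * θ + -(Real.pi / 2)) ^ 2 = L + 1 := by
      rw [← Finset.sum_add_distrib]
      simp_rw [← sub_eq_add_neg, Real.cos_sub_pi_div_two, add_zero, Real.cos_sq_add_sin_sq]
      simp
    rw [← h3, mul_add]
    linarith
  obtain ⟨L, hLgt⟩ := exists_nat_gt (2 * C / ε ^ 2)
  rw [div_lt_iff₀ (by positivity)] at hLgt
  nlinarith [hL L, sq_pos_of_pos hε]

end JacobiSystem

lemma IsJacobiParams.exists_system {μ : Measure ℝ} [IsFiniteMeasure μ] {a b : ℕ → ℝ}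
    (hJ : IsJacobiParams μ a b) (hcpt : IsCompact (msupport μ)) :
    ∃ p, JacobiSystem μ a b p := by
  obtain ⟨p, h1, h2, h3, h4⟩ := hJ
  exact ⟨p, h1, h2, h3, h4, fun f hf => integrable_of_isCompact_msupport hcpt hf⟩

/-- For an ℓ¹ perturbation of the free Jacobi matrix, the essential spectrum is
`[-2,2]` and the eigenvalues satisfy `∑ (|E_j| - 2)^{1/2} < ∞`
(Hundertmark–Simon). -/
theorem hundertmark_simon
    (a b : ℕ → ℝ) (hpos : ∀ n, 1 ≤ n → 0 < a n)
    (hsum : Summable fun n : ℕ => |a (n + 1) - 1| + |b (n + 1)|)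
    (μ : Measure ℝ) (hprob : IsProbabilityMeasure μ)
    (hcpt : IsCompact (msupport μ)) (hinf : (msupport μ).Infinite)
    (hJ : IsJacobiParams μ a b) :
    essSpec μ = Set.Icc (-2 : ℝ) 2 ∧
      ∑' E : ↥(msupport μ \ Set.Icc (-2 : ℝ) 2),
          ENNReal.ofReal ((|(E : ℝ)| - 2) ^ ((1 : ℝ) / 2)) < ⊤ := by
  obtain ⟨p, h⟩ := hJ.exists_system hcpt
  have hd : Summable fun n => |a (n + 1) - 1| :=
    Summable.of_nonneg_of_le (fun n => abs_nonneg _)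
      (fun n => le_add_of_nonneg_right (abs_nonneg _)) hsum
  set V : ℕ → ℝ := fun n =>
    |a (n + 1) - 1| + |b (n + 1)| + |a n - 1| + (1 / 2 : ℝ) ^ n with hV
  have hVs : Summable V :=
    (hsum.add ((summable_nat_add_iff (f := fun n => |a n - 1|) 1).1 hd)).add
      summable_geometric_two
  have hVpos : ∀ n, 0 < V n := fun n => by positivity
  have hVle : ∀ n, |b (n + 1)| + |a (n + 1) - 1| + |a n - 1| ≤ V n := fun n => by
    have : (0 : ℝ) ≤ (1 / 2) ^ n := by positivity
    simp only [hV]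
    linarith
  obtain ⟨s, w, hs, hw0, hws, hbr⟩ := exists_bracketing V hVpos hVs
  have hcount : ∀ σ : ℝ, σ ^ 2 = 1 → ∀ r, 0 < r →
      {x | x ∈ msupport μ ∧ 2 + r < σ * x}.encard ≤ {k | r < w k}.encard := fun σ hσ r hr =>
    h.encard_le hcpt fun g hg =>
      h.integral_form_nonpos hσ V hVle hs (fun u => hbr r u hr.le) g hg
  have hwfin : ∀ r, 0 < r → {k | r < w k}.Finite := by
    intro r hr
    have h1 := hws.tendsto_cofinite_zero.eventually_lt_const (Real.sqrt_pos.2 hr)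
    refine (Filter.eventually_cofinite.1 h1).subset fun k hk => ?_
    exact not_lt.2 (Real.sqrt_le_sqrt (le_of_lt hk))
  have hfin : ∀ σ : ℝ, σ ^ 2 = 1 → ∀ r, 0 < r →
      {x | x ∈ msupport μ ∧ 2 + r < σ * x}.Finite := fun σ hσ r hr =>
    Set.encard_lt_top_iff.1 ((hcount σ hσ r hr).trans_lt (Set.encard_lt_top_iff.2 (hwfin r hr)))
  have hnoacc : ∀ σ : ℝ, σ ^ 2 = 1 → ∀ E ∈ essSpec μ, σ * E ≤ 2 := by
    intro σ hσ E hE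
    by_contra! hlt
    have hr : 0 < (σ * E - 2) / 2 := by linarith
    have hinf' : {x | x ∈ msupport μ ∧ 2 + (σ * E - 2) / 2 < σ * x}.Infinite := by
      have hopen : IsOpen {x : ℝ | 2 + (σ * E - 2) / 2 < σ * x} :=
        isOpen_lt continuous_const (by fun_prop)
      have hmem : {x : ℝ | 2 + (σ * E - 2) / 2 < σ * x} ∈ nhds E :=
        hopen.mem_nhds (by simp only [mem_ofPred_eq]; linarith)
      exact (Set.Infinite.of_accPt (AccPt.nhds_inter hE hmem)).mono fun y hy => ⟨hy.2, hy.1⟩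
    exact hinf' (hfin σ hσ _ hr)
  refine ⟨Set.Subset.antisymm (fun E hE => ?_) (fun E hE => ?_), ?_⟩
  · have h1 := hnoacc 1 (by norm_num) E hE
    have h2 := hnoacc (-1) (by norm_num) E hE
    exact ⟨by linarith, by linarith⟩
  · have hacc : AccPt E (Filter.principal (Icc (-2 : ℝ) 2)) :=
      isPreconnected_Icc.preperfect_of_nontrivial
        ⟨-2, by norm_num, 2, by norm_num, by norm_num⟩ E hE
    exact hacc.mono (Filter.principal_mono.2
      (h.Icc_subset_msupport hVs (fun n => (hVpos n).le) hVle))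
  · have hside : ∀ σ : ℝ, σ ^ 2 = 1 →
        ∑' E : ↥{x | x ∈ msupport μ ∧ 2 < σ * x},
          ENNReal.ofReal ((|(E : ℝ)| - 2) ^ ((1 : ℝ) / 2)) < ⊤ := by
      intro σ hσ
      have hσabs : |σ| = 1 := by rw [← Real.sqrt_sq_eq_abs, hσ, Real.sqrt_one]
      refine lt_of_le_of_lt (tsum_le_tsum_of_encard_le
        (fun E : ↥{x | x ∈ msupport μ ∧ 2 < σ * x} => (|(E : ℝ)| - 2) ^ ((1 : ℝ) / 2))
        (fun k => Real.sqrt (w k)) (fun E => ?_) (fun k => Real.sqrt_nonneg _) fun t ht => ?_)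
        hws.tsum_ofReal_lt_top
      · rw [← Real.sqrt_eq_rpow]
        exact Real.sqrt_nonneg _
      · have hk : {k | t < Real.sqrt (w k)} = {k | t ^ 2 < w k} := by
          ext k
          exact Real.lt_sqrt ht.le
        rw [hk, ← Function.Injective.encard_image Subtype.val_injective]
        refine (Set.encard_le_encard ?_).trans (hcount σ hσ (t ^ 2) (by positivity))
        rintro _ ⟨E, hE, rfl⟩
        rw [mem_ofPred_eq, ← Real.sqrt_eq_rpow, Real.lt_sqrt ht.le] at hE
        refine ⟨E.2.1, ?_⟩
        have h1 : |(E : ℝ)| = σ * E := by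
          have := E.2.2
          rw [← abs_of_pos (by linarith : 0 < σ * (E : ℝ)), abs_mul, hσabs, one_mul]
        linarith
    have hset : msupport μ \ Icc (-2 : ℝ) 2 ⊆
        {x | x ∈ msupport μ ∧ 2 < 1 * x} ∪ {x | x ∈ msupport μ ∧ 2 < -1 * x} := by
      rintro x ⟨hx, hx2⟩
      by_cases h2 : 2 < x
      · exact Or.inl ⟨hx, by linarith⟩
      · refine Or.inr ⟨hx, ?_⟩
        by_contra! h3
        exact hx2 ⟨by linarith, not_lt.1 h2⟩
    set F : ℝ → ENNReal := fun x => ENNReal.ofReal ((|x| - 2) ^ ((1 : ℝ) / 2))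
    exact lt_of_le_of_lt
      ((ENNReal.tsum_mono_subtype F hset).trans (ENNReal.tsum_union_le F _ _))
      (ENNReal.add_lt_top.2 ⟨hside 1 (by norm_num), hside (-1) (by norm_num)⟩)
end
end
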